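/- Assume the inverse temperature sequence (β_N)_{N≥1} with β_N ∈ (0,1) satisfies lim_{N→∞} β_N = 1 and lim_{N→∞} N^{1/3}(1 − β_N²) = c where c ∈ (0,∞) or c = ∞. Then there exists a finite constant L (depending on (β_N)) such that for all t ∈ [0,1] and all N ≥ 1, E| N·⟨R(σ,τ)²⟩_t − 1/(1 − β_N² t) |² ≤ L·N^{−3/4}·(1 − β_N²)^{−53/24}·(1 − β_N² t)^{−49/24} + L·N^{−1/2}·(1 − β_N²)^{−4/3}·(1 − β_N² t)^{−13/6}. -/

import Mathlib

open MeasureTheory ProbabilityTheory Real Finset Filter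

noncomputable section

/-- Spin configurations: each of the `N` sites carries a `±1` spin, encoded by a `Bool`. -/
abbrev Config (N : ℕ) := Fin N → Bool

/-- The `±1` value of a spin. -/
def spin (b : Bool) : ℝ := if b then 1 else -1

/-- The value of the last spin `σ_N` (junk value `0` when `N = 0`). -/
def spinLast {N : ℕ} (σ : Config N) : ℝ :=
  if h : 0 < N then spin (σ ⟨N - 1, Nat.sub_lt h Nat.one_pos⟩) else 0

/-- The Gaussian disorder: i.i.d. standard Gaussians indexed by pairs `(i, j)`
(only the entries with `i < j` are used). -/
def gaussPi (N : ℕ) : Measure (Fin N × Fin N → ℝ) :=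
  Measure.pi fun _ => gaussianReal 0 1

instance (N : ℕ) : IsProbabilityMeasure (gaussPi N) := by
  unfold gaussPi; infer_instance

/-- Three independent copies `g, g', g''` of the disorder. -/
def disM3 (N : ℕ) :
    Measure ((Fin N × Fin N → ℝ) × (Fin N × Fin N → ℝ) × (Fin N × Fin N → ℝ)) :=
  (gaussPi N).prod ((gaussPi N).prod (gaussPi N))

/-- The SK Hamiltonian `H_{N,β}(σ) = (β/√N) ∑_{i<j} g_{ij} σ_i σ_j`. -/
def ham (N : ℕ) (β : ℝ) (g : Fin N × Fin N → ℝ) (σ : Config N) : ℝ :=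
  (β / Real.sqrt N) *
    ∑ p ∈ Finset.univ.filter (fun p : Fin N × Fin N => p.1 < p.2),
      g p * spin (σ p.1) * spin (σ p.2)

/-- The cavity Hamiltonian `H⁻_N(σ) = (β/√N) ∑_{i<j<N} g_{ij} σ_i σ_j` on the first
`N - 1` spins. -/
def hamCav (N : ℕ) (β : ℝ) (g : Fin N × Fin N → ℝ) (σ : Config N) : ℝ :=
  (β / Real.sqrt N) *
    ∑ p ∈ Finset.univ.filter
        (fun p : Fin N × Fin N => p.1 < p.2 ∧ (p.2 : ℕ) < N - 1),
      g p * spin (σ p.1) * spin (σ p.2)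

/-- The overlap `R(σ¹,σ²) = (1/N) ∑_{i ≤ N} σ_i¹ σ_i²`. -/
def ovlp (N : ℕ) (σ τ : Config N) : ℝ := (∑ i, spin (σ i) * spin (τ i)) / N

/-- The truncated overlap `R⁻(σ¹,σ²) = (1/N) ∑_{i ≤ N−1} σ_i¹ σ_i²`. -/
def ovlpm (N : ℕ) (σ τ : Config N) : ℝ :=
  (∑ i ∈ Finset.univ.filter (fun i : Fin N => (i : ℕ) < N - 1),
    spin (σ i) * spin (τ i)) / N

/-- The partition function `Z_N(β)`. -/
def partFun (N : ℕ) (β : ℝ) (g : Fin N × Fin N → ℝ) : ℝ :=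
  ∑ σ : Config N, Real.exp (ham N β g σ)

/-- The free energy `F_N(β) = ln Z_N(β)`. -/
def freeEnergy (N : ℕ) (β : ℝ) (g : Fin N × Fin N → ℝ) : ℝ :=
  Real.log (partFun N β g)

/-- Two-replica Gibbs average `⟨f⟩` for the single SK system. -/
def gibbs2 (N : ℕ) (β : ℝ) (g : Fin N × Fin N → ℝ)
    (f : Config N → Config N → ℝ) : ℝ :=
  (∑ σ : Config N, ∑ τ : Config N,
    f σ τ * Real.exp (ham N β g σ + ham N β g τ)) / (partFun N β g) ^ 2

/-- Disorder expectation of the two-replica Gibbs average. -/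
def Egibbs2 (N : ℕ) (β : ℝ) (f : Config N → Config N → ℝ) : ℝ :=
  ∫ g, gibbs2 N β g f ∂gaussPi N

/-- The interpolated Hamiltonian `√t · H_N + √(1−t) · H'_N`. -/
def hamT (N : ℕ) (β t : ℝ) (g g' : Fin N × Fin N → ℝ) (σ : Config N) : ℝ :=
  Real.sqrt t * ham N β g σ + Real.sqrt (1 - t) * ham N β g' σ

/-- The coupled Gibbs weight `exp(H¹_{N,t}(σ) + H²_{N,t}(τ))`. -/
def wT (N : ℕ) (β t : ℝ) (g g' g'' : Fin N × Fin N → ℝ)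
    (ρ : Config N × Config N) : ℝ :=
  Real.exp (hamT N β t g g' ρ.1 + hamT N β t g g'' ρ.2)

/-- The coupled Gibbs average `⟨f⟩_t` of a function of one pair `(σ, τ)`. -/
def gibbsT (N : ℕ) (β t : ℝ) (g g' g'' : Fin N × Fin N → ℝ)
    (f : Config N × Config N → ℝ) : ℝ :=
  (∑ ρ : Config N × Config N, f ρ * wT N β t g g' g'' ρ) /
    (∑ ρ : Config N × Config N, wT N β t g g' g'' ρ)

/-- The coupled Gibbs average `⟨f⟩_t` of a function of two pairs. -/
def gibbsT2 (N : ℕ) (β t : ℝ) (g g' g'' : Fin N × Fin N → ℝ)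
    (f : Config N × Config N → Config N × Config N → ℝ) : ℝ :=
  (∑ ρ₁ : Config N × Config N, ∑ ρ₂ : Config N × Config N,
    f ρ₁ ρ₂ * wT N β t g g' g'' ρ₁ * wT N β t g g' g'' ρ₂) /
    (∑ ρ : Config N × Config N, wT N β t g g' g'' ρ) ^ 2

/-- Disorder expectation `E⟨f⟩_t` (one pair). -/
def EgibbsT (N : ℕ) (β t : ℝ) (f : Config N × Config N → ℝ) : ℝ :=
  ∫ ω, gibbsT N β t ω.1 ω.2.1 ω.2.2 f ∂disM3 N

/-- Disorder expectation `E⟨f⟩_t` (two pairs). -/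
def EgibbsT2 (N : ℕ) (β t : ℝ)
    (f : Config N × Config N → Config N × Config N → ℝ) : ℝ :=
  ∫ ω, gibbsT2 N β t ω.1 ω.2.1 ω.2.2 f ∂disM3 N

/-- The `s`-dependent cavity field term
`(β/√N) σ_N ∑_{i<N} (√t g_{iN} + √(1−t) g'_{iN}) σ_i`. -/
def cavField (N : ℕ) (β t : ℝ) (g g' : Fin N × Fin N → ℝ) (σ : Config N) : ℝ :=
  if h : 0 < N then
    (β / Real.sqrt N) * spin (σ ⟨N - 1, Nat.sub_lt h Nat.one_pos⟩) *
      ∑ i ∈ Finset.univ.filter (fun i : Fin N => (i : ℕ) < N - 1),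
        (Real.sqrt t * g (i, ⟨N - 1, Nat.sub_lt h Nat.one_pos⟩) +
          Real.sqrt (1 - t) * g' (i, ⟨N - 1, Nat.sub_lt h Nat.one_pos⟩)) * spin (σ i)
  else 0

/-- The cavity-interpolated Hamiltonian `H^1_{N,t,s}` (resp. `H^2_{N,t,s}` with `g''`). -/
def hamTS (N : ℕ) (β t s : ℝ) (g g' : Fin N × Fin N → ℝ) (σ : Config N) : ℝ :=
  Real.sqrt t * hamCav N β g σ + Real.sqrt (1 - t) * hamCav N β g' σ +
    Real.sqrt s * cavField N β t g g' σ

/-- The coupled cavity Gibbs weight `exp(H¹_{N,t,s}(σ) + H²_{N,t,s}(τ))`. -/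
def wTS (N : ℕ) (β t s : ℝ) (g g' g'' : Fin N × Fin N → ℝ)
    (ρ : Config N × Config N) : ℝ :=
  Real.exp (hamTS N β t s g g' ρ.1 + hamTS N β t s g g'' ρ.2)

/-- The coupled cavity Gibbs average `⟨f⟩_{t,s}` of a function of one pair. -/
def gibbsTS1 (N : ℕ) (β t s : ℝ) (g g' g'' : Fin N × Fin N → ℝ)
    (f : Config N × Config N → ℝ) : ℝ :=
  (∑ ρ : Config N × Config N, f ρ * wTS N β t s g g' g'' ρ) /
    (∑ ρ : Config N × Config N, wTS N β t s g g' g'' ρ)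

/-- The coupled cavity Gibbs average `⟨f⟩_{t,s}` of a function of two pairs. -/
def gibbsTS2 (N : ℕ) (β t s : ℝ) (g g' g'' : Fin N × Fin N → ℝ)
    (f : Config N × Config N → Config N × Config N → ℝ) : ℝ :=
  (∑ ρ₁ : Config N × Config N, ∑ ρ₂ : Config N × Config N,
    f ρ₁ ρ₂ * wTS N β t s g g' g'' ρ₁ * wTS N β t s g g' g'' ρ₂) /
    (∑ ρ : Config N × Config N, wTS N β t s g g' g'' ρ) ^ 2

/-- The coupled cavity Gibbs average `⟨f⟩_{t,s}` of a function of `n` pairs. -/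
def gibbsTSn (N : ℕ) (β t s : ℝ) (g g' g'' : Fin N × Fin N → ℝ) {n : ℕ}
    (f : (Fin n → Config N × Config N) → ℝ) : ℝ :=
  (∑ ρ : Fin n → Config N × Config N, f ρ * ∏ l, wTS N β t s g g' g'' (ρ l)) /
    (∑ ρ₀ : Config N × Config N, wTS N β t s g g' g'' ρ₀) ^ n

/-- Disorder expectation `E⟨f⟩_{t,s}` (one pair). -/
def EgibbsTS1 (N : ℕ) (β t s : ℝ) (f : Config N × Config N → ℝ) : ℝ :=
  ∫ ω, gibbsTS1 N β t s ω.1 ω.2.1 ω.2.2 f ∂disM3 N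

/-- Disorder expectation `E⟨f⟩_{t,s}` (two pairs). -/
def EgibbsTS2 (N : ℕ) (β t s : ℝ)
    (f : Config N × Config N → Config N × Config N → ℝ) : ℝ :=
  ∫ ω, gibbsTS2 N β t s ω.1 ω.2.1 ω.2.2 f ∂disM3 N

/-- Disorder expectation `E⟨f⟩_{t,s}` (`n` pairs). -/
def EgibbsTSn (N : ℕ) (β t s : ℝ) {n : ℕ}
    (f : (Fin n → Config N × Config N) → ℝ) : ℝ :=
  ∫ ω, gibbsTSn N β t s ω.1 ω.2.1 ω.2.2 f ∂disM3 N

/-- The covariance kernel `U(ρ, ρ')` of the `s`-part of the coupled cavity Hamiltonians. -/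
def Ufun (N : ℕ) (β t : ℝ) (ρ ρ' : Config N × Config N) : ℝ :=
  β ^ 2 / 2 * (spinLast ρ.1 * spinLast ρ'.1 * ovlpm N ρ.1 ρ'.1 +
      spinLast ρ.2 * spinLast ρ'.2 * ovlpm N ρ.2 ρ'.2) +
    β ^ 2 * t / 2 * (spinLast ρ.1 * spinLast ρ'.2 * ovlpm N ρ.1 ρ'.2 +
      spinLast ρ.2 * spinLast ρ'.1 * ovlpm N ρ.2 ρ'.1)

/-- `ν(β) = −(1/2)·ln(1 − β²) − β²/2`. -/
def nuSK (b : ℝ) : ℝ := -(1 / 2) * Real.log (1 - b ^ 2) - b ^ 2 / 2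

set_option linter.unusedSectionVars false

section GaussianVectors

/-- The law of a vector of i.i.d. standard Gaussian variables indexed by `κ`. -/
def gaussVec (κ : Type*) [Fintype κ] : Measure (κ → ℝ) :=
  Measure.pi fun _ => gaussianReal 0 1

instance (κ : Type*) [Fintype κ] : IsProbabilityMeasure (gaussVec κ) := by
  unfold gaussVec; infer_instance

lemma hasDerivAt_gaussianPDFReal (x : ℝ) :
    HasDerivAt (gaussianPDFReal 0 1) (-(x * gaussianPDFReal 0 1 x)) x := by
  unfold gaussianPDFReal
  have h : HasDerivAt (fun x : ℝ => -(x - 0) ^ 2 / (2 * ((1 : NNReal) : ℝ))) (-x) x := by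
    have := (((hasDerivAt_id x).sub_const 0).pow 2).neg.div_const (2 * ((1 : NNReal) : ℝ))
    refine this.congr_deriv ?_
    simp only [id_eq, sub_zero, NNReal.coe_one]
    norm_num
    ring
  exact (h.exp.const_mul _).congr_deriv (by ring)

lemma integrable_mul_gaussianPDFReal : Integrable (fun x : ℝ => x * gaussianPDFReal 0 1 x) := by
  have h := integrable_mul_exp_neg_mul_sq (b := 1 / 2) (by norm_num)
  refine (h.const_mul (√(2 * π))⁻¹).congr (ae_of_all _ fun x => ?_)
  simp only [gaussianPDFReal, NNReal.coe_one, mul_one, sub_zero]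
  rw [show -(1 / 2) * x ^ 2 = -x ^ 2 / 2 by ring]
  ring

/-- One-dimensional Gaussian integration by parts. -/
lemma integral_id_mul_gaussianReal {F F' : ℝ → ℝ} (hF : ∀ x, HasDerivAt F (F' x) x)
    (hF' : Continuous F') {C : ℝ} (hC : ∀ x, |F x| ≤ C) (hC' : ∀ x, |F' x| ≤ C) :
    ∫ x, x * F x ∂gaussianReal 0 1 = ∫ x, F' x ∂gaussianReal 0 1 := by
  have hFc : Continuous F := continuous_iff_continuousAt.2 fun x => (hF x).continuousAt
  rw [integral_gaussianReal_eq_integral_smul one_ne_zero,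
    integral_gaussianReal_eq_integral_smul one_ne_zero]
  have h := integral_mul_deriv_eq_deriv_mul_of_integrable (u := F) (u' := F')
    (v := gaussianPDFReal 0 1) (v' := fun x => -(x * gaussianPDFReal 0 1 x))
    (fun x _ => hF x) (fun x _ => hasDerivAt_gaussianPDFReal x)
    (integrable_mul_gaussianPDFReal.neg.bdd_mul hFc.aestronglyMeasurable
      (ae_of_all _ fun x => hC x))
    ((integrable_gaussianPDFReal 0 1).bdd_mul hF'.aestronglyMeasurable
      (ae_of_all _ fun x => hC' x))
    ((integrable_gaussianPDFReal 0 1).bdd_mul hFc.aestronglyMeasurable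
      (ae_of_all _ fun x => hC x))
  have e1 : ∫ x, gaussianPDFReal 0 1 x • (x * F x) =
      -∫ x, F x * -(x * gaussianPDFReal 0 1 x) := by
    rw [← integral_neg]; congr 1; ext x; simp only [smul_eq_mul]; ring
  have e2 : ∫ x, gaussianPDFReal 0 1 x • F' x = ∫ x, F' x * gaussianPDFReal 0 1 x := by
    congr 1; ext x; simp only [smul_eq_mul]; ring
  rw [e1, e2, h, neg_neg]

variable {κ : Type*} [Fintype κ] [DecidableEq κ]

/-- Resampling one coordinate preserves the law of a Gaussian vector. -/
lemma measurePreserving_update (k : κ) :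
    MeasurePreserving (fun p : (κ → ℝ) × ℝ => Function.update p.1 k p.2)
      ((gaussVec κ).prod (gaussianReal 0 1)) (gaussVec κ) := by
  have hm : Measurable (fun p : (κ → ℝ) × ℝ => Function.update p.1 k p.2) := by
    refine measurable_pi_iff.2 fun j => ?_
    by_cases hj : j = k
    · subst hj; simpa using measurable_snd
    · simp only [Function.update_of_ne hj]
      exact (measurable_pi_apply j).comp measurable_fst
  refine ⟨hm, ?_⟩
  symm
  refine Measure.pi_eq fun s hs => ?_
  rw [Measure.map_apply hm (MeasurableSet.univ_pi hs)]
  have : (fun p : (κ → ℝ) × ℝ => Function.update p.1 k p.2) ⁻¹' Set.univ.pi s =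
      (Set.univ.pi (Function.update s k Set.univ)) ×ˢ s k := by
    ext ⟨x, y⟩
    simp only [Set.mem_preimage, Set.mem_pi, Set.mem_univ, true_imp_iff, Set.mem_prod]
    constructor
    · intro h
      refine ⟨fun j => ?_, by simpa using h k⟩
      by_cases hj : j = k
      · subst hj; simp
      · simpa [Function.update_of_ne hj] using h j
    · rintro ⟨h, h'⟩ j
      by_cases hj : j = k
      · subst hj; simpa using h'
      · simpa [Function.update_of_ne hj] using h j
  rw [this, Measure.prod_prod, gaussVec, Measure.pi_pi,
    ← Finset.mul_prod_erase _ _ (mem_univ k),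
    ← Finset.mul_prod_erase univ (fun i => gaussianReal 0 1 (s i)) (mem_univ k)]
  simp only [Function.update_self, measure_univ, one_mul]
  rw [mul_comm]
  congr 1
  refine Finset.prod_congr rfl fun j hj => ?_
  rw [Function.update_of_ne (Finset.ne_of_mem_erase hj)]

lemma integral_gaussVec_update (k : κ) {G : (κ → ℝ) → ℝ} (hG : Integrable G (gaussVec κ)) :
    ∫ ω, G ω ∂gaussVec κ =
      ∫ ω, ∫ x, G (Function.update ω k x) ∂gaussianReal 0 1 ∂gaussVec κ := by
  have hmp := measurePreserving_update k
  have h1 : ∫ ω, G ω ∂gaussVec κ =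
      ∫ p, G (Function.update p.1 k p.2) ∂((gaussVec κ).prod (gaussianReal 0 1)) := by
    conv_lhs => rw [← hmp.map_eq]
    exact integral_map hmp.measurable.aemeasurable (by rw [hmp.map_eq]; exact hG.1)
  rw [h1]
  exact integral_prod _ (hmp.integrable_comp_of_integrable hG)

lemma integrable_eval_gaussVec (k : κ) : Integrable (fun ω : κ → ℝ => ω k) (gaussVec κ) := by
  have h : MeasurePreserving (Function.eval k) (gaussVec κ) (gaussianReal 0 1) :=
    measurePreserving_eval _ k
  have h2 : Integrable (id : ℝ → ℝ) (gaussianReal 0 1) :=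
    memLp_one_iff_integrable.1 (memLp_id_gaussianReal 1)
  exact (h.integrable_comp_of_integrable h2)

/-- Gaussian integration by parts. -/
lemma integral_eval_mul_gaussVec (k : κ) {F F' : (κ → ℝ) → ℝ}
    (hF : ∀ ω x, HasDerivAt (fun y => F (Function.update ω k y)) (F' (Function.update ω k x)) x)
    (hFc : Continuous F) (hF' : Continuous F') {C : ℝ} (hC : ∀ x, |F x| ≤ C)
    (hC' : ∀ x, |F' x| ≤ C) :
    ∫ ω, ω k * F ω ∂gaussVec κ = ∫ ω, F' ω ∂gaussVec κ := by
  have hi1 : Integrable (fun ω => ω k * F ω) (gaussVec κ) :=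
    (integrable_eval_gaussVec k).mul_bdd hFc.aestronglyMeasurable (ae_of_all _ fun x => hC x)
  have hi2 : Integrable F' (gaussVec κ) :=
    Integrable.of_bound hF'.aestronglyMeasurable C (ae_of_all _ fun x => hC' x)
  rw [integral_gaussVec_update k hi1, integral_gaussVec_update k hi2]
  congr 1
  ext ω
  have hu : Continuous fun x : ℝ => Function.update ω k x :=
    continuous_const.update k continuous_id
  have := integral_id_mul_gaussianReal (hF ω) (hF'.comp hu) (fun x => hC _) (fun x => hC' _)
  simpa using this

end GaussianVectors

section GibbsAverages

variable {S : Type*} [Fintype S] [Nonempty S]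

/-- The Gibbs probability with weights `exp (H x)`. -/
def gibbsProb (H : S → ℝ) (x : S) : ℝ := exp (H x) / ∑ y, exp (H y)

/-- The Gibbs average of a function of `n` replicas. -/
def gav (H : S → ℝ) {n : ℕ} (f : (Fin n → S) → ℝ) : ℝ :=
  ∑ ρ, f ρ * ∏ l, gibbsProb H (ρ l)

lemma sum_exp_pos (H : S → ℝ) : 0 < ∑ y, exp (H y) :=
  Finset.sum_pos (fun _ _ => exp_pos _) univ_nonempty

lemma gibbsProb_pos (H : S → ℝ) (x : S) : 0 < gibbsProb H x :=
  div_pos (exp_pos _) (sum_exp_pos H)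

lemma sum_gibbsProb (H : S → ℝ) : ∑ x, gibbsProb H x = 1 := by
  simp only [gibbsProb]
  rw [← Finset.sum_div, div_self (sum_exp_pos H).ne']

lemma sum_prod_gibbsProb (H : S → ℝ) (n : ℕ) :
    ∑ ρ : Fin n → S, ∏ l, gibbsProb H (ρ l) = 1 := by
  rw [← Fintype.prod_sum (fun _ : Fin n => gibbsProb H)]
  simp [sum_gibbsProb]

lemma prod_gibbsProb_nonneg (H : S → ℝ) {n : ℕ} (ρ : Fin n → S) :
    0 ≤ ∏ l, gibbsProb H (ρ l) :=
  Finset.prod_nonneg fun _ _ => (gibbsProb_pos H _).le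

lemma prod_gibbsProb_le_one (H : S → ℝ) {n : ℕ} (ρ : Fin n → S) :
    ∏ l, gibbsProb H (ρ l) ≤ 1 := by
  rw [← sum_prod_gibbsProb H n]
  exact Finset.single_le_sum (f := fun ρ : Fin n → S => ∏ l, gibbsProb H (ρ l))
    (fun ρ _ => prod_gibbsProb_nonneg H ρ) (mem_univ ρ)

lemma abs_gav_le (H : S → ℝ) {n : ℕ} (f : (Fin n → S) → ℝ) : |gav H f| ≤ ∑ ρ, |f ρ| := by
  refine (Finset.abs_sum_le_sum_abs _ _).trans (Finset.sum_le_sum fun ρ _ => ?_)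
  rw [abs_mul, abs_of_nonneg (prod_gibbsProb_nonneg H ρ)]
  exact mul_le_of_le_one_right (abs_nonneg _) (prod_gibbsProb_le_one H ρ)

/-- The derivative operator of the Gibbs average in the direction `a`. -/
def dirOp (a : S → ℝ) {n : ℕ} (f : (Fin n → S) → ℝ) (ρ : Fin (n + 1) → S) : ℝ :=
  f (Fin.init ρ) * (∑ l : Fin n, a (ρ l.castSucc) - n * a (ρ (Fin.last n)))

lemma prod_gibbsProb_eq_exp (H : S → ℝ) {n : ℕ} (ρ : Fin n → S) :
    ∏ l, gibbsProb H (ρ l) = exp (∑ l, H (ρ l) - n * log (∑ y, exp (H y))) := by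
  have h : ∀ x, gibbsProb H x = exp (H x - log (∑ y, exp (H y))) := fun x => by
    rw [exp_sub, exp_log (sum_exp_pos H), gibbsProb]
  simp only [h, ← exp_sum, Finset.sum_sub_distrib, Finset.sum_const, card_univ, Fintype.card_fin,
    nsmul_eq_mul]

lemma gav_snoc (H : S → ℝ) {n : ℕ} (f : (Fin (n + 1) → S) → ℝ) :
    gav H f = ∑ ρ : Fin n → S, (∑ y, f (Fin.snoc (α := fun _ => S) ρ y) * gibbsProb H y) *
      ∏ l, gibbsProb H (ρ l) := by
  unfold gav
  rw [← (Fin.snocEquiv fun _ => S).sum_comp, Fintype.sum_prod_type, Finset.sum_comm]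
  refine Finset.sum_congr rfl fun ρ _ => ?_
  rw [Finset.sum_mul]
  refine Finset.sum_congr rfl fun y _ => ?_
  simp only [Fin.snocEquiv, Equiv.coe_fn_mk, Fin.prod_univ_castSucc, Fin.snoc_castSucc,
    Fin.snoc_last]
  ring

lemma hasDerivAt_gav {H : ℝ → S → ℝ} {a : S → ℝ} {s : ℝ}
    (hH : ∀ x, HasDerivAt (fun s => H s x) (a x) s) {n : ℕ} (f : (Fin n → S) → ℝ) :
    HasDerivAt (fun s => gav (H s) f) (gav (H s) (dirOp a f)) s := by
  have hZ : HasDerivAt (fun s => log (∑ y, exp (H s y))) (∑ y, a y * gibbsProb (H s) y) s := by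
    have h1 : HasDerivAt (fun s => ∑ y, exp (H s y)) (∑ y, exp (H s y) * a y) s :=
      HasDerivAt.fun_sum fun y _ => (hH y).exp
    refine (h1.log (sum_exp_pos (H s)).ne').congr_deriv ?_
    rw [Finset.sum_div]
    exact Finset.sum_congr rfl fun y _ => by rw [gibbsProb]; ring
  have hρ : ∀ ρ : Fin n → S, HasDerivAt (fun s => f ρ * ∏ l, gibbsProb (H s) (ρ l))
      (f ρ * (∑ l, a (ρ l) - n * ∑ y, a y * gibbsProb (H s) y) *
        ∏ l, gibbsProb (H s) (ρ l)) s := by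
    intro ρ
    simp only [prod_gibbsProb_eq_exp]
    have h2 : HasDerivAt (fun s => ∑ l, H s (ρ l)) (∑ l, a (ρ l)) s :=
      HasDerivAt.fun_sum fun l _ => hH (ρ l)
    exact (((h2.sub (hZ.const_mul (n : ℝ))).exp).const_mul (f ρ)).congr_deriv (by
      simp only [Pi.sub_apply]; ring)
  have hsum := HasDerivAt.fun_sum (u := univ) fun ρ _ => hρ ρ
  refine hsum.congr_deriv ?_
  rw [gav_snoc]
  refine Finset.sum_congr rfl fun ρ _ => ?_
  congr 1
  simp only [dirOp, Fin.init_snoc, Fin.snoc_castSucc, Fin.snoc_last]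
  have h3 : ∀ y, f ρ * (∑ l, a (ρ l) - n * a y) * gibbsProb (H s) y =
      f ρ * (∑ l, a (ρ l)) * gibbsProb (H s) y - f ρ * n * (a y * gibbsProb (H s) y) :=
    fun y => by ring
  simp only [h3, Finset.sum_sub_distrib, ← Finset.mul_sum, sum_gibbsProb]
  ring

lemma continuous_gav {X : Type*} [TopologicalSpace X] {H : X → S → ℝ}
    (hH : ∀ x, Continuous fun s => H s x) {n : ℕ} (f : (Fin n → S) → ℝ) :
    Continuous fun s => gav (H s) f := by
  unfold gav gibbsProb
  refine continuous_finsetSum _ fun ρ _ => continuous_const.mul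
    (continuous_finsetProd _ fun l _ => ((hH _).rexp).div₀
      (continuous_finsetSum _ fun y _ => (hH y).rexp) fun s => (sum_exp_pos (H s)).ne')

variable {κ : Type*} [Fintype κ] [DecidableEq κ]

/-- The linear Gaussian exponent with coefficients `c`. -/
def linH (c : κ → S → ℝ) (ω : κ → ℝ) (x : S) : ℝ := ∑ k, c k x * ω k

/-- The disorder average of the Gibbs average. -/
def nu (c : κ → S → ℝ) {n : ℕ} (f : (Fin n → S) → ℝ) : ℝ :=
  ∫ ω, gav (linH c ω) f ∂gaussVec κ

lemma continuous_gav_linH (c : κ → S → ℝ) {n : ℕ} (f : (Fin n → S) → ℝ) :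
    Continuous fun ω => gav (linH c ω) f := by
  refine continuous_gav (fun x => ?_) f
  unfold linH
  fun_prop

lemma integrable_gav_linH (c : κ → S → ℝ) {n : ℕ} (f : (Fin n → S) → ℝ) :
    Integrable (fun ω => gav (linH c ω) f) (gaussVec κ) :=
  Integrable.of_bound (continuous_gav_linH c f).aestronglyMeasurable _
    (ae_of_all _ fun _ => abs_gav_le _ f)

/-- Gaussian integration by parts for Gibbs averages. -/
lemma integral_eval_mul_gav (c : κ → S → ℝ) (k : κ) {n : ℕ} (f : (Fin n → S) → ℝ) :
    ∫ ω, ω k * gav (linH c ω) f ∂gaussVec κ = nu c (dirOp (c k) f) := by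
  unfold nu
  refine integral_eval_mul_gaussVec k (fun ω x => ?_) (continuous_gav_linH c f)
    (continuous_gav_linH c _) (C := max (∑ ρ, |f ρ|) (∑ ρ, |dirOp (c k) f ρ|))
    (fun ω => (abs_gav_le _ _).trans (le_max_left _ _))
    (fun ω => (abs_gav_le _ _).trans (le_max_right _ _))
  refine hasDerivAt_gav (H := fun y => linH c (Function.update ω k y)) (fun z => ?_) f
  unfold linH
  have : ∀ j ∈ (univ : Finset κ), HasDerivAt (fun y => c j z * Function.update ω k y j)
      (c j z * if j = k then 1 else 0) x := by
    intro j _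
    refine HasDerivAt.const_mul _ ?_
    by_cases hj : j = k
    · subst hj; simpa using hasDerivAt_id' x
    · simpa [hj] using hasDerivAt_const x (ω j)
  exact (HasDerivAt.fun_sum this).congr_deriv (by simp)

end GibbsAverages

section CavityInterpolation

variable {S : Type*} [Fintype S] [Nonempty S] {κ : Type*} [Fintype κ] [DecidableEq κ]

/-- Coefficients of the interpolated exponent: the coordinates in `T` are scaled by `√s`. -/
def coefS (b : κ → S → ℝ) (T : Finset κ) (s : ℝ) (k : κ) (x : S) : ℝ :=
  if k ∈ T then √s * b k x else b k x

lemma coefS_one (b : κ → S → ℝ) (T : Finset κ) : coefS b T 1 = b := by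
  ext k x; simp [coefS]

lemma gav_add (H : S → ℝ) {n : ℕ} (f g : (Fin n → S) → ℝ) :
    gav H (fun ρ => f ρ + g ρ) = gav H f + gav H g := by
  simp only [gav, add_mul, Finset.sum_add_distrib]

lemma gav_const_mul (H : S → ℝ) {n : ℕ} (c : ℝ) (f : (Fin n → S) → ℝ) :
    gav H (fun ρ => c * f ρ) = c * gav H f := by
  simp only [gav, mul_assoc, Finset.mul_sum]

lemma gav_finset_sum (H : S → ℝ) {n : ℕ} {ι : Type*} (A : Finset ι)
    (f : ι → (Fin n → S) → ℝ) :
    gav H (fun ρ => ∑ i ∈ A, f i ρ) = ∑ i ∈ A, gav H (f i) := by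
  simp only [gav, Finset.sum_mul]
  exact Finset.sum_comm

lemma dirOp_sum (A : Finset κ) (q : κ → ℝ) (a : κ → S → ℝ) {n : ℕ} (f : (Fin n → S) → ℝ) :
    dirOp (fun x => ∑ k ∈ A, q k * a k x) f = fun ρ => ∑ k ∈ A, q k * dirOp (a k) f ρ := by
  ext ρ
  simp only [dirOp]
  rw [Finset.sum_comm, Finset.mul_sum, ← Finset.sum_sub_distrib, Finset.mul_sum]
  refine Finset.sum_congr rfl fun k _ => ?_
  rw [← Finset.mul_sum]
  ring

lemma continuous_nu_coefS (b : κ → S → ℝ) (T : Finset κ) {n : ℕ} (f : (Fin n → S) → ℝ) :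
    Continuous fun s => nu (coefS b T s) f := by
  unfold nu
  refine continuous_of_dominated (bound := fun _ => ∑ ρ, |f ρ|)
    (fun s => (continuous_gav_linH _ f).aestronglyMeasurable)
    (fun s => ae_of_all _ fun ω => abs_gav_le _ f) (integrable_const _)
    (ae_of_all _ fun ω => continuous_gav (fun x => ?_) f)
  unfold linH coefS
  refine continuous_finsetSum _ fun k _ => ?_
  by_cases hk : k ∈ T
  · simp only [hk, if_true]; fun_prop
  · simp only [hk, if_false]; fun_prop

lemma hasDerivAt_nu_coefS_dirOp (b : κ → S → ℝ) (T : Finset κ) {n : ℕ} (f : (Fin n → S) → ℝ)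
    {s : ℝ} (hs : 0 < s) :
    HasDerivAt (fun s => nu (coefS b T s) f)
      (1 / 2 * ∑ k ∈ T, nu (coefS b T s) (dirOp (b k) (dirOp (b k) f))) s := by
  set F' : ℝ → (κ → ℝ) → ℝ := fun u ω =>
    ∑ k ∈ T, (1 / (2 * √u)) * (ω k * gav (linH (coefS b T u) ω) (dirOp (b k) f)) with hF'
  have hcont : ∀ u, Continuous (F' u) := fun u => by
    refine continuous_finsetSum _ fun k _ => continuous_const.mul
      ((continuous_apply k).mul (continuous_gav_linH _ _))
  have hderiv : ∀ ω, ∀ u ∈ Set.Ioi (s / 2),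
      HasDerivAt (fun u => gav (linH (coefS b T u) ω) f) (F' u ω) u := by
    intro ω u hu
    have hu0 : 0 < u := lt_trans (half_pos hs) hu
    have h1 : ∀ x, HasDerivAt (fun u => linH (coefS b T u) ω x)
        (∑ k ∈ T, (1 / (2 * √u) * ω k) * b k x) u := by
      intro x
      have h2 : ∀ k ∈ (univ : Finset κ), HasDerivAt (fun u => coefS b T u k x * ω k)
          (if k ∈ T then (1 / (2 * √u) * ω k) * b k x else 0) u := by
        intro k _
        by_cases hk : k ∈ T
        · simp only [coefS, hk, if_true]
          exact (((hasDerivAt_sqrt hu0.ne').mul_const (b k x)).mul_const (ω k)).congr_deriv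
            (by ring)
        · simp only [coefS, hk, if_false]
          exact hasDerivAt_const _ _
      exact (HasDerivAt.fun_sum h2).congr_deriv (by simp)
    refine (hasDerivAt_gav h1 f).congr_deriv ?_
    rw [dirOp_sum, gav_finset_sum]
    refine Finset.sum_congr rfl fun k _ => ?_
    rw [gav_const_mul]; ring
  have hmain := hasDerivAt_integral_of_dominated_loc_of_deriv_le
    (μ := gaussVec κ) (F := fun u ω => gav (linH (coefS b T u) ω) f) (F' := F') (x₀ := s)
    (s := Set.Ioi (s / 2)) (Ioi_mem_nhds (half_lt_self hs))
    (bound := fun ω => ∑ k ∈ T, (1 / (2 * √(s / 2))) * (|ω k| * ∑ ρ, |dirOp (b k) f ρ|))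
    (Eventually.of_forall fun u => (continuous_gav_linH _ f).aestronglyMeasurable)
    (integrable_gav_linH _ f) (hcont s).aestronglyMeasurable
    (ae_of_all _ fun ω u hu => by
      have hu' : s / 2 < u := hu
      refine (norm_sum_le _ _).trans (Finset.sum_le_sum fun k _ => ?_)
      rw [norm_mul, norm_mul, Real.norm_of_nonneg (by positivity), Real.norm_eq_abs,
        Real.norm_eq_abs]
      have := abs_gav_le (linH (coefS b T u) ω) (dirOp (b k) f)
      have h3 : (0 : ℝ) < 2 * √(s / 2) := by positivity
      gcongr)
    (integrable_finsetSum _ fun k _ =>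
      ((integrable_eval_gaussVec k).abs.mul_const _).const_mul _)
    (ae_of_all _ hderiv)
  refine hmain.2.congr_deriv ?_
  have h_int : ∀ k ∈ T, Integrable (fun ω : κ → ℝ => (1 / (2 * √s)) *
      (ω k * gav (linH (coefS b T s) ω) (dirOp (b k) f))) (gaussVec κ) := fun k _ =>
    ((integrable_eval_gaussVec k).mul_bdd (continuous_gav_linH _ _).aestronglyMeasurable
      (ae_of_all _ fun _ => abs_gav_le _ _)).const_mul _
  rw [hF', integral_finsetSum _ h_int, Finset.mul_sum]
  refine Finset.sum_congr rfl fun k hk => ?_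
  rw [integral_const_mul, integral_eval_mul_gav]
  have hc : dirOp (coefS b T s k) (dirOp (b k) f) =
      fun ρ => √s * dirOp (b k) (dirOp (b k) f) ρ := by
    ext ρ
    simp only [dirOp, coefS, hk, if_true, ← Finset.mul_sum]
    ring
  rw [hc, nu]
  simp only [gav_const_mul]
  rw [integral_const_mul, ← nu]
  have hs' : √s ≠ 0 := (sqrt_pos.2 hs).ne'
  field_simp

end CavityInterpolation

section DisorderAverages

variable {S : Type*} [Fintype S] [Nonempty S] {κ : Type*} [Fintype κ] [DecidableEq κ]

lemma nu_add (c : κ → S → ℝ) {n : ℕ} (f g : (Fin n → S) → ℝ) :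
    nu c (fun ρ => f ρ + g ρ) = nu c f + nu c g := by
  simp only [nu, gav_add]
  exact integral_add (integrable_gav_linH c f) (integrable_gav_linH c g)

lemma nu_const_mul (c : κ → S → ℝ) {n : ℕ} (a : ℝ) (f : (Fin n → S) → ℝ) :
    nu c (fun ρ => a * f ρ) = a * nu c f := by
  simp only [nu, gav_const_mul, integral_const_mul]

lemma nu_sub (c : κ → S → ℝ) {n : ℕ} (f g : (Fin n → S) → ℝ) :
    nu c (fun ρ => f ρ - g ρ) = nu c f - nu c g := by
  have h := nu_add c f (fun ρ => (-1) * g ρ)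
  rw [nu_const_mul] at h
  simp only [sub_eq_add_neg]
  simpa using h

lemma nu_finset_sum (c : κ → S → ℝ) {n : ℕ} {ι : Type*} (A : Finset ι)
    (f : ι → (Fin n → S) → ℝ) :
    nu c (fun ρ => ∑ i ∈ A, f i ρ) = ∑ i ∈ A, nu c (f i) := by
  simp only [nu, gav_finset_sum]
  exact integral_finsetSum _ fun i _ => integrable_gav_linH c (f i)

lemma gav_mono (H : S → ℝ) {n : ℕ} {f g : (Fin n → S) → ℝ} (h : ∀ ρ, f ρ ≤ g ρ) :
    gav H f ≤ gav H g :=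
  Finset.sum_le_sum fun ρ _ => mul_le_mul_of_nonneg_right (h ρ) (prod_gibbsProb_nonneg H ρ)

lemma nu_mono (c : κ → S → ℝ) {n : ℕ} {f g : (Fin n → S) → ℝ} (h : ∀ ρ, f ρ ≤ g ρ) :
    nu c f ≤ nu c g :=
  integral_mono (integrable_gav_linH c f) (integrable_gav_linH c g) fun _ => gav_mono _ h

lemma gav_const (H : S → ℝ) (n : ℕ) (a : ℝ) : gav H (fun _ : Fin n → S => a) = a := by
  simp only [gav, ← Finset.mul_sum, sum_prod_gibbsProb, mul_one]

lemma nu_const (c : κ → S → ℝ) (n : ℕ) (a : ℝ) : nu c (fun _ : Fin n → S => a) = a := by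
  simp [nu, gav_const]

lemma nu_nonneg (c : κ → S → ℝ) {n : ℕ} {f : (Fin n → S) → ℝ} (h : ∀ ρ, 0 ≤ f ρ) :
    0 ≤ nu c f := by
  rw [← nu_const c n 0]; exact nu_mono c h

lemma abs_nu_le (c : κ → S → ℝ) {n : ℕ} (f : (Fin n → S) → ℝ) :
    |nu c f| ≤ nu c (fun ρ => |f ρ|) := by
  rw [abs_le]
  refine ⟨?_, nu_mono c fun ρ => le_abs_self _⟩
  have h := nu_const_mul c (-1) (fun ρ => |f ρ|)
  rw [neg_one_mul] at h
  rw [← h]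
  exact nu_mono c fun ρ => by linarith [neg_abs_le (f ρ)]

/-- The annealed probability of a replica configuration. -/
def annealed (c : κ → S → ℝ) {n : ℕ} (ρ : Fin n → S) : ℝ :=
  ∫ ω, ∏ l, gibbsProb (linH c ω) (ρ l) ∂gaussVec κ

lemma annealed_nonneg (c : κ → S → ℝ) {n : ℕ} (ρ : Fin n → S) : 0 ≤ annealed c ρ :=
  integral_nonneg fun _ => prod_gibbsProb_nonneg _ ρ

lemma nu_eq_sum (c : κ → S → ℝ) {n : ℕ} (f : (Fin n → S) → ℝ) :
    nu c f = ∑ ρ, f ρ * annealed c ρ := by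
  classical
  have h1 : ∀ ρ : Fin n → S, annealed c ρ = nu c (fun ρ' => if ρ' = ρ then 1 else 0) := by
    intro ρ
    simp only [annealed, nu, gav, ite_mul, one_mul, zero_mul, Finset.sum_ite_eq', mem_univ,
      if_true]
  simp only [h1, ← nu_const_mul, ← nu_finset_sum]
  congr 1
  ext ρ'
  simp

/-- The Cauchy–Schwarz inequality for replica averages. -/
lemma nu_mul_sq_le (c : κ → S → ℝ) {n : ℕ} (f g : (Fin n → S) → ℝ) :
    nu c (fun ρ => f ρ * g ρ) ^ 2 ≤ nu c (fun ρ => f ρ ^ 2) * nu c (fun ρ => g ρ ^ 2) := by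
  simp only [nu_eq_sum]
  refine Finset.sum_sq_le_sum_mul_sum_of_sq_le_mul _
    (fun ρ _ => mul_nonneg (sq_nonneg _) (annealed_nonneg c ρ))
    (fun ρ _ => mul_nonneg (sq_nonneg _) (annealed_nonneg c ρ)) (fun ρ _ => le_of_eq ?_)
  ring

lemma gav_comp_injective (H : S → ℝ) {m n : ℕ} {e : Fin m → Fin n} (he : Function.Injective e)
    (f : (Fin m → S) → ℝ) : gav H (fun ρ : Fin n → S => f (ρ ∘ e)) = gav H f := by
  classical
  unfold gav
  rw [← (Equiv.piEquivPiSubtypeProd (fun i => i ∈ Set.range e) (fun _ => S)).symm.sum_comp,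
    Fintype.sum_prod_type, ← (Equiv.arrowCongr (Equiv.ofInjective e he) (Equiv.refl S)).sum_comp]
  refine Finset.sum_congr rfl fun ρ _ => ?_
  set E := Equiv.ofInjective e he
  have hval : ∀ (ζ : {i // ¬ i ∈ Set.range e} → S),
      ((Equiv.piEquivPiSubtypeProd (fun i => i ∈ Set.range e) (fun _ => S)).symm
        ((Equiv.arrowCongr E (Equiv.refl S)) ρ, ζ)) ∘ e = ρ := by
    intro ζ
    ext l
    have : e l ∈ Set.range e := ⟨l, rfl⟩
    simp only [Function.comp_apply, Equiv.piEquivPiSubtypeProd_symm_apply, this, dif_pos,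
      Equiv.arrowCongr_apply, Equiv.coe_refl, id_eq]
    congr 1
    rw [Equiv.symm_apply_eq]
    rfl
  have hprod : ∀ (ζ : {i // ¬ i ∈ Set.range e} → S),
      ∏ l, gibbsProb H ((Equiv.piEquivPiSubtypeProd (fun i => i ∈ Set.range e) (fun _ => S)).symm
        ((Equiv.arrowCongr E (Equiv.refl S)) ρ, ζ) l) =
      (∏ l, gibbsProb H (ρ l)) * ∏ i, gibbsProb H (ζ i) := by
    intro ζ
    rw [← Fintype.prod_subtype_mul_prod_subtype (fun i => i ∈ Set.range e)]
    congr 1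
    · refine Finset.prod_equiv E.symm (by simp) fun i _ => ?_
      rw [← congrFun (hval ζ) (E.symm i), Function.comp_apply,
        show e (E.symm i) = i from Equiv.apply_ofInjective_symm he i]
    · refine Finset.prod_congr rfl fun i _ => ?_
      rw [Equiv.piEquivPiSubtypeProd_symm_apply, dif_neg i.2]
  have hone : ∑ ζ : {i // ¬ i ∈ Set.range e} → S, ∏ i, gibbsProb H (ζ i) = 1 := by
    rw [← Fintype.prod_sum (fun _ : {i // ¬ i ∈ Set.range e} => gibbsProb H)]
    simp [sum_gibbsProb]
  calc _ = ∑ ζ : {i // ¬ i ∈ Set.range e} → S, f ρ * ((∏ l, gibbsProb H (ρ l)) *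
        ∏ i, gibbsProb H (ζ i)) := Finset.sum_congr rfl fun ζ _ => by
          rw [hprod ζ]; exact congrArg (fun x => f x * _) (hval ζ)
    _ = _ := by rw [← Finset.mul_sum, ← Finset.mul_sum, hone, mul_one]

/-- Replica averages only depend on the replicas a function uses. -/
lemma nu_comp_injective (c : κ → S → ℝ) {m n : ℕ} {e : Fin m → Fin n}
    (he : Function.Injective e) (f : (Fin m → S) → ℝ) :
    nu c (fun ρ : Fin n → S => f (ρ ∘ e)) = nu c f := by
  simp only [nu, gav_comp_injective _ he]

lemma gav_flip {H : S → ℝ} {ψ : S → S} (hψ : Function.Involutive ψ) (hH : ∀ x, H (ψ x) = H x)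
    {n : ℕ} (l : Fin n) (f : (Fin n → S) → ℝ) :
    gav H (fun ρ => f (Function.update ρ l (ψ (ρ l)))) = gav H f := by
  have hinv : Function.Involutive fun ρ : Fin n → S => Function.update ρ l (ψ (ρ l)) := by
    intro ρ
    simp [hψ (ρ l)]
  unfold gav
  rw [← Equiv.sum_comp hinv.toPerm]
  refine Finset.sum_congr rfl fun ρ _ => ?_
  rw [Function.Involutive.coe_toPerm]
  refine congrArg₂ (fun x y => f x * y) (hinv ρ) ?_
  refine Finset.prod_congr rfl fun j _ => ?_
  by_cases hj : j = l
  · subst hj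
    simp [gibbsProb, hH]
  · simp [hj]

/-- Replica averages of functions that are odd under a symmetry of the exponent vanish. -/
lemma nu_eq_zero_of_odd {c : κ → S → ℝ} {ψ : S → S} (hψ : Function.Involutive ψ)
    (hc : ∀ k x, c k (ψ x) = c k x) {n : ℕ} (l : Fin n) {f : (Fin n → S) → ℝ}
    (hf : ∀ ρ, f (Function.update ρ l (ψ (ρ l))) = -f ρ) : nu c f = 0 := by
  have h1 : nu c (fun ρ => f (Function.update ρ l (ψ (ρ l)))) = nu c f := by
    simp only [nu]
    congr 1
    ext ω
    exact gav_flip hψ (fun x => by simp [linH, hc]) l f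
  have h2 := nu_const_mul c (-1) f
  simp only [hf] at h1
  simp only [neg_one_mul] at h2
  linarith

end DisorderAverages

section CavityDerivative

variable {S : Type*} [Fintype S] [Nonempty S] {κ : Type*} [Fintype κ] [DecidableEq κ]

/-- The replica weights in the derivative of a Gibbs average over `n` replicas. -/
def replWt (n : ℕ) (l : Fin (n + 1)) : ℝ := if l = Fin.last n then -n else 1

/-- The kernel `U` evaluated at two replicas, with modified diagonal `w`. -/
def replKer (U : S → S → ℝ) (w : S → ℝ) {n : ℕ} (ρ : Fin n → S) (l m : Fin n) : ℝ :=
  if l = m then w (ρ l) else U (ρ l) (ρ m)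

/-- Forgetting the last two replicas. -/
def dropTwo {n : ℕ} (ρ : Fin (n + 2) → S) : Fin n → S := fun l => ρ l.castSucc.castSucc

/-- The operator giving the derivative of a replica average along the cavity interpolation. -/
def cavOp (U : S → S → ℝ) (w : S → ℝ) {n : ℕ} (f : (Fin n → S) → ℝ) (ρ : Fin (n + 2) → S) : ℝ :=
  1 / 2 * (f (dropTwo ρ) * ∑ l : Fin (n + 1), ∑ l' : Fin (n + 2),
    replWt n l * replWt (n + 1) l' * replKer U w ρ l.castSucc l')

lemma sum_replWt (n : ℕ) : ∑ l, replWt n l = 0 := by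
  rw [Fin.sum_univ_castSucc]
  simp [replWt, Fin.castSucc_ne_last]

lemma sum_abs_replWt (n : ℕ) : ∑ l, |replWt n l| = 2 * n := by
  rw [Fin.sum_univ_castSucc]
  simp [replWt, Fin.castSucc_ne_last]
  ring

lemma dirOp_eq (a : S → ℝ) {n : ℕ} (f : (Fin n → S) → ℝ) (ρ : Fin (n + 1) → S) :
    dirOp a f ρ = f (Fin.init ρ) * ∑ l, replWt n l * a (ρ l) := by
  rw [dirOp, Fin.sum_univ_castSucc (n := n)]
  simp only [replWt, Fin.castSucc_ne_last, if_false, one_mul, if_true]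
  ring

lemma sum_dirOp_dirOp {b : κ → S → ℝ} {T : Finset κ} {U : S → S → ℝ} {w : S → ℝ} {u₀ : ℝ}
    (hU : ∀ x y, ∑ k ∈ T, b k x * b k y = U x y) (hw : ∀ x, U x x = u₀ + w x) {n : ℕ}
    (f : (Fin n → S) → ℝ) (ρ : Fin (n + 2) → S) :
    1 / 2 * ∑ k ∈ T, dirOp (b k) (dirOp (b k) f) ρ = cavOp U w f ρ := by
  have h1 : ∀ k, dirOp (b k) (dirOp (b k) f) ρ = f (dropTwo ρ) *
      ∑ l : Fin (n + 1), ∑ l' : Fin (n + 2), replWt n l * replWt (n + 1) l' *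
        (b k (ρ l.castSucc) * b k (ρ l')) := by
    intro k
    rw [dirOp_eq, dirOp_eq, mul_assoc, Finset.sum_mul_sum]
    congr 1
    refine Finset.sum_congr rfl fun l _ => Finset.sum_congr rfl fun l' _ => ?_
    simp only [Fin.init]; ring
  have h2 : ∀ l : Fin (n + 1), ∀ l' : Fin (n + 2),
      ∑ k ∈ T, replWt n l * replWt (n + 1) l' * (b k (ρ l.castSucc) * b k (ρ l')) =
        replWt n l * replWt (n + 1) l' * replKer U w ρ l.castSucc l' +
          (if l.castSucc = l' then u₀ * (replWt n l * replWt (n + 1) l') else 0) := by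
    intro l l'
    rw [← Finset.mul_sum, hU, replKer]
    split_ifs with h
    · rw [← h, hw]; ring
    · ring
  have h3 : ∑ l : Fin (n + 1), ∑ l' : Fin (n + 2),
      (if l.castSucc = l' then u₀ * (replWt n l * replWt (n + 1) l') else 0) = 0 := by
    simp only [Finset.sum_ite_eq, mem_univ, if_true, ← Finset.mul_sum]
    have : ∀ l : Fin (n + 1), replWt n l * replWt (n + 1) l.castSucc = replWt n l := fun l => by
      rw [replWt.eq_def (n + 1), if_neg (Fin.castSucc_ne_last l), mul_one]
    simp only [this, sum_replWt, mul_zero]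
  rw [cavOp]
  congr 1
  simp only [h1]
  rw [← Finset.mul_sum, Finset.sum_comm]
  congr 1
  have h4 : ∀ l : Fin (n + 1), ∑ k ∈ T, ∑ l' : Fin (n + 2), replWt n l * replWt (n + 1) l' *
        (b k (ρ l.castSucc) * b k (ρ l')) = ∑ l' : Fin (n + 2), (replWt n l * replWt (n + 1) l' *
          replKer U w ρ l.castSucc l' +
          (if l.castSucc = l' then u₀ * (replWt n l * replWt (n + 1) l') else 0)) := fun l => by
    rw [Finset.sum_comm]; exact Finset.sum_congr rfl fun l' _ => h2 l l'
  simp only [h4, Finset.sum_add_distrib, h3, add_zero]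

/-- The data of a cavity interpolation: the coordinates in `T` carry the kernel `U`; off `T` the
exponent is invariant under the involutions `ψ` and `ψ'`, which change the signs of `U` and `w`;
the kernel is dominated by `θ • G` and `θ • w'`, which are at most `A`. -/
structure CavityData (b : κ → S → ℝ) (T : Finset κ) (U : S → S → ℝ) (w : S → ℝ)
    (ψ ψ' : S → S) (G : S → S → ℝ) (w' : S → ℝ) (θ A : ℝ) : Prop where
  ker : ∀ x y, ∑ k ∈ T, b k x * b k y = U x y
  diag : ∃ u₀, ∀ x, U x x = u₀ + w x
  inv : Function.Involutive ψ
  inv' : Function.Involutive ψ'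
  off : ∀ k ∉ T, ∀ x, b k (ψ x) = b k x
  off' : ∀ k ∉ T, ∀ x, b k (ψ' x) = b k x
  odd : ∀ x y, U (ψ x) y = -U x y
  odd' : ∀ x, w (ψ' x) = -w x
  bound : ∀ x y, |U x y| ≤ θ * G x y
  bound' : ∀ x, |w x| ≤ θ * w' x
  nonneg : ∀ x y, 0 ≤ G x y
  nonneg' : ∀ x, 0 ≤ w' x
  le : ∀ x y, θ * G x y ≤ A
  le' : ∀ x, θ * w' x ≤ A
  theta : 0 ≤ θ

variable {b : κ → S → ℝ} {T : Finset κ} {U : S → S → ℝ} {w : S → ℝ} {ψ ψ' : S → S}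
  {G : S → S → ℝ} {w' : S → ℝ} {θ A : ℝ}

/-- The sum of the dominating kernel over all pairs of replicas. -/
def totKer (G : S → S → ℝ) (w' : S → ℝ) {n : ℕ} (ρ : Fin n → S) : ℝ :=
  ∑ l, ∑ l', replKer G w' ρ l l'

namespace CavityData

lemma symm (h : CavityData b T U w ψ ψ' G w' θ A) (x y : S) : U x y = U y x := by
  rw [← h.ker, ← h.ker]; exact Finset.sum_congr rfl fun k _ => mul_comm _ _

lemma odd_right (h : CavityData b T U w ψ ψ' G w' θ A) (x y : S) : U x (ψ y) = -U x y := by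
  rw [h.symm, h.odd, h.symm]

lemma hasDerivAt_nu (h : CavityData b T U w ψ ψ' G w' θ A) {n : ℕ} (f : (Fin n → S) → ℝ) {s : ℝ} (hs : 0 < s) :
    HasDerivAt (fun s => nu (coefS b T s) f) (nu (coefS b T s) (cavOp U w f)) s := by
  refine (hasDerivAt_nu_coefS_dirOp b T f hs).congr_deriv ?_
  obtain ⟨u₀, hu⟩ := h.diag
  rw [← nu_finset_sum, ← nu_const_mul]
  congr 1
  ext ρ
  exact sum_dirOp_dirOp h.ker hu f ρ

lemma replKer_nonneg (h : CavityData b T U w ψ ψ' G w' θ A) {n : ℕ} (ρ : Fin n → S) (l l' : Fin n) : 0 ≤ replKer G w' ρ l l' := by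
  unfold replKer; split_ifs
  · exact h.nonneg' _
  · exact h.nonneg _ _

lemma abs_replKer_le (h : CavityData b T U w ψ ψ' G w' θ A) {n : ℕ} (ρ : Fin n → S) (l l' : Fin n) :
    |replKer U w ρ l l'| ≤ θ * replKer G w' ρ l l' := by
  unfold replKer; split_ifs
  · exact h.bound' _
  · exact h.bound _ _

lemma abs_replKer_le_const (h : CavityData b T U w ψ ψ' G w' θ A) {n : ℕ} (ρ : Fin n → S) (l l' : Fin n) :
    |replKer U w ρ l l'| ≤ A := by
  unfold replKer; split_ifs
  · exact (h.bound' _).trans (h.le' _)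
  · exact (h.bound _ _).trans (h.le _ _)

lemma totKer_nonneg (h : CavityData b T U w ψ ψ' G w' θ A) {n : ℕ} (ρ : Fin n → S) : 0 ≤ totKer G w' ρ :=
  Finset.sum_nonneg fun l _ => Finset.sum_nonneg fun l' _ => h.replKer_nonneg ρ l l'

lemma abs_replKer_le_totKer (h : CavityData b T U w ψ ψ' G w' θ A) {n : ℕ} (ρ : Fin n → S) (l l' : Fin n) :
    |replKer U w ρ l l'| ≤ θ * totKer G w' ρ := by
  refine (h.abs_replKer_le ρ l l').trans (mul_le_mul_of_nonneg_left ?_ h.theta)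
  refine (Finset.single_le_sum (f := fun l' => replKer G w' ρ l l')
    (fun l' _ => h.replKer_nonneg ρ l l') (mem_univ l')).trans ?_
  exact Finset.single_le_sum (f := fun l => ∑ l', replKer G w' ρ l l')
    (fun l _ => Finset.sum_nonneg fun l' _ => h.replKer_nonneg ρ l l') (mem_univ l)

lemma totKer_dropTwo_le (h : CavityData b T U w ψ ψ' G w' θ A) {n : ℕ} (ρ : Fin (n + 2) → S) :
    totKer G w' (dropTwo ρ) ≤ totKer G w' ρ := by
  have h1 : ∀ l l' : Fin n, replKer G w' (dropTwo ρ) l l' =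
      replKer G w' ρ l.castSucc.castSucc l'.castSucc.castSucc := by
    intro l l'
    simp [replKer, dropTwo]
  have h2 : ∀ g : Fin (n + 2) → ℝ, (∀ l, 0 ≤ g l) →
      ∑ l : Fin n, g l.castSucc.castSucc ≤ ∑ l, g l := by
    intro g hg
    rw [Fin.sum_univ_castSucc, Fin.sum_univ_castSucc]
    linarith [hg (Fin.last _), hg (Fin.last n).castSucc]
  unfold totKer
  simp only [h1]
  refine (Finset.sum_le_sum fun l _ =>
    h2 (fun l' => replKer G w' ρ l.castSucc.castSucc l') fun l' => h.replKer_nonneg ρ _ _).trans ?_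
  exact h2 (fun l => ∑ l', replKer G w' ρ l l')
    fun l => Finset.sum_nonneg fun l' _ => h.replKer_nonneg ρ l l'

lemma abs_cavOp_le_of {n : ℕ} (f : (Fin n → S) → ℝ) (ρ : Fin (n + 2) → S) {M : ℝ}
    (hM : ∀ l l', |replKer U w ρ l l'| ≤ M) :
    |cavOp U w f ρ| ≤ 2 * n * (n + 1) * (M * |f (dropTwo ρ)|) := by
  have h1 : |∑ l : Fin (n + 1), ∑ l' : Fin (n + 2),
      replWt n l * replWt (n + 1) l' * replKer U w ρ l.castSucc l'| ≤
      (2 * n) * (2 * (n + 1)) * M := by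
    calc _ ≤ ∑ l : Fin (n + 1), ∑ l' : Fin (n + 2), |replWt n l| * |replWt (n + 1) l'| * M := by
          refine (Finset.abs_sum_le_sum_abs _ _).trans (Finset.sum_le_sum fun l _ => ?_)
          refine (Finset.abs_sum_le_sum_abs _ _).trans (Finset.sum_le_sum fun l' _ => ?_)
          rw [abs_mul, abs_mul]
          exact mul_le_mul_of_nonneg_left (hM _ _) (by positivity)
      _ = _ := by
          have := sum_abs_replWt (n + 1)
          push_cast at this
          rw [← sum_abs_replWt n, ← this, Finset.sum_mul_sum, Finset.sum_mul]
          exact Finset.sum_congr rfl fun l _ => by rw [Finset.sum_mul]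
  rw [cavOp, abs_mul, abs_mul, abs_of_pos (by norm_num : (0 : ℝ) < 1 / 2)]
  nlinarith [mul_le_mul_of_nonneg_left h1 (abs_nonneg (f (dropTwo ρ)))]

lemma abs_cavOp_le (h : CavityData b T U w ψ ψ' G w' θ A) {n : ℕ} (f : (Fin n → S) → ℝ)
    (ρ : Fin (n + 2) → S) :
    |cavOp U w f ρ| ≤ 2 * n * (n + 1) * (θ * totKer G w' ρ * |f (dropTwo ρ)|) :=
  abs_cavOp_le_of f ρ fun l m => h.abs_replKer_le_totKer ρ l m

/-- Replica averages of nonnegative functions are comparable along the interpolation. -/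
lemma nu_le_exp_mul (h : CavityData b T U w ψ ψ' G w' θ A) {n : ℕ} {f : (Fin n → S) → ℝ} (hf : ∀ ρ, 0 ≤ f ρ) {s : ℝ}
    (hs : s ∈ Set.Icc (0 : ℝ) 1) :
    nu (coefS b T s) f ≤ exp (2 * n * (n + 1) * A) * nu b f := by
  set C := 2 * n * (n + 1) * A with hC
  have hA : 0 ≤ A := by
    obtain ⟨x⟩ := ‹Nonempty S›
    exact (mul_nonneg h.theta (h.nonneg x x)).trans (h.le x x)
  have hC0 : 0 ≤ C := by positivity
  have hd : ∀ u ∈ Set.Ioo (0 : ℝ) 1, HasDerivAt (fun u => exp (C * u) * nu (coefS b T u) f)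
      (exp (C * u) * C * nu (coefS b T u) f +
        exp (C * u) * nu (coefS b T u) (cavOp U w f)) u := by
    intro u hu
    have h1 : HasDerivAt (fun u : ℝ => exp (C * u)) (exp (C * u) * C) u := by
      have := ((hasDerivAt_id' u).const_mul C).exp
      simpa using this
    exact h1.mul (h.hasDerivAt_nu f hu.1)
  have hmono : MonotoneOn (fun u => exp (C * u) * nu (coefS b T u) f) (Set.Icc 0 1) := by
    refine monotoneOn_of_deriv_nonneg (convex_Icc 0 1)
      ((by fun_prop : Continuous fun u : ℝ => exp (C * u)).mul
        (continuous_nu_coefS b T f)).continuousOn ?_ ?_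
    · rw [interior_Icc]
      exact fun u hu => (hd u hu).differentiableAt.differentiableWithinAt
    · rw [interior_Icc]
      intro u hu
      rw [(hd u hu).deriv]
      have h2 : -(C * nu (coefS b T u) f) ≤ nu (coefS b T u) (cavOp U w f) := by
        have h3 := abs_nu_le (coefS b T u) (cavOp U w f)
        have h4 : nu (coefS b T u) (fun ρ => |cavOp U w f ρ|) ≤ C * nu (coefS b T u) f := by
          have h5 : nu (coefS b T u) (fun ρ : Fin (n + 2) → S => f (dropTwo ρ)) =
              nu (coefS b T u) f :=
            nu_comp_injective (coefS b T u) (e := fun l : Fin n => l.castSucc.castSucc)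
              (fun i j hij => by simpa using hij) f
          rw [← h5, ← nu_const_mul]
          refine nu_mono _ fun ρ => ?_
          have := abs_cavOp_le_of f ρ fun l l' => h.abs_replKer_le_const ρ l l'
          rw [abs_of_nonneg (hf _)] at this
          rw [hC]; linarith
        linarith [neg_abs_le (nu (coefS b T u) (cavOp U w f))]
      have := exp_pos (C * u)
      nlinarith
  have h6 := hmono hs (Set.right_mem_Icc.2 zero_le_one) hs.2
  simp only [mul_one, coefS_one] at h6
  refine le_trans ?_ h6
  have h7 : 1 ≤ exp (C * s) := one_le_exp (mul_nonneg hC0 hs.1)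
  have := nu_nonneg (coefS b T s) hf
  nlinarith

lemma exists_nu_sub (h : CavityData b T U w ψ ψ' G w' θ A) {n : ℕ} (f : (Fin n → S) → ℝ) {s : ℝ} (hs : s ∈ Set.Ioc (0 : ℝ) 1) :
    ∃ u ∈ Set.Ioo (0 : ℝ) s,
      nu (coefS b T s) f = nu (coefS b T 0) f + s * nu (coefS b T u) (cavOp U w f) := by
  obtain ⟨u, hu, he⟩ := exists_hasDerivAt_eq_slope (fun s => nu (coefS b T s) f)
    (fun s => nu (coefS b T s) (cavOp U w f)) hs.1 (continuous_nu_coefS b T f).continuousOn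
    (fun x hx => h.hasDerivAt_nu f hx.1)
  refine ⟨u, hu, ?_⟩
  have := hs.1.ne'
  rw [he]; simp only [sub_zero]; field_simp; ring

/-- Exponent symmetric at `s = 0`. -/
lemma coef_zero_inv (h : CavityData b T U w ψ ψ' G w' θ A) (k : κ) (x : S) : coefS b T 0 k (ψ x) = coefS b T 0 k x := by
  unfold coefS; split_ifs with hk
  · simp
  · exact h.off k hk x

lemma coef_zero_inv' (h : CavityData b T U w ψ ψ' G w' θ A) (k : κ) (x : S) : coefS b T 0 k (ψ' x) = coefS b T 0 k x := by
  unfold coefS; split_ifs with hk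
  · simp
  · exact h.off' k hk x

lemma nu_zero_eq_zero (h : CavityData b T U w ψ ψ' G w' θ A) {n : ℕ} (l : Fin n) {f : (Fin n → S) → ℝ}
    (hf : ∀ ρ, f (Function.update ρ l (ψ (ρ l))) = -f ρ) : nu (coefS b T 0) f = 0 :=
  nu_eq_zero_of_odd h.inv h.coef_zero_inv l hf

/-- At the start of the interpolation only the kernels between the original replicas survive. -/
lemma nu_zero_cavOp (h : CavityData b T U w ψ ψ' G w' θ A) {n : ℕ} (f : (Fin n → S) → ℝ) :
    nu (coefS b T 0) (cavOp U w f) =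
      1 / 2 * ∑ l, ∑ l', nu (coefS b T 0) (fun ρ => f ρ * replKer U w ρ l l') := by
  set c := coefS b T 0 with hc
  have hterm : ∀ l : Fin (n + 1), ∀ l' : Fin (n + 2),
      nu c (fun ρ => f (dropTwo ρ) * (replWt n l * replWt (n + 1) l' *
        replKer U w ρ l.castSucc l')) =
      if hl : l ≠ Fin.last n ∧ l' ≠ Fin.last (n + 1) ∧ l' ≠ (Fin.last n).castSucc then
        nu c (fun ρ => f (dropTwo ρ) * replKer U w ρ l.castSucc l') else 0 := by
    intro l l'
    have drop_upd : ∀ (ρ : Fin (n + 2) → S) (j : Fin (n + 2)) (x : S),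
        (j = Fin.last (n + 1) ∨ j = (Fin.last n).castSucc) →
        dropTwo (Function.update ρ j x) = dropTwo ρ := by
      intro ρ j x hj
      ext m
      simp only [dropTwo]
      rw [Function.update_of_ne]
      rcases hj with rfl | rfl
      · exact Fin.castSucc_ne_last _
      · simp
    split_ifs with hl
    · obtain ⟨h1, h2, -⟩ := hl
      simp only [replWt, h1, h2, if_false, one_mul]
    · by_cases h2 : l' = Fin.last (n + 1)
      · subst h2
        refine h.nu_zero_eq_zero (Fin.last (n + 1)) fun ρ => ?_
        rw [drop_upd _ _ _ (Or.inl rfl)]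
        simp only [replKer, Fin.castSucc_ne_last, if_false, Function.update_self,
          Function.update_of_ne (Fin.castSucc_ne_last l), h.odd_right]
        ring
      · by_cases h1 : l = Fin.last n
        · subst h1
          by_cases h3 : (Fin.last n).castSucc = l'
          · subst h3
            refine nu_eq_zero_of_odd h.inv' h.coef_zero_inv' (Fin.last n).castSucc fun ρ => ?_
            rw [drop_upd _ _ _ (Or.inr rfl)]
            simp only [replKer, if_true, Function.update_self, h.odd']
            ring
          · refine h.nu_zero_eq_zero (Fin.last n).castSucc fun ρ => ?_
            rw [drop_upd _ _ _ (Or.inr rfl)]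
            simp only [replKer, h3, if_false, Function.update_self,
              Function.update_of_ne (Ne.symm h3), h.odd]
            ring
        · have h3 : l' = (Fin.last n).castSucc := by
            by_contra h3; exact hl ⟨h1, h2, h3⟩
          subst h3
          have h4 : l.castSucc ≠ (Fin.last n).castSucc := by simpa using h1
          refine h.nu_zero_eq_zero (Fin.last n).castSucc fun ρ => ?_
          rw [drop_upd _ _ _ (Or.inr rfl)]
          simp only [replKer, h4, if_false, Function.update_self,
            Function.update_of_ne h4, h.odd_right]
          ring
  have hexp : nu c (cavOp U w f) = 1 / 2 * ∑ l : Fin (n + 1), ∑ l' : Fin (n + 2),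
      nu c (fun ρ => f (dropTwo ρ) * (replWt n l * replWt (n + 1) l' *
        replKer U w ρ l.castSucc l')) := by
    simp only [← nu_finset_sum, ← nu_const_mul, ← Finset.mul_sum]
    rfl
  rw [hexp]
  congr 1
  simp only [hterm]
  rw [Fin.sum_univ_castSucc (n := n)]
  have hlast : ∑ l' : Fin (n + 2), (if hl : Fin.last n ≠ Fin.last n ∧ l' ≠ Fin.last (n + 1) ∧
      l' ≠ (Fin.last n).castSucc then nu c (fun ρ => f (dropTwo ρ) *
        replKer U w ρ (Fin.last n).castSucc l') else 0) = 0 :=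
    Finset.sum_eq_zero fun l' _ => by simp
  rw [hlast, add_zero]
  refine Finset.sum_congr rfl fun l _ => ?_
  rw [Fin.sum_univ_castSucc, Fin.sum_univ_castSucc]
  simp only [ne_eq, Fin.castSucc_ne_last, not_false_eq_true, true_and, not_true_eq_false,
    and_false, false_and, dite_false, add_zero]
  refine Finset.sum_congr rfl fun l' _ => ?_
  have h5 : l'.castSucc.castSucc ≠ (Fin.last n).castSucc := by
    simp
  simp only [h5, not_false_eq_true, dite_true]
  rw [← nu_comp_injective c (e := fun l : Fin n => l.castSucc.castSucc)
    (fun i j hij => by simpa using hij) (fun ρ => f ρ * replKer U w ρ l l')]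
  congr 1
  ext ρ
  have h6 : replKer U w ρ l.castSucc.castSucc l'.castSucc.castSucc =
      replKer U w (dropTwo ρ) l l' := by simp [replKer, dropTwo]
  rw [h6]; rfl

end CavityData

end CavityDerivative

section CavityBounds

variable {S : Type*} [Fintype S] [Nonempty S] {κ : Type*} [Fintype κ] [DecidableEq κ]
variable {b : κ → S → ℝ} {T : Finset κ} {U : S → S → ℝ} {w : S → ℝ} {ψ ψ' : S → S}
  {G : S → S → ℝ} {w' : S → ℝ} {θ A : ℝ}

/-- The combinatorial constant in the bound on the cavity derivative. -/
def cavCst (n : ℕ) : ℝ := 2 * n * (n + 1)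

lemma cavCst_nonneg (n : ℕ) : 0 ≤ cavCst n := by unfold cavCst; positivity

namespace CavityData

lemma abs_cavOp_two_le (h : CavityData b T U w ψ ψ' G w' θ A) {n : ℕ} (f : (Fin n → S) → ℝ)
    (ρ : Fin (n + 2 + 2) → S) :
    |cavOp U w (cavOp U w f) ρ| ≤ cavCst (n + 2) * cavCst n *
      (θ ^ 2 * (totKer G w' ρ ^ 2 * |f (dropTwo (dropTwo ρ))|)) := by
  have h1 := h.abs_cavOp_le (cavOp U w f) ρ
  have h2 := h.abs_cavOp_le f (dropTwo ρ)
  have h3 := h.totKer_dropTwo_le ρ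
  have h4 := h.totKer_nonneg ρ
  have hθ := h.theta
  have hc : (2 * ((n + 2 : ℕ) : ℝ) * ((n + 2 : ℕ) + 1)) = cavCst (n + 2) := rfl
  have hc' : (2 * (n : ℝ) * (n + 1)) = cavCst n := rfl
  rw [hc] at h1
  rw [hc'] at h2
  have h5 := cavCst_nonneg n
  have h6 := cavCst_nonneg (n + 2)
  refine h1.trans ?_
  calc cavCst (n + 2) * (θ * totKer G w' ρ * |cavOp U w f (dropTwo ρ)|)
      ≤ cavCst (n + 2) * (θ * totKer G w' ρ * (cavCst n * (θ * totKer G w' ρ *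
        |f (dropTwo (dropTwo ρ))|))) := by
        gcongr
        refine h2.trans ?_
        gcongr
    _ = _ := by ring

lemma abs_cavOp_three_le (h : CavityData b T U w ψ ψ' G w' θ A) {n : ℕ} (f : (Fin n → S) → ℝ)
    (ρ : Fin (n + 2 + 2 + 2) → S) :
    |cavOp U w (cavOp U w (cavOp U w f)) ρ| ≤ cavCst (n + 2 + 2) * cavCst (n + 2) * cavCst n *
      (θ ^ 3 * (totKer G w' ρ ^ 3 * |f (dropTwo (dropTwo (dropTwo ρ)))|)) := by
  have h1 := h.abs_cavOp_le (cavOp U w (cavOp U w f)) ρ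
  have h2 := h.abs_cavOp_two_le f (dropTwo ρ)
  have h3 := h.totKer_dropTwo_le ρ
  have h4 := h.totKer_nonneg ρ
  have h4' := h.totKer_nonneg (dropTwo ρ)
  have hθ := h.theta
  have hc : (2 * ((n + 2 + 2 : ℕ) : ℝ) * ((n + 2 + 2 : ℕ) + 1)) = cavCst (n + 2 + 2) := rfl
  rw [hc] at h1
  have h5 := cavCst_nonneg n
  have h6 := cavCst_nonneg (n + 2)
  have h7 := cavCst_nonneg (n + 2 + 2)
  refine h1.trans ?_
  calc cavCst (n + 2 + 2) * (θ * totKer G w' ρ * |cavOp U w (cavOp U w f) (dropTwo ρ)|)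
      ≤ cavCst (n + 2 + 2) * (θ * totKer G w' ρ * (cavCst (n + 2) * cavCst n *
        (θ ^ 2 * (totKer G w' ρ ^ 2 * |f (dropTwo (dropTwo (dropTwo ρ)))|)))) := by
        gcongr
        refine h2.trans ?_
        gcongr
    _ = _ := by ring

lemma abs_nu_le_of_le (h : CavityData b T U w ψ ψ' G w' θ A) {n : ℕ} {f g : (Fin n → S) → ℝ}
    {C : ℝ} (hC : 0 ≤ C) (hg : ∀ ρ, 0 ≤ g ρ) (hfg : ∀ ρ, |f ρ| ≤ C * g ρ) {s : ℝ}
    (hs : s ∈ Set.Icc (0 : ℝ) 1) :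
    |nu (coefS b T s) f| ≤ C * exp (cavCst n * A) * nu b g := by
  refine (abs_nu_le _ _).trans ?_
  refine (nu_mono _ hfg).trans ?_
  rw [nu_const_mul, mul_assoc]
  exact mul_le_mul_of_nonneg_left (h.nu_le_exp_mul hg hs) hC

lemma abs_nu_cavOp_le (h : CavityData b T U w ψ ψ' G w' θ A) {n : ℕ} (f : (Fin n → S) → ℝ)
    {s : ℝ} (hs : s ∈ Set.Icc (0 : ℝ) 1) :
    |nu (coefS b T s) (cavOp U w f)| ≤ cavCst n * exp (cavCst (n + 2) * A) *
      (θ * nu b (fun ρ : Fin (n + 2) → S => totKer G w' ρ * |f (dropTwo ρ)|)) := by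
  have hθ := h.theta
  have := h.abs_nu_le_of_le (f := cavOp U w f)
    (g := fun ρ : Fin (n + 2) → S => totKer G w' ρ * |f (dropTwo ρ)|) (C := cavCst n * θ)
    (mul_nonneg (cavCst_nonneg n) hθ)
    (fun ρ => mul_nonneg (h.totKer_nonneg ρ) (abs_nonneg _))
    (fun ρ => (h.abs_cavOp_le f ρ).trans (le_of_eq (by unfold cavCst; ring))) hs
  refine this.trans (le_of_eq (by ring))

/-- First-order comparison of the two ends of the interpolation. -/
lemma abs_nu_sub_le (h : CavityData b T U w ψ ψ' G w' θ A) {n : ℕ} (f : (Fin n → S) → ℝ) :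
    |nu b f - nu (coefS b T 0) f| ≤ cavCst n * exp (cavCst (n + 2) * A) *
      (θ * nu b (fun ρ : Fin (n + 2) → S => totKer G w' ρ * |f (dropTwo ρ)|)) := by
  obtain ⟨u, hu, he⟩ := h.exists_nu_sub f (s := 1) ⟨one_pos, le_rfl⟩
  rw [coefS_one, one_mul] at he
  rw [he, add_sub_cancel_left]
  exact h.abs_nu_cavOp_le f ⟨hu.1.le, hu.2.le⟩

/-- Second-order expansion of replica averages along the interpolation. -/
lemma abs_nu_sub_sub_le (h : CavityData b T U w ψ ψ' G w' θ A) {n : ℕ} (f : (Fin n → S) → ℝ) :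
    |nu b f - nu (coefS b T 0) f - nu (coefS b T 0) (cavOp U w f)| ≤
      cavCst (n + 2) * cavCst n * exp (cavCst (n + 2 + 2) * A) *
      (θ ^ 2 * nu b (fun ρ : Fin (n + 2 + 2) → S =>
        totKer G w' ρ ^ 2 * |f (dropTwo (dropTwo ρ))|)) := by
  obtain ⟨u, hu, he⟩ := h.exists_nu_sub f (s := 1) ⟨one_pos, le_rfl⟩
  obtain ⟨v, hv, he'⟩ := h.exists_nu_sub (cavOp U w f) (s := u) ⟨hu.1, hu.2.le⟩
  rw [coefS_one, one_mul, he'] at he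
  rw [he, add_sub_cancel_left, add_sub_cancel_left, abs_mul, abs_of_pos hu.1]
  have h1 := h.abs_nu_le_of_le (f := cavOp U w (cavOp U w f))
    (g := fun ρ : Fin (n + 2 + 2) → S => totKer G w' ρ ^ 2 * |f (dropTwo (dropTwo ρ))|)
    (C := cavCst (n + 2) * cavCst n * θ ^ 2)
    (mul_nonneg (mul_nonneg (cavCst_nonneg _) (cavCst_nonneg n)) (sq_nonneg _))
    (fun ρ => by positivity)
    (fun ρ => (h.abs_cavOp_two_le f ρ).trans (le_of_eq (by ring))) (s := v)
    ⟨hv.1.le, (hv.2.trans hu.2).le⟩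
  calc u * |nu (coefS b T v) (cavOp U w (cavOp U w f))|
      ≤ 1 * |nu (coefS b T v) (cavOp U w (cavOp U w f))| := by
        gcongr; exact hu.2.le
    _ ≤ _ := by rw [one_mul]; exact h1.trans (le_of_eq (by ring))

/-- Third-order upper bound when the second derivative at the start is nonpositive. -/
lemma nu_le_of_second_nonpos (h : CavityData b T U w ψ ψ' G w' θ A) {n : ℕ}
    (f : (Fin n → S) → ℝ) (hf : nu (coefS b T 0) (cavOp U w (cavOp U w f)) ≤ 0) :
    nu b f ≤ nu (coefS b T 0) f + nu (coefS b T 0) (cavOp U w f) +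
      cavCst (n + 2 + 2) * cavCst (n + 2) * cavCst n * exp (cavCst (n + 2 + 2 + 2) * A) *
      (θ ^ 3 * nu b (fun ρ : Fin (n + 2 + 2 + 2) → S =>
        totKer G w' ρ ^ 3 * |f (dropTwo (dropTwo (dropTwo ρ)))|)) := by
  obtain ⟨u, hu, he⟩ := h.exists_nu_sub f (s := 1) ⟨one_pos, le_rfl⟩
  obtain ⟨v, hv, he'⟩ := h.exists_nu_sub (cavOp U w f) (s := u) ⟨hu.1, hu.2.le⟩
  have hv1 : v < 1 := hv.2.trans hu.2
  obtain ⟨z, hz, he''⟩ := h.exists_nu_sub (cavOp U w (cavOp U w f)) (s := v) ⟨hv.1, hv1.le⟩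
  rw [coefS_one, one_mul, he', he''] at he
  have h1 := h.abs_nu_le_of_le (f := cavOp U w (cavOp U w (cavOp U w f)))
    (g := fun ρ : Fin (n + 2 + 2 + 2) → S =>
      totKer G w' ρ ^ 3 * |f (dropTwo (dropTwo (dropTwo ρ)))|)
    (C := cavCst (n + 2 + 2) * cavCst (n + 2) * cavCst n * θ ^ 3)
    (mul_nonneg (mul_nonneg (mul_nonneg (cavCst_nonneg _) (cavCst_nonneg _)) (cavCst_nonneg n))
      (pow_nonneg h.theta 3))
    (fun ρ => mul_nonneg (pow_nonneg (h.totKer_nonneg ρ) 3) (abs_nonneg _))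
    (fun ρ => (h.abs_cavOp_three_le f ρ).trans (le_of_eq (by ring))) (s := z)
    ⟨hz.1.le, (hz.2.trans hv1).le⟩
  have h2 : u * (v * nu (coefS b T z) (cavOp U w (cavOp U w (cavOp U w f)))) ≤
      |nu (coefS b T z) (cavOp U w (cavOp U w (cavOp U w f)))| := by
    have h3 := le_abs_self (nu (coefS b T z) (cavOp U w (cavOp U w (cavOp U w f))))
    have h4 := abs_nonneg (nu (coefS b T z) (cavOp U w (cavOp U w (cavOp U w f))))
    have h5 : u * v ≤ 1 := by nlinarith [hu.1, hu.2, hv.1]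
    have h6 : 0 ≤ u * v := mul_nonneg hu.1.le hv.1.le
    nlinarith
  have h7 : u * nu (coefS b T 0) (cavOp U w (cavOp U w f)) ≤ 0 :=
    mul_nonpos_of_nonneg_of_nonpos hu.1.le hf
  have h8 := h2.trans h1
  rw [he]
  have h9 : cavCst (n + 2 + 2) * cavCst (n + 2) * cavCst n * θ ^ 3 *
      exp (cavCst (n + 2 + 2 + 2) * A) * nu b (fun ρ : Fin (n + 2 + 2 + 2) → S =>
        totKer G w' ρ ^ 3 * |f (dropTwo (dropTwo (dropTwo ρ)))|) =
      cavCst (n + 2 + 2) * cavCst (n + 2) * cavCst n * exp (cavCst (n + 2 + 2 + 2) * A) *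
      (θ ^ 3 * nu b (fun ρ : Fin (n + 2 + 2 + 2) → S =>
        totKer G w' ρ ^ 3 * |f (dropTwo (dropTwo (dropTwo ρ)))|)) := by ring
  linarith

end CavityData

end CavityBounds

section SpinSystems

lemma spin_mul_self (a : Bool) : spin a * spin a = 1 := by cases a <;> simp [spin]

lemma abs_spin (a : Bool) : |spin a| = 1 := by cases a <;> simp [spin]

lemma spin_not (a : Bool) : spin (!a) = -spin a := by cases a <;> simp [spin]

/-- Flipping the spin at site `i`. -/
def flipAt {N : ℕ} (i : Fin N) (σ : Config N) : Config N := Function.update σ i (!σ i)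

lemma flipAt_involutive {N : ℕ} (i : Fin N) : Function.Involutive (flipAt i) := by
  intro σ
  simp [flipAt]

lemma spin_flipAt {N : ℕ} (i : Fin N) (σ : Config N) : spin (flipAt i σ i) = -spin (σ i) := by
  simp [flipAt, spin_not]

/-- The overlap without the contribution of site `i`. -/
def ovCav (N : ℕ) (i : Fin N) (σ τ : Config N) : ℝ :=
  (∑ j ∈ univ.erase i, spin (σ j) * spin (τ j)) / N

lemma ovlp_eq {N : ℕ} (i : Fin N) (σ τ : Config N) :
    ovlp N σ τ = ovCav N i σ τ + spin (σ i) * spin (τ i) / N := by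
  rw [ovlp, ovCav, ← Finset.sum_erase_add _ _ (mem_univ i), add_div]

lemma ovCav_flip_left {N : ℕ} (i : Fin N) (σ τ : Config N) :
    ovCav N i (flipAt i σ) τ = ovCav N i σ τ := by
  unfold ovCav
  congr 1
  refine Finset.sum_congr rfl fun j hj => ?_
  rw [flipAt, Function.update_of_ne (Finset.ne_of_mem_erase hj)]

lemma ovlp_comm {N : ℕ} (σ τ : Config N) : ovlp N σ τ = ovlp N τ σ := by
  unfold ovlp; congr 1; exact Finset.sum_congr rfl fun j _ => mul_comm _ _

lemma ovCav_comm {N : ℕ} (i : Fin N) (σ τ : Config N) : ovCav N i σ τ = ovCav N i τ σ := by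
  unfold ovCav; congr 1; exact Finset.sum_congr rfl fun j _ => mul_comm _ _

lemma ovCav_flip_right {N : ℕ} (i : Fin N) (σ τ : Config N) :
    ovCav N i σ (flipAt i τ) = ovCav N i σ τ := by
  rw [ovCav_comm, ovCav_flip_left, ovCav_comm]

lemma abs_ovlp_le {N : ℕ} (σ τ : Config N) : |ovlp N σ τ| ≤ 1 := by
  rw [ovlp, abs_div, Nat.abs_cast]
  refine div_le_one_of_le₀ ?_ (Nat.cast_nonneg _)
  refine (Finset.abs_sum_le_sum_abs _ _).trans ?_
  simp [abs_mul, abs_spin]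

lemma ovlp_self {N : ℕ} (hN : 1 ≤ N) (σ : Config N) : ovlp N σ σ = 1 := by
  have : (N : ℝ) ≠ 0 := by positivity
  simp [ovlp, spin_mul_self, this]

/-- The product of the two spins at site `i`. -/
def spinProd {N : ℕ} (i : Fin N) (σ τ : Config N) : ℝ := spin (σ i) * spin (τ i)

lemma abs_spinProd {N : ℕ} (i : Fin N) (σ τ : Config N) : |spinProd i σ τ| = 1 := by
  simp [spinProd, abs_mul, abs_spin]

lemma spinProd_mul_self {N : ℕ} (i : Fin N) (σ τ : Config N) :
    spinProd i σ τ * spinProd i σ τ = 1 := by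
  rw [spinProd, mul_mul_mul_comm, spin_mul_self, spin_mul_self, one_mul]

lemma spinProd_comm {N : ℕ} (i : Fin N) (σ τ : Config N) :
    spinProd i σ τ = spinProd i τ σ := mul_comm _ _

lemma spinProd_flip_left {N : ℕ} (i : Fin N) (σ τ : Config N) :
    spinProd i (flipAt i σ) τ = -spinProd i σ τ := by
  rw [spinProd, spin_flipAt, spinProd, neg_mul]

lemma spinProd_flip_right {N : ℕ} (i : Fin N) (σ τ : Config N) :
    spinProd i σ (flipAt i τ) = -spinProd i σ τ := by
  rw [spinProd_comm, spinProd_flip_left, spinProd_comm]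

/-- The rescaled overlap `√N R`. -/
def scOv (N : ℕ) (σ τ : Config N) : ℝ := √N * ovlp N σ τ

/-- The rescaled cavity overlap. -/
def scCav (N : ℕ) (i : Fin N) (σ τ : Config N) : ℝ := √N * ovCav N i σ τ

/-- The dominating function `√N |R| + 1`. -/
def domOv (N : ℕ) (σ τ : Config N) : ℝ := |scOv N σ τ| + 1

lemma one_le_domOv {N : ℕ} (σ τ : Config N) : 1 ≤ domOv N σ τ := by
  unfold domOv; linarith [abs_nonneg (scOv N σ τ)]

lemma domOv_pos {N : ℕ} (σ τ : Config N) : 0 < domOv N σ τ :=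
  one_pos.trans_le (one_le_domOv σ τ)

lemma domOv_comm {N : ℕ} (σ τ : Config N) : domOv N σ τ = domOv N τ σ := by
  unfold domOv scOv; rw [ovlp_comm]

lemma scOv_sub_scCav {N : ℕ} (i : Fin N) (σ τ : Config N) :
    scOv N σ τ = scCav N i σ τ + spinProd i σ τ / √N := by
  have hN : (0 : ℝ) < N := by
    have := i.pos; positivity
  unfold scOv scCav spinProd
  rw [ovlp_eq i]
  have h1 := Real.sq_sqrt hN.le
  have : √(N : ℝ) ≠ 0 := (sqrt_pos.2 hN).ne'
  field_simp
  rw [h1]; ring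

lemma one_le_sqrt_nat {N : ℕ} (hN : 1 ≤ N) : 1 ≤ √(N : ℝ) := by
  rw [Real.one_le_sqrt]; exact_mod_cast hN

lemma abs_scOv_sub_scCav_le {N : ℕ} (i : Fin N) (σ τ : Config N) :
    |scOv N σ τ - scCav N i σ τ| ≤ 1 / √N := by
  rw [scOv_sub_scCav i, add_sub_cancel_left, abs_div, abs_spinProd, abs_of_nonneg (sqrt_nonneg _)]

lemma abs_scOv_le {N : ℕ} (σ τ : Config N) : |scOv N σ τ| ≤ domOv N σ τ := by
  unfold domOv; linarith

lemma abs_scCav_le {N : ℕ} (i : Fin N) (σ τ : Config N) : |scCav N i σ τ| ≤ domOv N σ τ := by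
  have h1 := abs_scOv_sub_scCav_le i σ τ
  have h2 : 1 / √(N : ℝ) ≤ 1 := by
    have := one_le_sqrt_nat i.pos
    rw [div_le_one (by linarith)]; exact this
  have h3 := abs_sub_abs_le_abs_sub (scCav N i σ τ) (scOv N σ τ)
  rw [abs_sub_comm] at h3
  unfold domOv; linarith

lemma scCav_flip_left {N : ℕ} (i : Fin N) (σ τ : Config N) :
    scCav N i (flipAt i σ) τ = scCav N i σ τ := by
  rw [scCav, ovCav_flip_left, scCav]

lemma scCav_flip_right {N : ℕ} (i : Fin N) (σ τ : Config N) :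
    scCav N i σ (flipAt i τ) = scCav N i σ τ := by
  rw [scCav, ovCav_flip_right, scCav]

lemma domOv_le {N : ℕ} (hN : 1 ≤ N) (σ τ : Config N) : 1 / √N * domOv N σ τ ≤ 2 := by
  have h1 := one_le_sqrt_nat hN
  have h2 := abs_ovlp_le σ τ
  rw [domOv, scOv, abs_mul, abs_of_nonneg (sqrt_nonneg _)]
  rw [one_div_mul_eq_div, div_le_iff₀ (by linarith)]
  nlinarith

/-- Changing an overlap power into the corresponding cavity overlap power. -/
lemma abs_pow_scOv_sub_le {N : ℕ} (i : Fin N) (m : ℕ) (σ τ : Config N) :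
    |scOv N σ τ ^ m - scCav N i σ τ ^ m| ≤ m / √N * domOv N σ τ ^ (m - 1) := by
  refine (abs_pow_sub_pow_le _ _ _).trans ?_
  have h1 := abs_scOv_sub_scCav_le i σ τ
  have h2 : max |scOv N σ τ| |scCav N i σ τ| ≤ domOv N σ τ :=
    max_le (abs_scOv_le σ τ) (abs_scCav_le i σ τ)
  have h3 : 0 ≤ max |scOv N σ τ| |scCav N i σ τ| := (abs_nonneg _).trans (le_max_left _ _)
  calc |scOv N σ τ - scCav N i σ τ| * m * max |scOv N σ τ| |scCav N i σ τ| ^ (m - 1)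
      ≤ 1 / √N * m * domOv N σ τ ^ (m - 1) := by gcongr
    _ = _ := by ring

/-- Averaging the site products recovers the overlap. -/
lemma sum_spinProd {N : ℕ} (hN : 1 ≤ N) (σ τ : Config N) :
    ∑ i, √N * spinProd i σ τ = N * scOv N σ τ := by
  have : (N : ℝ) ≠ 0 := by positivity
  rw [← Finset.mul_sum, scOv, ovlp]
  simp only [spinProd]
  field_simp

variable {κ : Type*} [Fintype κ] [DecidableEq κ]

/-- A Gaussian exponent on spin configurations with the covariance of the SK model together with
the sets of coordinates that involve a given site. -/
structure SKSystem (N : ℕ) (β : ℝ) (b : κ → Config N → ℝ) (T : Fin N → Finset κ) : Prop where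
  cov : ∀ σ τ, ∑ k, b k σ * b k τ = β ^ 2 / 2 * (N * ovlp N σ τ ^ 2 - 1)
  site : ∀ i σ τ, ∑ k ∈ T i, b k σ * b k τ = β ^ 2 * (spinProd i σ τ * ovCav N i σ τ)
  off : ∀ i, ∀ k ∉ T i, ∀ σ, b k (flipAt i σ) = b k σ

/-- The cavity kernel of a single SK system. -/
def siteKer (N : ℕ) (β : ℝ) (i : Fin N) (σ τ : Config N) : ℝ :=
  β ^ 2 * (spinProd i σ τ * ovCav N i σ τ)

lemma abs_spinProd_mul_ovCav_le {N : ℕ} (i : Fin N) (σ τ : Config N) :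
    |spinProd i σ τ * ovCav N i σ τ| ≤ 1 / √N * domOv N σ τ := by
  have hs : 0 < √(N : ℝ) := by linarith [one_le_sqrt_nat i.pos]
  have h1 := abs_scCav_le i σ τ
  rw [scCav, abs_mul, abs_of_pos hs] at h1
  rw [abs_mul, abs_spinProd, one_mul, one_div_mul_eq_div, le_div_iff₀ hs]
  linarith

lemma SKSystem.cavityData {N : ℕ} {β : ℝ} (hβ : β ^ 2 ≤ 1) {b : κ → Config N → ℝ}
    {T : Fin N → Finset κ} (h : SKSystem N β b T) (i : Fin N) :
    CavityData b (T i) (siteKer N β i) (fun _ => 0) (flipAt i) (flipAt i) (domOv N)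
      (fun _ => 0) (1 / √N) 2 where
  ker := h.site i
  diag := ⟨β ^ 2 * (1 - 1 / N), fun σ => by
    have h1 := ovlp_eq i σ σ
    rw [ovlp_self i.pos, spin_mul_self] at h1
    rw [siteKer, spinProd, spin_mul_self, one_mul, add_zero]
    congr 1; linarith⟩
  inv := flipAt_involutive i
  inv' := flipAt_involutive i
  off := h.off i
  off' := h.off i
  odd σ τ := by rw [siteKer, spinProd_flip_left, ovCav_flip_left, siteKer]; ring
  odd' _ := by simp
  bound σ τ := by
    rw [siteKer, abs_mul, abs_of_nonneg (sq_nonneg β)]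
    have := abs_spinProd_mul_ovCav_le i σ τ
    have h2 := abs_nonneg (spinProd i σ τ * ovCav N i σ τ)
    nlinarith
  bound' _ := by simp
  nonneg σ τ := (domOv_pos σ τ).le
  nonneg' _ := le_rfl
  le σ τ := domOv_le i.pos σ τ
  le' _ := by norm_num
  theta := by positivity

end SpinSystems

section gibbs

variable {S : Type*} [Fintype S] [Nonempty S]

lemma gav_one (H : S → ℝ) (f : (Fin 1 → S) → ℝ) :
    gav H f = ∑ x, f (fun _ => x) * gibbsProb H x := by
  unfold gav
  rw [← (Equiv.funUnique (Fin 1) S).symm.sum_comp]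
  refine Finset.sum_congr rfl fun x _ => ?_
  rw [Fin.prod_univ_one]
  rfl

lemma gav_two (H : S → ℝ) (f : (Fin 2 → S) → ℝ) :
    gav H f = ∑ x, ∑ y, f ![x, y] * (gibbsProb H x * gibbsProb H y) := by
  unfold gav
  rw [← (finTwoArrowEquiv S).symm.sum_comp, Fintype.sum_prod_type]
  simp [Fin.prod_univ_two, finTwoArrowEquiv]

lemma gav_three (H : S → ℝ) (f : (Fin 3 → S) → ℝ) :
    gav H f = ∑ z, gibbsProb H z * ∑ x, ∑ y, f ![x, y, z] * (gibbsProb H x * gibbsProb H y) := by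
  rw [gav_snoc, ← (finTwoArrowEquiv S).symm.sum_comp, Fintype.sum_prod_type]
  have h : ∀ x y z : S, Fin.snoc (α := fun _ => S) ![x, y] z = ![x, y, z] := by
    intro x y z
    ext j
    fin_cases j <;> rfl
  have h' : ∀ x y : S, (finTwoArrowEquiv S).symm (x, y) = ![x, y] := fun _ _ => rfl
  simp only [h', Fin.prod_univ_two, h, Finset.sum_mul,
    Finset.mul_sum, Matrix.cons_val_zero, Matrix.cons_val_one]
  rw [Finset.sum_comm]
  conv_rhs => rw [Finset.sum_comm]
  conv_lhs => rw [Finset.sum_comm]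
  refine Finset.sum_congr rfl fun x _ => ?_
  rw [Finset.sum_comm]
  refine Finset.sum_congr rfl fun z _ => Finset.sum_congr rfl fun y _ => by ring

lemma sum_mul_pow_eq {ι : Type*} [DecidableEq ι] (J : Finset ι) (u v : ι → ℝ) (m : ℕ) :
    (∑ j ∈ J, u j * v j) ^ m =
      ∑ q ∈ Fintype.piFinset (fun _ : Fin m => J), (∏ a, u (q a)) * ∏ a, v (q a) := by
  rw [Finset.sum_pow']
  exact Finset.sum_congr rfl fun q _ => Finset.prod_mul_distrib

lemma gav_pow_mul_nonneg {ι : Type*} [DecidableEq ι] (J : Finset ι) (φ : ι → S → ℝ) (m : ℕ)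
    (v : S → S → ℝ) (H : S → ℝ) :
    0 ≤ gav H (fun ρ : Fin 3 → S =>
      (∑ j ∈ J, φ j (ρ 0) * φ j (ρ 1)) ^ m * (v (ρ 0) (ρ 2) * v (ρ 1) (ρ 2))) := by
  simp only [sum_mul_pow_eq, Finset.sum_mul]
  rw [gav_finset_sum]
  refine Finset.sum_nonneg fun q _ => ?_
  rw [gav_three]
  refine Finset.sum_nonneg fun z _ => mul_nonneg (gibbsProb_pos H z).le ?_
  have : ∑ x, ∑ y, (∏ a, φ (q a) x) * (∏ a, φ (q a) y) * (v x z * v y z) *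
      (gibbsProb H x * gibbsProb H y) = (∑ x, (∏ a, φ (q a) x) * v x z * gibbsProb H x) ^ 2 := by
    rw [sq, Finset.sum_mul_sum]
    exact Finset.sum_congr rfl fun x _ => Finset.sum_congr rfl fun y _ => by ring
  exact le_of_le_of_eq (sq_nonneg _) this.symm

end gibbs

lemma nu_pow_scCav_mul_nonneg {N : ℕ} {κ : Type*} [Fintype κ] [DecidableEq κ]
    (c : κ → Config N → ℝ) (i : Fin N) (m : ℕ) {n : ℕ} (a a' d : Fin n) (h : a ≠ a')
    (h1 : a ≠ d) (h2 : a' ≠ d) :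
    0 ≤ nu c (fun ρ : Fin n → Config N => scCav N i (ρ a) (ρ a') ^ m *
      (ovCav N i (ρ a) (ρ d) * ovCav N i (ρ a') (ρ d))) := by
  have he : Function.Injective ![a, a', d] := by
    intro x y
    fin_cases x <;> fin_cases y <;> simp [h, h1, h2, h.symm, h1.symm, h2.symm]
  have := nu_comp_injective c he (fun ρ : Fin 3 → Config N => scCav N i (ρ 0) (ρ 1) ^ m *
      (ovCav N i (ρ 0) (ρ 2) * ovCav N i (ρ 1) (ρ 2)))
  simp only [Function.comp_apply, Matrix.cons_val_zero, Matrix.cons_val_one,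
    Matrix.cons_val_two, Matrix.cons_val, Matrix.tail_cons, Matrix.head_cons] at this
  rw [this]
  refine integral_nonneg fun ω => ?_
  have h3 := gav_pow_mul_nonneg (univ.erase i) (fun j (σ : Config N) => spin (σ j)) m
    (ovCav N i) (linH c ω)
  have h4 : (fun ρ : Fin 3 → Config N => scCav N i (ρ 0) (ρ 1) ^ m *
      (ovCav N i (ρ 0) (ρ 2) * ovCav N i (ρ 1) (ρ 2))) = fun ρ => (√N / N) ^ m *
      ((∑ j ∈ univ.erase i, spin (ρ 0 j) * spin (ρ 1 j)) ^ m *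
        (ovCav N i (ρ 0) (ρ 2) * ovCav N i (ρ 1) (ρ 2))) := by
    ext ρ
    have : scCav N i (ρ 0) (ρ 1) = √N / N * ∑ j ∈ univ.erase i, spin (ρ 0 j) * spin (ρ 1 j) := by
      rw [scCav, ovCav]; ring
    rw [this, mul_pow]; ring
  rw [h4, gav_const_mul]
  positivity

/-- The test function of the cavity computation for the even overlap moments. -/
def cavTest (N : ℕ) (i : Fin N) (m : ℕ) (ρ : Fin 2 → Config N) : ℝ :=
  √N * (spinProd i (ρ 0) (ρ 1) * scCav N i (ρ 0) (ρ 1) ^ m)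

/-- The sign by which a pair of replicas changes when replica `j` is flipped. -/
def pairSign {n : ℕ} (j a a' : Fin n) : ℤ := if j = a ∨ j = a' then -1 else 1

lemma spinProd_update {N n : ℕ} (i : Fin N) (j a a' : Fin n) (h : a ≠ a')
    (ρ : Fin n → Config N) :
    spinProd i (Function.update ρ j (flipAt i (ρ j)) a) (Function.update ρ j (flipAt i (ρ j)) a') =
      pairSign j a a' * spinProd i (ρ a) (ρ a') := by
  unfold pairSign
  by_cases h1 : j = a
  · subst h1
    simp [Function.update_of_ne h.symm, spinProd_flip_left]
  · by_cases h2 : j = a'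
    · subst h2
      simp [Function.update_of_ne h, spinProd_flip_right]
    · simp [h1, h2, Function.update_of_ne (Ne.symm h1), Function.update_of_ne (Ne.symm h2)]

lemma ovCav_update {N n : ℕ} (i : Fin N) (j a a' : Fin n) (ρ : Fin n → Config N) :
    ovCav N i (Function.update ρ j (flipAt i (ρ j)) a) (Function.update ρ j (flipAt i (ρ j)) a') =
      ovCav N i (ρ a) (ρ a') := by
  have h : ∀ d, ∀ τ, ovCav N i (Function.update ρ j (flipAt i (ρ j)) d) τ = ovCav N i (ρ d) τ := by
    intro d τ
    by_cases h1 : j = d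
    · subst h1; rw [Function.update_self, ovCav_flip_left]
    · rw [Function.update_of_ne (Ne.symm h1)]
  rw [h, ovCav_comm, h, ovCav_comm]

section

variable {κ : Type*} [Fintype κ] [DecidableEq κ] {N : ℕ} {β : ℝ} {b : κ → Config N → ℝ}
  {T : Fin N → Finset κ}

lemma SKSystem.nu_zero_triple_eq_zero (h : SKSystem N β b T) (hβ : β ^ 2 ≤ 1) (i : Fin N) (m : ℕ)
    {j a a' l l' : Fin 4} (ha : a ≠ a') (hl : l ≠ l')
    (hj : pairSign j 0 1 * pairSign j a a' * pairSign j l l' = -1) :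
    nu (coefS b (T i) 0) (fun ρ : Fin 4 → Config N => cavTest N i m (dropTwo ρ) *
      siteKer N β i (ρ a) (ρ a') * siteKer N β i (ρ l) (ρ l')) = 0 := by
  refine (h.cavityData hβ i).nu_zero_eq_zero j fun ρ => ?_
  have h01 : (0 : Fin 4) ≠ 1 := by decide
  have hd : ∀ ρ : Fin 4 → Config N, cavTest N i m (dropTwo ρ) =
      √N * (spinProd i (ρ 0) (ρ 1) * (√N * ovCav N i (ρ 0) (ρ 1)) ^ m) := fun ρ => rfl
  simp only [hd, siteKer, spinProd_update i j _ _ h01, spinProd_update i j _ _ ha,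
    spinProd_update i j _ _ hl, ovCav_update]
  have hj' : ((pairSign j 0 1 : ℤ) : ℝ) * pairSign j a a' * pairSign j l l' = -1 := by
    exact_mod_cast hj
  linear_combination (√N * (spinProd i (ρ 0) (ρ 1) * (√N * ovCav N i (ρ 0) (ρ 1)) ^ m) *
    (β ^ 2 * (spinProd i (ρ a) (ρ a') * ovCav N i (ρ a) (ρ a'))) *
    (β ^ 2 * (spinProd i (ρ l) (ρ l') * ovCav N i (ρ l) (ρ l')))) * hj'

lemma siteKer_comm (N : ℕ) (β : ℝ) (i : Fin N) (σ τ : Config N) :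
    siteKer N β i σ τ = siteKer N β i τ σ := by
  rw [siteKer, spinProd_comm, ovCav_comm, siteKer]

lemma nu_triple_nonneg (c : κ → Config N → ℝ) (i : Fin N) (m : ℕ)
    {a a' d : Fin 4} (ha : (a = 0 ∧ a' = 1) ∨ (a = 1 ∧ a' = 0)) (hd : a ≠ d) (hd' : a' ≠ d) :
    0 ≤ nu c (fun ρ : Fin 4 → Config N => cavTest N i m (dropTwo ρ) *
      siteKer N β i (ρ a) (ρ d) * siteKer N β i (ρ a') (ρ d)) := by
  have h0 := nu_pow_scCav_mul_nonneg c i m a a' d (by rcases ha with ⟨rfl, rfl⟩ | ⟨rfl, rfl⟩ <;> decide)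
    hd hd'
  have h1 : (fun ρ : Fin 4 → Config N => cavTest N i m (dropTwo ρ) *
      siteKer N β i (ρ a) (ρ d) * siteKer N β i (ρ a') (ρ d)) = fun ρ => (√N * β ^ 4) *
      (scCav N i (ρ a) (ρ a') ^ m * (ovCav N i (ρ a) (ρ d) * ovCav N i (ρ a') (ρ d))) := by
    ext ρ
    have h2 : cavTest N i m (dropTwo ρ) = √N * (spinProd i (ρ a) (ρ a') *
        scCav N i (ρ a) (ρ a') ^ m) := by
      rcases ha with ⟨rfl, rfl⟩ | ⟨rfl, rfl⟩
      · rfl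
      · rw [spinProd_comm, scCav, ovCav_comm]; rfl
    have h3 : spinProd i (ρ a) (ρ a') * spinProd i (ρ a) (ρ d) * spinProd i (ρ a') (ρ d) = 1 := by
      have e1 := spin_mul_self (ρ a i)
      have e2 := spin_mul_self (ρ a' i)
      have e3 := spin_mul_self (ρ d i)
      unfold spinProd
      calc _ = (spin (ρ a i) * spin (ρ a i)) * (spin (ρ a' i) * spin (ρ a' i)) *
            (spin (ρ d i) * spin (ρ d i)) := by ring
        _ = 1 := by rw [e1, e2, e3]; norm_num
    rw [h2, siteKer, siteKer]
    linear_combination (√N * β ^ 4 * (scCav N i (ρ a) (ρ a') ^ m *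
      (ovCav N i (ρ a) (ρ d) * ovCav N i (ρ a') (ρ d)))) * h3
  rw [h1, nu_const_mul]
  positivity

lemma SKSystem.nu_zero_triple_nonneg (h : SKSystem N β b T) (hβ : β ^ 2 ≤ 1) (i : Fin N) (m : ℕ)
    {a a' d : Fin 4} (ha : (a = 0 ∧ a' = 1) ∨ (a = 1 ∧ a' = 0)) (hd : a ≠ d) (hd' : a' ≠ d)
    (l l' : Fin 4) (hl : l ≠ l') :
    0 ≤ nu (coefS b (T i) 0) (fun ρ : Fin 4 → Config N => cavTest N i m (dropTwo ρ) *
      siteKer N β i (ρ a) (ρ d) * siteKer N β i (ρ l) (ρ l')) := by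
  by_cases hj : ∃ j, pairSign j 0 1 * pairSign j a d * pairSign j l l' = -1
  · obtain ⟨j, hj⟩ := hj
    exact (h.nu_zero_triple_eq_zero hβ i m hd hl hj).ge
  · have key : ∀ a a' d l l' : Fin 4, ((a = 0 ∧ a' = 1) ∨ (a = 1 ∧ a' = 0)) → a ≠ d → a' ≠ d →
        l ≠ l' → (¬ ∃ j, pairSign j 0 1 * pairSign j a d * pairSign j l l' = -1) →
        (l = a' ∧ l' = d) ∨ (l = d ∧ l' = a') := by
      unfold pairSign; decide
    rcases key a a' d l l' ha hd hd' hl hj with ⟨rfl, rfl⟩ | ⟨rfl, rfl⟩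
    · exact nu_triple_nonneg _ i m ha hd hd'
    · have := nu_triple_nonneg (β := β) (coefS b (T i) 0) i m ha hd hd'
      simpa only [siteKer_comm N β i _ (_)] using by
        simp only [siteKer_comm N β i (_) _] at this ⊢
        exact this

lemma cavOp_two (U : Config N → Config N → ℝ) (hU : ∀ x y, U x y = U y x)
    (f : (Fin 2 → Config N) → ℝ) (ρ : Fin 4 → Config N) :
    cavOp U (fun _ => 0) f ρ = f (dropTwo ρ) * U (ρ 0) (ρ 1) + 3 * (f (dropTwo ρ) * U (ρ 2) (ρ 3))
      - (1 / 2 * (f (dropTwo ρ) * U (ρ 0) (ρ 2)) + 1 / 2 * (f (dropTwo ρ) * U (ρ 1) (ρ 2)) +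
        3 / 2 * (f (dropTwo ρ) * U (ρ 0) (ρ 3)) + 3 / 2 * (f (dropTwo ρ) * U (ρ 1) (ρ 3))) := by
  have h : ∑ l : Fin (2 + 1), ∑ l' : Fin (2 + 2),
      replWt 2 l * replWt (2 + 1) l' * replKer U (fun _ => 0) ρ l.castSucc l' =
      2 * U (ρ 0) (ρ 1) + 6 * U (ρ 2) (ρ 3) - (U (ρ 0) (ρ 2) + U (ρ 1) (ρ 2) +
        3 * U (ρ 0) (ρ 3) + 3 * U (ρ 1) (ρ 3)) := by
    have e1 := hU (ρ 1) (ρ 0)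
    have e2 := hU (ρ 2) (ρ 0)
    have e3 := hU (ρ 2) (ρ 1)
    have r0 : replWt 2 0 = 1 := by simp [replWt, Fin.ext_iff]
    have r1 : replWt 2 1 = 1 := by simp [replWt, Fin.ext_iff]
    have r2 : replWt 2 2 = -2 := by simp [replWt, Fin.ext_iff]
    have s0 : replWt (2 + 1) 0 = 1 := by simp [replWt, Fin.ext_iff]
    have s1 : replWt (2 + 1) 1 = 1 := by simp [replWt, Fin.ext_iff]
    have s2 : replWt (2 + 1) 2 = 1 := by simp [replWt, Fin.ext_iff]
    have s3 : replWt (2 + 1) 3 = -3 := by simp [replWt, Fin.ext_iff]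
    have k : ∀ (l : Fin 3) (l' : Fin 4), replKer U (fun _ => 0) ρ l.castSucc l' =
      if l.castSucc = l' then 0 else U (ρ l.castSucc) (ρ l') := fun l l' => rfl
    have c0 : (Fin.castSucc 0 : Fin 4) = 0 := rfl
    have c1 : (Fin.castSucc 1 : Fin 4) = 1 := rfl
    have c2 : (Fin.castSucc 2 : Fin 4) = 2 := rfl
    have f3 : ∀ g : Fin (2 + 1) → ℝ, ∑ l, g l = g 0 + g 1 + g 2 := Fin.sum_univ_three
    have f4 : ∀ g : Fin (2 + 2) → ℝ, ∑ l, g l = g 0 + g 1 + g 2 + g 3 := Fin.sum_univ_four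
    simp only [f3, f4, k, r0, r1, r2, s0, s1, s2, s3, c0, c1, c2]
    simp [Fin.ext_iff, e1, e2, e3]
    ring
  rw [cavOp, h]; ring

/-- The second derivative at the start of the cavity interpolation is nonpositive. -/
lemma SKSystem.nu_zero_cavOp_cavOp_nonpos (h : SKSystem N β b T) (hβ : β ^ 2 ≤ 1) (i : Fin N)
    (m : ℕ) :
    nu (coefS b (T i) 0) (cavOp (siteKer N β i) (fun _ => 0)
      (cavOp (siteKer N β i) (fun _ => 0) (cavTest N i m))) ≤ 0 := by
  rw [(h.cavityData hβ i).nu_zero_cavOp]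
  suffices hs : ∀ l l' : Fin 4, nu (coefS b (T i) 0) (fun ρ : Fin 4 → Config N =>
      cavOp (siteKer N β i) (fun _ => 0) (cavTest N i m) ρ *
        replKer (siteKer N β i) (fun _ => 0) ρ l l') ≤ 0 by
    have := Finset.sum_nonpos fun l (_ : l ∈ (univ : Finset (Fin 4))) =>
      Finset.sum_nonpos fun l' (_ : l' ∈ (univ : Finset (Fin 4))) => hs l l'
    linarith
  intro l l'
  by_cases hl : l = l'
  · subst hl
    simp [replKer, nu_const]
  · have e : (fun ρ : Fin 4 → Config N => cavOp (siteKer N β i) (fun _ => 0) (cavTest N i m) ρ *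
        replKer (siteKer N β i) (fun _ => 0) ρ l l') = fun ρ =>
        cavTest N i m (dropTwo ρ) * siteKer N β i (ρ 0) (ρ 1) * siteKer N β i (ρ l) (ρ l') +
        3 * (cavTest N i m (dropTwo ρ) * siteKer N β i (ρ 2) (ρ 3) * siteKer N β i (ρ l) (ρ l')) -
        (1 / 2 * (cavTest N i m (dropTwo ρ) * siteKer N β i (ρ 0) (ρ 2) *
            siteKer N β i (ρ l) (ρ l')) +
          1 / 2 * (cavTest N i m (dropTwo ρ) * siteKer N β i (ρ 1) (ρ 2) *
            siteKer N β i (ρ l) (ρ l')) +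
          3 / 2 * (cavTest N i m (dropTwo ρ) * siteKer N β i (ρ 0) (ρ 3) *
            siteKer N β i (ρ l) (ρ l')) +
          3 / 2 * (cavTest N i m (dropTwo ρ) * siteKer N β i (ρ 1) (ρ 3) *
            siteKer N β i (ρ l) (ρ l'))) := by
      ext ρ
      rw [cavOp_two _ (siteKer_comm N β i), replKer, if_neg hl]
      ring
    rw [e, nu_sub, nu_add, nu_add, nu_add, nu_add]
    simp only [nu_const_mul]
    have par : ∀ l l' : Fin 4, l ≠ l' →
        (∃ j : Fin 4, pairSign j 0 1 * pairSign j 0 1 * pairSign j l l' = -1) ∧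
        ∃ j : Fin 4, pairSign j 0 1 * pairSign j 2 3 * pairSign j l l' = -1 := by
      unfold pairSign; decide
    obtain ⟨⟨j, hj⟩, ⟨j', hj'⟩⟩ := par l l' hl
    rw [h.nu_zero_triple_eq_zero hβ i m (by decide) hl hj,
      h.nu_zero_triple_eq_zero hβ i m (by decide) hl hj']
    have t1 := h.nu_zero_triple_nonneg hβ i m (a := 0) (a' := 1) (d := 2) (by decide) (by decide)
      (by decide) l l' hl
    have t2 := h.nu_zero_triple_nonneg hβ i m (a := 1) (a' := 0) (d := 2) (by decide) (by decide)
      (by decide) l l' hl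
    have t3 := h.nu_zero_triple_nonneg hβ i m (a := 0) (a' := 1) (d := 3) (by decide) (by decide)
      (by decide) l l' hl
    have t4 := h.nu_zero_triple_nonneg hβ i m (a := 1) (a' := 0) (d := 3) (by decide) (by decide)
      (by decide) l l' hl
    linarith

end

section

variable {S : Type*} [Fintype S] [Nonempty S] {κ : Type*} [Fintype κ] [DecidableEq κ]

lemma pow_sum_le_mul_sum_pow {ι : Type*} (J : Finset ι) (x : ι → ℝ) (hx : ∀ j ∈ J, 0 ≤ x j)
    (p : ℕ) (hp : p ≠ 0) : (∑ j ∈ J, x j) ^ p ≤ (J.card : ℝ) ^ p * ∑ j ∈ J, x j ^ p := by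
  rcases J.eq_empty_or_nonempty with rfl | hJ
  · simp [hp]
  obtain ⟨m, hm, hmax⟩ := J.exists_max_image x hJ
  have h1 : ∑ j ∈ J, x j ≤ J.card * x m := by
    have := Finset.sum_le_card_nsmul J x (x m) hmax
    rwa [nsmul_eq_mul] at this
  have h2 : x m ^ p ≤ ∑ j ∈ J, x j ^ p :=
    Finset.single_le_sum (f := fun j => x j ^ p) (fun j hj => pow_nonneg (hx j hj) p) hm
  calc (∑ j ∈ J, x j) ^ p ≤ (J.card * x m) ^ p :=
        pow_le_pow_left₀ (Finset.sum_nonneg hx) h1 p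
    _ = J.card ^ p * x m ^ p := mul_pow _ _ _
    _ ≤ _ := by gcongr

/-- Moments of the total kernel are controlled by moments of single kernels. -/
lemma nu_totKer_pow_le (c : κ → S → ℝ) {G : S → S → ℝ} {w' : S → ℝ} (hG : ∀ x y, 0 ≤ G x y)
    (hw : ∀ x, 0 ≤ w' x) (n p : ℕ) (hp : p ≠ 0) {M : ℝ}
    (h1 : nu c (fun ρ : Fin 2 → S => G (ρ 0) (ρ 1) ^ p) ≤ M)
    (h2 : nu c (fun ρ : Fin 1 → S => w' (ρ 0) ^ p) ≤ M) :
    nu c (fun ρ : Fin n → S => totKer G w' ρ ^ p) ≤ ((n : ℝ) * n) ^ p * (n * n) * M := by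
  have hr : ∀ (ρ : Fin n → S) l l', 0 ≤ replKer G w' ρ l l' := by
    intro ρ l l'; unfold replKer; split_ifs
    · exact hw _
    · exact hG _ _
  have e : ∀ l l' : Fin n, nu c (fun ρ : Fin n → S => replKer G w' ρ l l' ^ p) ≤ M := by
    intro l l'
    by_cases hl : l = l'
    · subst hl
      have := nu_comp_injective c (e := ![l]) (fun x y _ => Subsingleton.elim x y)
        (fun ρ : Fin 1 → S => w' (ρ 0) ^ p)
      simp only [Function.comp_apply, Matrix.cons_val_zero] at this
      simp only [replKer, if_true]
      rw [this]; exact h2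
    · have he : Function.Injective ![l, l'] := by
        intro x y
        fin_cases x <;> fin_cases y <;> simp [hl, Ne.symm hl]
      have := nu_comp_injective c he (fun ρ : Fin 2 → S => G (ρ 0) (ρ 1) ^ p)
      simp only [Function.comp_apply, Matrix.cons_val_zero, Matrix.cons_val_one] at this
      simp only [replKer, hl, if_false]
      rw [this]; exact h1
  have h3 : ∀ ρ : Fin n → S, totKer G w' ρ ^ p ≤
      ((n : ℝ) * n) ^ p * ∑ q : Fin n × Fin n, replKer G w' ρ q.1 q.2 ^ p := by
    intro ρ
    have := pow_sum_le_mul_sum_pow (univ : Finset (Fin n × Fin n))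
      (fun q => replKer G w' ρ q.1 q.2) (fun q _ => hr ρ q.1 q.2) p hp
    rw [Fintype.sum_prod_type] at this
    simpa [totKer] using this
  refine (nu_mono c h3).trans ?_
  rw [nu_const_mul, nu_finset_sum, mul_assoc]
  refine mul_le_mul_of_nonneg_left ?_ (by positivity)
  have := Finset.sum_le_card_nsmul (univ : Finset (Fin n × Fin n))
    (fun q => nu c (fun ρ : Fin n → S => replKer G w' ρ q.1 q.2 ^ p)) M (fun q _ => e q.1 q.2)
  simpa using this

end

/-- Moments of the rescaled overlap of two replicas. -/
def ovMom {κ : Type*} [Fintype κ] [DecidableEq κ] (N : ℕ) (b : κ → Config N → ℝ) (p : ℕ) : ℝ :=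
  nu b (fun ρ : Fin 2 → Config N => scOv N (ρ 0) (ρ 1) ^ p)

/-- Moments of the dominating overlap of two replicas. -/
def domMom {κ : Type*} [Fintype κ] [DecidableEq κ] (N : ℕ) (b : κ → Config N → ℝ) (p : ℕ) : ℝ :=
  nu b (fun ρ : Fin 2 → Config N => domOv N (ρ 0) (ρ 1) ^ p)

section

variable {κ : Type*} [Fintype κ] [DecidableEq κ] {N : ℕ} {β : ℝ} {b : κ → Config N → ℝ}
  {T : Fin N → Finset κ}

lemma domMom_nonneg (b : κ → Config N → ℝ) (p : ℕ) : 0 ≤ domMom N b p :=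
  nu_nonneg b fun ρ => pow_nonneg (domOv_pos _ _).le p

lemma ovMom_nonneg (b : κ → Config N → ℝ) (k : ℕ) : 0 ≤ ovMom N b (2 * k) :=
  nu_nonneg b fun ρ => (even_two_mul k).pow_nonneg _

lemma domMom_le (b : κ → Config N → ℝ) (k : ℕ) :
    domMom N b (2 * k) ≤ 2 ^ (2 * k) * (ovMom N b (2 * k) + 1) := by
  have h : ∀ ρ : Fin 2 → Config N, domOv N (ρ 0) (ρ 1) ^ (2 * k) ≤
      2 ^ (2 * k) * (scOv N (ρ 0) (ρ 1) ^ (2 * k) + 1) := by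
    intro ρ
    have h1 := add_pow_le (abs_nonneg (scOv N (ρ 0) (ρ 1))) zero_le_one (2 * k)
    rw [one_pow, (even_two_mul k).pow_abs] at h1
    refine h1.trans ?_
    have h2 : 0 ≤ scOv N (ρ 0) (ρ 1) ^ (2 * k) := (even_two_mul k).pow_nonneg _
    gcongr
    · norm_num
    · omega
  refine (nu_mono b h).trans (le_of_eq ?_)
  rw [nu_const_mul, nu_add, nu_const, ovMom]

lemma nu_totKer_domOv_le (b : κ → Config N → ℝ) (n p : ℕ) (hp : p ≠ 0) :
    nu b (fun ρ : Fin n → Config N => totKer (domOv N) (fun _ => 0) ρ ^ p) ≤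
      ((n : ℝ) * n) ^ p * (n * n) * domMom N b p :=
  nu_totKer_pow_le b (fun _ _ => (domOv_pos _ _).le) (fun _ => le_rfl) n p hp le_rfl (by
    simp only [ne_eq, hp, not_false_eq_true, zero_pow, nu_const]; exact domMom_nonneg b p)

lemma domOv_le_totKer {n : ℕ} (ρ : Fin n → Config N) {l l' : Fin n} (hl : l ≠ l') :
    domOv N (ρ l) (ρ l') ≤ totKer (domOv N) (fun _ => 0) ρ := by
  have hr : ∀ l l', 0 ≤ replKer (domOv N) (fun _ => 0) ρ l l' := by
    intro l l'; unfold replKer; split_ifs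
    · exact le_rfl
    · exact (domOv_pos _ _).le
  have h1 : domOv N (ρ l) (ρ l') = replKer (domOv N) (fun _ => 0) ρ l l' := by simp [replKer, hl]
  rw [h1]
  refine (Finset.single_le_sum (f := fun l' => replKer (domOv N) (fun _ => 0) ρ l l')
    (fun l' _ => hr l l') (mem_univ l')).trans ?_
  exact Finset.single_le_sum (f := fun l => ∑ l', replKer (domOv N) (fun _ => 0) ρ l l')
    (fun l _ => Finset.sum_nonneg fun l' _ => hr l l') (mem_univ l)

lemma SKSystem.nu_zero_cavOp_cavTest (h : SKSystem N β b T) (hβ : β ^ 2 ≤ 1) (i : Fin N)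
    (m : ℕ) :
    nu (coefS b (T i) 0) (cavOp (siteKer N β i) (fun _ => 0) (cavTest N i m)) =
      β ^ 2 * nu (coefS b (T i) 0) (fun ρ : Fin 2 → Config N => scCav N i (ρ 0) (ρ 1) ^ (m + 1)) := by
  rw [(h.cavityData hβ i).nu_zero_cavOp, ← nu_const_mul]
  simp only [← nu_finset_sum, ← nu_const_mul]
  congr 1
  ext ρ
  simp only [Fin.sum_univ_two, replKer, cavTest]
  have h1 := spinProd_mul_self i (ρ 0) (ρ 1)
  have h2 := siteKer_comm N β i (ρ 1) (ρ 0)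
  simp only [if_true, Fin.isValue, zero_ne_one, one_ne_zero, if_false, h2]
  simp only [siteKer]
  have h3 : scCav N i (ρ 0) (ρ 1) = √N * ovCav N i (ρ 0) (ρ 1) := rfl
  rw [pow_succ]
  linear_combination (β ^ 2 * √N * ovCav N i (ρ 0) (ρ 1) * scCav N i (ρ 0) (ρ 1) ^ m) * h1 -
    β ^ 2 * scCav N i (ρ 0) (ρ 1) ^ m * h3

lemma SKSystem.nu_zero_cavTest (h : SKSystem N β b T) (hβ : β ^ 2 ≤ 1) (i : Fin N) (m : ℕ) :
    nu (coefS b (T i) 0) (cavTest N i m) = 0 := by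
  refine (h.cavityData hβ i).nu_zero_eq_zero 0 fun ρ => ?_
  simp [cavTest, spinProd_flip_left, scCav_flip_left]

lemma SKSystem.nu_zero_cavOp_scCav (h : SKSystem N β b T) (hβ : β ^ 2 ≤ 1) (i : Fin N) (m : ℕ) :
    nu (coefS b (T i) 0) (cavOp (siteKer N β i) (fun _ => 0)
      (fun ρ : Fin 2 → Config N => scCav N i (ρ 0) (ρ 1) ^ m)) = 0 := by
  rw [(h.cavityData hβ i).nu_zero_cavOp]
  have : ∀ l l' : Fin 2, nu (coefS b (T i) 0) (fun ρ : Fin 2 → Config N =>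
      scCav N i (ρ 0) (ρ 1) ^ m * replKer (siteKer N β i) (fun _ => 0) ρ l l') = 0 := by
    intro l l'
    by_cases hl : l = l'
    · simp [replKer, hl, nu_const]
    · refine (h.cavityData hβ i).nu_zero_eq_zero l fun ρ => ?_
      simp only [replKer, hl, if_false, scCav, siteKer, ovCav_update, spinProd_update i l l l' hl,
        pairSign, true_or, if_true]
      push_cast; ring
  simp [this]

/-- The constant of the cavity recursion. -/
def recCst (k : ℕ) : ℝ :=
  cavCst 6 * cavCst 4 * cavCst 2 * exp (cavCst 8 * 2) * ((8 * 8) ^ (2 * k + 2) * (8 * 8)) +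
    cavCst 4 * cavCst 2 * exp (cavCst 6 * 2) * ((6 * 6) ^ (2 * k + 2) * (6 * 6)) + 4 * k + 1

lemma SKSystem.site_bound (h : SKSystem N β b T) (hβ : β ^ 2 ≤ 1) (i : Fin N) (k : ℕ)
    (hk : 1 ≤ k) :
    nu b (fun ρ : Fin 2 → Config N =>
      √N * spinProd i (ρ 0) (ρ 1) * scOv N (ρ 0) (ρ 1) ^ (2 * k - 1)) ≤
      β ^ 2 * ovMom N b (2 * k) + recCst k * (domMom N b (2 * k - 2) +
        1 / N * domMom N b (2 * k + 2)) := by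
  have hc := h.cavityData hβ i
  have hN : (0 : ℝ) < N := by have := i.pos; positivity
  have hs : 0 < √(N : ℝ) := sqrt_pos.2 hN
  have hsq : √(N : ℝ) ^ 2 = N := Real.sq_sqrt hN.le
  -- comparison with the cavity test function
  have h1 : nu b (fun ρ : Fin 2 → Config N =>
      √N * spinProd i (ρ 0) (ρ 1) * scOv N (ρ 0) (ρ 1) ^ (2 * k - 1)) ≤
      nu b (cavTest N i (2 * k - 1)) + 2 * k * domMom N b (2 * k - 2) := by
    rw [domMom, ← nu_const_mul, ← nu_add]
    refine nu_mono b fun ρ => ?_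
    have e1 := abs_pow_scOv_sub_le i (2 * k - 1) (ρ 0) (ρ 1)
    have e2 : √N * spinProd i (ρ 0) (ρ 1) * (scOv N (ρ 0) (ρ 1) ^ (2 * k - 1) -
        scCav N i (ρ 0) (ρ 1) ^ (2 * k - 1)) ≤ 2 * k * domOv N (ρ 0) (ρ 1) ^ (2 * k - 2) := by
      refine (le_abs_self _).trans ?_
      rw [abs_mul, abs_mul, abs_spinProd, abs_of_pos hs, mul_one]
      refine (mul_le_mul_of_nonneg_left e1 hs.le).trans ?_
      rw [show 2 * k - 1 - 1 = 2 * k - 2 by omega]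
      have e3 : ((2 * k - 1 : ℕ) : ℝ) ≤ 2 * k := by
        have : 2 * k - 1 ≤ 2 * k := by omega
        exact_mod_cast this
      have e4 : 0 ≤ domOv N (ρ 0) (ρ 1) ^ (2 * k - 2) := pow_nonneg (domOv_pos _ _).le _
      calc _ = ((2 * k - 1 : ℕ) : ℝ) * domOv N (ρ 0) (ρ 1) ^ (2 * k - 2) := by
            field_simp
        _ ≤ _ := by gcongr
    unfold cavTest
    nlinarith
  -- third order expansion
  have h2 := hc.nu_le_of_second_nonpos _ (h.nu_zero_cavOp_cavOp_nonpos hβ i (2 * k - 1))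
  rw [h.nu_zero_cavTest hβ, h.nu_zero_cavOp_cavTest hβ, show 2 * k - 1 + 1 = 2 * k by omega] at h2
  have h3 : (1 / √(N : ℝ)) ^ 3 * nu b (fun ρ : Fin (2 + 2 + 2 + 2) → Config N =>
      totKer (domOv N) (fun _ => 0) ρ ^ 3 *
        |cavTest N i (2 * k - 1) (dropTwo (dropTwo (dropTwo ρ)))|) ≤
      1 / N * ((8 * 8) ^ (2 * k + 2) * (8 * 8) * domMom N b (2 * k + 2)) := by
    have e1 : ∀ ρ : Fin (2 + 2 + 2 + 2) → Config N, totKer (domOv N) (fun _ => 0) ρ ^ 3 *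
        |cavTest N i (2 * k - 1) (dropTwo (dropTwo (dropTwo ρ)))| ≤
        √N * totKer (domOv N) (fun _ => 0) ρ ^ (2 * k + 2) := by
      intro ρ
      have e2 := domOv_le_totKer ρ (l := 0) (l' := 1) (by decide)
      have e3 : |cavTest N i (2 * k - 1) (dropTwo (dropTwo (dropTwo ρ)))| ≤
          √N * totKer (domOv N) (fun _ => 0) ρ ^ (2 * k - 1) := by
        have e4 : cavTest N i (2 * k - 1) (dropTwo (dropTwo (dropTwo ρ))) =
          √N * (spinProd i (ρ 0) (ρ 1) * scCav N i (ρ 0) (ρ 1) ^ (2 * k - 1)) := rfl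
        rw [e4, abs_mul, abs_mul, abs_spinProd, one_mul, abs_of_pos hs, abs_pow]
        gcongr
        exact (abs_scCav_le i _ _).trans e2
      have e5 := hc.totKer_nonneg ρ
      calc _ ≤ totKer (domOv N) (fun _ => 0) ρ ^ 3 *
            (√N * totKer (domOv N) (fun _ => 0) ρ ^ (2 * k - 1)) := by gcongr
        _ = _ := by
          rw [show 2 * k + 2 = 3 + (2 * k - 1) by omega, pow_add]; ring
    have e6 := nu_totKer_domOv_le b (2 + 2 + 2 + 2) (2 * k + 2) (by omega)
    have e7 := nu_mono b e1
    rw [nu_const_mul] at e7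
    calc _ ≤ (1 / √(N : ℝ)) ^ 3 * (√N * (((2 + 2 + 2 + 2 : ℕ) * (2 + 2 + 2 + 2 : ℕ) : ℝ) ^ (2 * k + 2) *
          ((2 + 2 + 2 + 2 : ℕ) * (2 + 2 + 2 + 2 : ℕ)) * domMom N b (2 * k + 2))) := by
          refine mul_le_mul_of_nonneg_left (e7.trans ?_) (by positivity)
          exact mul_le_mul_of_nonneg_left e6 hs.le
      _ = _ := by
          push_cast
          norm_num
          field_simp
          rw [hsq]
          ring
  -- back to the full system
  have h4 := (abs_le.1 (hc.abs_nu_sub_sub_le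
    (fun ρ : Fin 2 → Config N => scCav N i (ρ 0) (ρ 1) ^ (2 * k)))).1
  rw [h.nu_zero_cavOp_scCav hβ, sub_zero] at h4
  have h5 : (1 / √(N : ℝ)) ^ 2 * nu b (fun ρ : Fin (2 + 2 + 2) → Config N =>
      totKer (domOv N) (fun _ => 0) ρ ^ 2 *
        |scCav N i (dropTwo (dropTwo ρ) 0) (dropTwo (dropTwo ρ) 1) ^ (2 * k)|) ≤
      1 / N * ((6 * 6) ^ (2 * k + 2) * (6 * 6) * domMom N b (2 * k + 2)) := by
    have e1 : ∀ ρ : Fin (2 + 2 + 2) → Config N, totKer (domOv N) (fun _ => 0) ρ ^ 2 *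
        |scCav N i (dropTwo (dropTwo ρ) 0) (dropTwo (dropTwo ρ) 1) ^ (2 * k)| ≤
        totKer (domOv N) (fun _ => 0) ρ ^ (2 * k + 2) := by
      intro ρ
      have e2 := domOv_le_totKer ρ (l := 0) (l' := 1) (by decide)
      have e3 : |scCav N i (dropTwo (dropTwo ρ) 0) (dropTwo (dropTwo ρ) 1) ^ (2 * k)| ≤
          totKer (domOv N) (fun _ => 0) ρ ^ (2 * k) := by
        rw [abs_pow]
        refine pow_le_pow_left₀ (abs_nonneg _) ?_ _
        exact (abs_scCav_le i _ _).trans e2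
      have e5 := hc.totKer_nonneg ρ
      calc _ ≤ totKer (domOv N) (fun _ => 0) ρ ^ 2 *
            totKer (domOv N) (fun _ => 0) ρ ^ (2 * k) := by gcongr
        _ = _ := by ring
    have e6 := nu_totKer_domOv_le b (2 + 2 + 2) (2 * k + 2) (by omega)
    have e7 := nu_mono b e1
    calc _ ≤ (1 / √(N : ℝ)) ^ 2 * (((2 + 2 + 2 : ℕ) * (2 + 2 + 2 : ℕ) : ℝ) ^ (2 * k + 2) *
          ((2 + 2 + 2 : ℕ) * (2 + 2 + 2 : ℕ)) * domMom N b (2 * k + 2)) := by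
          exact mul_le_mul_of_nonneg_left (e7.trans e6) (by positivity)
      _ = _ := by
          rw [div_pow, hsq]
          push_cast
          norm_num
  have h6 : nu b (fun ρ : Fin 2 → Config N => scCav N i (ρ 0) (ρ 1) ^ (2 * k)) ≤
      ovMom N b (2 * k) + 2 * k * (domMom N b (2 * k - 2) + 1 / N * domMom N b (2 * k + 2)) := by
    rw [ovMom, domMom, domMom]
    rw [← nu_const_mul, ← nu_add, ← nu_const_mul, ← nu_add]
    refine nu_mono b fun ρ => ?_
    have e1 := (abs_le.1 (abs_pow_scOv_sub_le i (2 * k) (ρ 0) (ρ 1))).1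
    set D := domOv N (ρ 0) (ρ 1) with hD
    have hD1 : 1 ≤ D := one_le_domOv _ _
    have e2 : 1 / √(N : ℝ) * D ^ (2 * k - 1) ≤ D ^ (2 * k - 2) + 1 / N * D ^ (2 * k + 2) := by
      have e3 : D ^ (2 * k - 1) = D ^ (2 * k - 2) * D := by
        rw [← pow_succ]; congr 1; omega
      have e4 : D ^ (2 * k - 2) * D ^ 2 ≤ D ^ (2 * k + 2) := by
        rw [← pow_add]; exact pow_le_pow_right₀ hD1 (by omega)
      have e5 : 0 < D ^ (2 * k - 2) := by positivity
      have e6 : (1 / √(N : ℝ)) ^ 2 = 1 / N := by rw [div_pow, hsq, one_pow]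
      have e7 : 1 / √(N : ℝ) * D ≤ 1 + (1 / √(N : ℝ)) ^ 2 * D ^ 2 := by
        nlinarith [sq_nonneg (1 / √(N : ℝ) * D - 1)]
      rw [e6] at e7
      have e8 : (0 : ℝ) < 1 / N := by positivity
      calc 1 / √(N : ℝ) * D ^ (2 * k - 1) = D ^ (2 * k - 2) * (1 / √(N : ℝ) * D) := by
            rw [e3]; ring
        _ ≤ D ^ (2 * k - 2) * (1 + 1 / N * D ^ 2) := by gcongr
        _ = D ^ (2 * k - 2) + 1 / N * (D ^ (2 * k - 2) * D ^ 2) := by ring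
        _ ≤ _ := by gcongr
    have hk0 : (0 : ℝ) ≤ 2 * k := by positivity
    have e9 := mul_le_mul_of_nonneg_left e2 hk0
    push_cast at e1
    rw [div_mul_eq_mul_div, mul_div_assoc, ← one_div_mul_eq_div] at e1
    linarith
  have hM := domMom_nonneg b (2 * k - 2)
  have hM' : 0 ≤ 1 / N * domMom N b (2 * k + 2) :=
    mul_nonneg (by positivity) (domMom_nonneg b _)
  set K3 := cavCst 6 * cavCst 4 * cavCst 2 * exp (cavCst 8 * 2) with hK3
  set K2 := cavCst 4 * cavCst 2 * exp (cavCst 6 * 2) with hK2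
  have hK3n : 0 ≤ K3 := mul_nonneg (mul_nonneg (mul_nonneg (cavCst_nonneg _) (cavCst_nonneg _))
    (cavCst_nonneg _)) (exp_pos _).le
  have hK2n : 0 ≤ K2 := mul_nonneg (mul_nonneg (cavCst_nonneg _) (cavCst_nonneg _)) (exp_pos _).le
  have h3' := mul_le_mul_of_nonneg_left h3 hK3n
  have h5' := mul_le_mul_of_nonneg_left h5 hK2n
  have h7 : nu (coefS b (T i) 0) (fun ρ : Fin 2 → Config N => scCav N i (ρ 0) (ρ 1) ^ (2 * k)) ≤
      ovMom N b (2 * k) + 2 * k * (domMom N b (2 * k - 2) + 1 / N * domMom N b (2 * k + 2)) +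
      K2 * (1 / N * ((6 * 6) ^ (2 * k + 2) * (6 * 6) * domMom N b (2 * k + 2))) := by
    linarith
  set E := 2 * k * (domMom N b (2 * k - 2) + 1 / N * domMom N b (2 * k + 2)) +
      K2 * (1 / N * ((6 * 6) ^ (2 * k + 2) * (6 * 6) * domMom N b (2 * k + 2))) with hE
  have hE0 : 0 ≤ E := by
    have := domMom_nonneg b (2 * k + 2)
    positivity
  have h8 : β ^ 2 * nu (coefS b (T i) 0)
      (fun ρ : Fin 2 → Config N => scCav N i (ρ 0) (ρ 1) ^ (2 * k)) ≤
      β ^ 2 * ovMom N b (2 * k) + E := by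
    have := mul_le_mul_of_nonneg_left h7 (sq_nonneg β)
    nlinarith
  have h9 : recCst k = K3 * ((8 * 8) ^ (2 * k + 2) * (8 * 8)) +
    K2 * ((6 * 6) ^ (2 * k + 2) * (6 * 6)) + 4 * k + 1 := rfl
  have h10 : 0 ≤ K3 * ((8 * 8 : ℝ) ^ (2 * k + 2) * (8 * 8)) * domMom N b (2 * k - 2) := by
    positivity
  have h11 : 0 ≤ K2 * ((6 * 6 : ℝ) ^ (2 * k + 2) * (6 * 6)) * domMom N b (2 * k - 2) := by
    positivity
  have h12 : (0 : ℝ) ≤ k * (1 / N * domMom N b (2 * k + 2)) := by positivity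
  have h13 := h1.trans (add_le_add_left h2 _)
  rw [h9]
  set Q3 := (8 * 8 : ℝ) ^ (2 * k + 2) * (8 * 8)
  set Q2 := (6 * 6 : ℝ) ^ (2 * k + 2) * (6 * 6)
  rw [hE] at h8
  linarith

lemma recCst_nonneg (k : ℕ) : 0 ≤ recCst k := by
  unfold recCst
  have h2 := cavCst_nonneg 2
  have h4 := cavCst_nonneg 4
  have h6 := cavCst_nonneg 6
  positivity

/-- The cavity recursion for the even moments of the overlap. -/
lemma SKSystem.moment_recursion (h : SKSystem N β b T) (hN : 1 ≤ N) (hβ : β ^ 2 ≤ 1) (k : ℕ) :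
    (1 - β ^ 2) * ovMom N b (2 * (k + 1)) ≤ recCst (k + 1) * 2 ^ (2 * k + 4) *
      ((ovMom N b (2 * k) + 1) + 1 / N * (ovMom N b (2 * (k + 2)) + 1)) := by
  have hN0 : (0 : ℝ) < N := by positivity
  have h1 : (N : ℝ) * ovMom N b (2 * (k + 1)) = ∑ i : Fin N, nu b (fun ρ : Fin 2 → Config N =>
      √N * spinProd i (ρ 0) (ρ 1) * scOv N (ρ 0) (ρ 1) ^ (2 * (k + 1) - 1)) := by
    rw [← nu_finset_sum, ovMom, ← nu_const_mul]
    congr 1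
    ext ρ
    rw [← Finset.sum_mul, sum_spinProd hN, mul_assoc, ← pow_succ']
    congr 2
  have h2 : (N : ℝ) * ovMom N b (2 * (k + 1)) ≤ N * (β ^ 2 * ovMom N b (2 * (k + 1)) +
      recCst (k + 1) * (domMom N b (2 * (k + 1) - 2) + 1 / N * domMom N b (2 * (k + 1) + 2))) := by
    rw [h1]
    refine (Finset.sum_le_card_nsmul _ _ _ fun i _ =>
      h.site_bound hβ i (k + 1) (by omega)).trans (le_of_eq ?_)
    rw [nsmul_eq_mul, Finset.card_univ, Fintype.card_fin]
  have h3 := le_of_mul_le_mul_left h2 hN0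
  rw [show 2 * (k + 1) - 2 = 2 * k by omega, show 2 * (k + 1) + 2 = 2 * (k + 2) by omega] at h3
  have h4 := domMom_le b k
  have h5 := domMom_le b (k + 2)
  have h6 := ovMom_nonneg b k
  have h7 := ovMom_nonneg b (k + 2)
  have h8 := recCst_nonneg (k + 1)
  have h9 : (2 : ℝ) ^ (2 * k) ≤ 2 ^ (2 * k + 4) := pow_le_pow_right₀ (by norm_num) (by omega)
  have h10 : domMom N b (2 * k) + 1 / N * domMom N b (2 * (k + 2)) ≤ 2 ^ (2 * k + 4) *
      ((ovMom N b (2 * k) + 1) + 1 / N * (ovMom N b (2 * (k + 2)) + 1)) := by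
    calc _ ≤ 2 ^ (2 * k) * (ovMom N b (2 * k) + 1) +
          1 / N * (2 ^ (2 * (k + 2)) * (ovMom N b (2 * (k + 2)) + 1)) := by gcongr
      _ ≤ 2 ^ (2 * k + 4) * (ovMom N b (2 * k) + 1) +
          1 / N * (2 ^ (2 * k + 4) * (ovMom N b (2 * (k + 2)) + 1)) := by
          rw [show 2 * (k + 2) = 2 * k + 4 by ring] at *
          gcongr
      _ = _ := by ring
  have h11 := mul_le_mul_of_nonneg_left h10 h8
  rw [mul_assoc]
  linarith

end

section Concentration

variable {E : Type*} [NormedAddCommGroup E] [InnerProductSpace ℝ E] [FiniteDimensional ℝ E]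
  [MeasurableSpace E] [BorelSpace E]

lemma lintegral_exp_dual_stdGaussian (L : StrongDual ℝ E) :
    ∫⁻ y, ENNReal.ofReal (exp (L y)) ∂stdGaussian E = ENNReal.ofReal (exp (‖L‖ ^ 2 / 2)) := by
  have h1 : (stdGaussian E).map L = gaussianReal 0 (‖L‖ ^ 2).toNNReal := by
    rw [IsGaussian.map_eq_gaussianReal, integral_strongDual_stdGaussian,
      variance_dual_stdGaussian]
  have h2 : ∫⁻ y, ENNReal.ofReal (exp (L y)) ∂stdGaussian E =
      ∫⁻ x, ENNReal.ofReal (exp x) ∂gaussianReal 0 (‖L‖ ^ 2).toNNReal := by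
    rw [← h1, lintegral_map (by fun_prop) (by fun_prop)]
  have h3 : Integrable (fun x : ℝ => exp x) (gaussianReal 0 (‖L‖ ^ 2).toNNReal) := by
    simpa using integrable_exp_mul_gaussianReal (μ := 0) (v := (‖L‖ ^ 2).toNNReal) 1
  have h4 := congrFun (mgf_fun_id_gaussianReal (μ := 0) (v := (‖L‖ ^ 2).toNNReal)) 1
  rw [h2, ← ofReal_integral_eq_lintegral_ofReal h3 (ae_of_all _ fun x => (exp_pos x).le)]
  congr 1
  simpa [mgf] using h4

/-- The plane rotation by the angle `π / 2 * s`. -/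
def rotPair (s : ℝ) (p : E × E) : E × E :=
  (cos (π / 2 * s) • p.1 + sin (π / 2 * s) • p.2, -sin (π / 2 * s) • p.1 + cos (π / 2 * s) • p.2)

lemma continuous_rotPair : Continuous fun q : ℝ × (E × E) => rotPair q.1 q.2 := by
  unfold rotPair
  fun_prop

lemma continuous_rotPair_left (p : E × E) : Continuous fun s : ℝ => rotPair s p := by
  unfold rotPair
  fun_prop

lemma exp_sub_le_integral_rotPair {f : E → ℝ} (hf : ContDiff ℝ 1 f) (p : E × E) :
    exp (f p.2 - f p.1) ≤ ∫ s in Set.Icc (0 : ℝ) 1,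
      exp ((π / 2) * fderiv ℝ f (rotPair s p).1 (rotPair s p).2) := by
  have hfd : Continuous (fderiv ℝ f) := hf.continuous_fderiv one_ne_zero
  have hγ : ∀ s : ℝ, HasDerivAt (fun s => (rotPair s p).1) ((π / 2) • (rotPair s p).2) s := by
    intro s
    have h0 : HasDerivAt (fun s : ℝ => π / 2 * s) (π / 2) s := by
      simpa using (hasDerivAt_id s).const_mul (π / 2)
    refine ((h0.cos.smul_const p.1).add (h0.sin.smul_const p.2)).congr_deriv ?_
    simp only [rotPair]
    module
  have hd : ∀ s : ℝ, HasDerivAt (fun s => f (rotPair s p).1)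
      ((π / 2) * fderiv ℝ f (rotPair s p).1 (rotPair s p).2) s := by
    intro s
    have h1 : HasFDerivAt f (fderiv ℝ f (rotPair s p).1) (rotPair s p).1 :=
      ((hf.differentiable one_ne_zero) _).hasFDerivAt
    have h2 := h1.comp_hasDerivAt s (hγ s)
    rw [map_smul, smul_eq_mul] at h2
    exact h2
  have hrc := continuous_rotPair_left p
  have hgc : Continuous fun s => (π / 2) * fderiv ℝ f (rotPair s p).1 (rotPair s p).2 :=
    ((hfd.comp (continuous_fst.comp hrc)).clm_apply (continuous_snd.comp hrc)).const_mul _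
  have hI : ∫ s in Set.Icc (0 : ℝ) 1, (π / 2) * fderiv ℝ f (rotPair s p).1 (rotPair s p).2 =
      f p.2 - f p.1 := by
    rw [integral_Icc_eq_integral_Ioc, ← intervalIntegral.integral_of_le zero_le_one,
      intervalIntegral.integral_eq_sub_of_hasDerivAt (fun s _ => hd s)
        (hgc.intervalIntegrable _ _)]
    simp [rotPair]
  have : IsProbabilityMeasure (volume.restrict (Set.Icc (0 : ℝ) 1)) := ⟨by simp⟩
  rw [← hI]
  exact convexOn_exp.map_integral_le continuous_exp.continuousOn isClosed_univ
    (ae_of_all _ fun _ => Set.mem_univ _) (hgc.integrableOn_Icc)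
    ((continuous_exp.comp hgc).integrableOn_Icc)

lemma lintegral_rotPair {Φ : E × E → ℝ} (hΦ : Continuous Φ) (s : ℝ) :
    ∫⁻ p, ENNReal.ofReal (Φ (rotPair s p)) ∂(stdGaussian E).prod (stdGaussian E) =
      ∫⁻ p, ENNReal.ofReal (Φ p) ∂(stdGaussian E).prod (stdGaussian E) := by
  have hr : ((stdGaussian E).prod (stdGaussian E)).map
      (ContinuousLinearMap.rotation (π / 2 * s)) = (stdGaussian E).prod (stdGaussian E) :=
    IsGaussian.map_rotation_eq_self_of_forall_strongDual_eq_zero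
      integral_strongDual_stdGaussian _
  conv_rhs => rw [← hr]
  rw [lintegral_map hΦ.measurable.ennreal_ofReal
    (ContinuousLinearMap.rotation (π / 2 * s)).continuous.measurable]
  rfl

/-- The exponential Maurey–Pisier inequality for smooth functions. -/
lemma lintegral_exp_sub_le {f : E → ℝ} (hf : ContDiff ℝ 1 f) (hf1 : ∀ x, ‖fderiv ℝ f x‖ ≤ 1) :
    ∫⁻ p, ENNReal.ofReal (exp (f p.2 - f p.1)) ∂(stdGaussian E).prod (stdGaussian E) ≤
      ENNReal.ofReal (exp (π ^ 2 / 8)) := by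
  have hfd : Continuous (fderiv ℝ f) := hf.continuous_fderiv one_ne_zero
  obtain ⟨Φ, hΦ⟩ : ∃ Φ : E × E → ℝ, Φ = fun p => exp ((π / 2) * fderiv ℝ f p.1 p.2) := ⟨_, rfl⟩
  have hΦc : Continuous Φ := by
    rw [hΦ]
    exact continuous_exp.comp
      (((hfd.comp continuous_fst).clm_apply continuous_snd).const_mul _)
  have hΦ0 : ∀ p, 0 ≤ Φ p := fun p => by rw [hΦ]; exact (exp_pos _).le
  have hpt : ∀ p : E × E, exp (f p.2 - f p.1) ≤ ∫ s in Set.Icc (0 : ℝ) 1, Φ (rotPair s p) := by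
    rw [hΦ]; exact exp_sub_le_integral_rotPair hf
  have hmeas : Measurable fun q : (E × E) × ℝ => ENNReal.ofReal (Φ (rotPair q.2 q.1)) :=
    ((hΦc.comp (continuous_rotPair.comp continuous_swap)).measurable).ennreal_ofReal
  have hbd : ∫⁻ p, ENNReal.ofReal (Φ p) ∂(stdGaussian E).prod (stdGaussian E) ≤
      ENNReal.ofReal (exp (π ^ 2 / 8)) := by
    rw [lintegral_prod _ hΦc.measurable.ennreal_ofReal.aemeasurable]
    refine (lintegral_mono (g := fun _ => ENNReal.ofReal (exp (π ^ 2 / 8))) fun x => ?_).trans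
      (by simp)
    have h2 := lintegral_exp_dual_stdGaussian ((π / 2) • fderiv ℝ f x)
    simp only [FunLike.coe_smul, Pi.smul_apply, smul_eq_mul] at h2
    simp only [hΦ]
    rw [h2]
    refine ENNReal.ofReal_le_ofReal (exp_le_exp.2 ?_)
    rw [norm_smul, Real.norm_of_nonneg (by positivity)]
    have h3 := hf1 x
    have h4 := norm_nonneg (fderiv ℝ f x)
    have h5 : ‖fderiv ℝ f x‖ ^ 2 ≤ 1 := by nlinarith
    nlinarith [sq_nonneg π]
  calc ∫⁻ p, ENNReal.ofReal (exp (f p.2 - f p.1)) ∂(stdGaussian E).prod (stdGaussian E)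
      ≤ ∫⁻ p, (∫⁻ s in Set.Icc (0 : ℝ) 1, ENNReal.ofReal (Φ (rotPair s p)))
          ∂(stdGaussian E).prod (stdGaussian E) := by
        refine lintegral_mono fun p => ?_
        refine (ENNReal.ofReal_le_ofReal (hpt p)).trans (le_of_eq ?_)
        refine ofReal_integral_eq_lintegral_ofReal ?_ (ae_of_all _ fun s => hΦ0 _)
        exact (hΦc.comp (continuous_rotPair_left p)).integrableOn_Icc
    _ = ∫⁻ s in Set.Icc (0 : ℝ) 1, ∫⁻ p, ENNReal.ofReal (Φ (rotPair s p))
          ∂(stdGaussian E).prod (stdGaussian E) :=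
        lintegral_lintegral_swap hmeas.aemeasurable
    _ ≤ ∫⁻ s in Set.Icc (0 : ℝ) 1, ENNReal.ofReal (exp (π ^ 2 / 8)) := by
        refine lintegral_mono fun s => ?_
        rw [lintegral_rotPair hΦc s]
        exact hbd
    _ = _ := by simp

/-- A Lipschitz function is a uniform limit of smooth functions with the same Lipschitz
constant. -/
lemma exists_contDiff_of_lipschitz {f : E → ℝ} (hf : LipschitzWith 1 f) {ε : ℝ} (hε : 0 < ε) :
    ∃ g : E → ℝ, ContDiff ℝ 1 g ∧ (∀ x, ‖fderiv ℝ g x‖ ≤ 1) ∧ ∀ x, |g x - f x| ≤ ε := by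
  set φ : ContDiffBump (0 : E) := ⟨ε / 2, ε, half_pos hε, half_lt_self hε⟩ with hφ
  have hloc := hf.continuous.locallyIntegrable (μ := (volume : Measure E))
  set g : E → ℝ := convolution (φ.normed volume) f (ContinuousLinearMap.lsmul ℝ ℝ) volume with hg
  have hgc : ContDiff ℝ 1 g :=
    φ.hasCompactSupport_normed.contDiff_convolution_left (n := 1) _ φ.contDiff_normed hloc
  have hval : ∀ x, g x = ∫ t, φ.normed volume t * f (x - t) := fun x => rfl
  have h_int : ∀ x, Integrable (fun t => φ.normed volume t * f (x - t)) := fun x =>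
    (φ.continuous_normed.mul (hf.continuous.comp (by fun_prop))).integrable_of_hasCompactSupport
      φ.hasCompactSupport_normed.mul_right
  have hlip : LipschitzWith 1 g := by
    refine LipschitzWith.of_dist_le_mul fun x y => ?_
    rw [Real.dist_eq, hval, hval, ← integral_sub (h_int x) (h_int y)]
    have key : ‖∫ t, (φ.normed volume t * f (x - t) - φ.normed volume t * f (y - t))‖ ≤
        ∫ t, φ.normed volume t * dist x y := by
      refine norm_integral_le_of_norm_le ((φ.integrable_normed).mul_const _)
        (ae_of_all _ fun t => ?_)
      rw [← mul_sub, norm_mul, Real.norm_of_nonneg (φ.nonneg_normed t)]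
      refine mul_le_mul_of_nonneg_left ?_ (φ.nonneg_normed t)
      have := hf.dist_le_mul (x - t) (y - t)
      simpa [Real.dist_eq, dist_sub_right] using this
    refine key.trans (le_of_eq ?_)
    rw [integral_mul_const, φ.integral_normed]; simp
  refine ⟨g, hgc, fun x => by simpa using norm_fderiv_le_of_lipschitz ℝ (x₀ := x) hlip, fun x => ?_⟩
  rw [← Real.dist_eq]
  refine φ.dist_normed_convolution_le hloc.aestronglyMeasurable fun y hy => ?_
  have := hf.dist_le_mul y x
  simp only [NNReal.coe_one, one_mul] at this
  exact this.trans (Metric.mem_ball.1 hy).le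

/-- A weak form of Gaussian isoperimetry. -/
lemma stdGaussian_infDist_le (A : Set E) (hA : MeasurableSet A) (r : ℝ) :
    (stdGaussian E).real A * (stdGaussian E).real {x | r ≤ Metric.infDist x A} ≤
      exp (π ^ 2 / 8 + 2) * exp (-r) := by
  obtain ⟨g, hg1, hg2, hg3⟩ :=
    exists_contDiff_of_lipschitz (Metric.lipschitz_infDist_pt A) one_pos
  set B : Set E := {x | r ≤ Metric.infDist x A} with hB
  have hBm : MeasurableSet B :=
    measurableSet_le measurable_const (Metric.continuous_infDist_pt A).measurable
  have h1 := lintegral_exp_sub_le hg1 hg2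
  set μ := stdGaussian E
  have h2 : ENNReal.ofReal (exp (r - 2)) * (μ A * μ B) ≤ ENNReal.ofReal (exp (π ^ 2 / 8)) := by
    refine le_trans ?_ h1
    rw [← Measure.prod_prod, ← lintegral_indicator_const (hA.prod hBm)]
    refine lintegral_mono fun p => ?_
    by_cases hp : p ∈ A ×ˢ B
    · rw [Set.indicator_of_mem hp]
      refine ENNReal.ofReal_le_ofReal (exp_le_exp.2 ?_)
      have e1 := (abs_le.1 (hg3 p.1)).2
      have e2 := (abs_le.1 (hg3 p.2)).1
      have e3 : Metric.infDist p.1 A = 0 := Metric.infDist_zero_of_mem hp.1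
      have e4 : r ≤ Metric.infDist p.2 A := hp.2
      linarith
    · rw [Set.indicator_of_notMem hp]; exact zero_le
  have h3 := ENNReal.toReal_mono ENNReal.ofReal_ne_top h2
  rw [ENNReal.toReal_mul, ENNReal.toReal_mul, ENNReal.toReal_ofReal (exp_pos _).le,
    ENNReal.toReal_ofReal (exp_pos _).le] at h3
  have h4 : exp (π ^ 2 / 8 + 2) * exp (-r) = exp (π ^ 2 / 8) * exp (-(r - 2)) := by
    rw [← exp_add, ← exp_add]; congr 1; ring
  rw [h4]
  have h5 : exp (r - 2) * exp (-(r - 2)) = 1 := by rw [← exp_add]; simp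
  calc μ.real A * μ.real B = (exp (r - 2) * ((μ A).toReal * (μ B).toReal)) * exp (-(r - 2)) := by
        rw [mul_comm (exp (r - 2)), mul_assoc, h5, mul_one]; rfl
    _ ≤ _ := mul_le_mul_of_nonneg_right h3 (exp_pos _).le

end Concentration

section PartitionFunction

lemma integral_exp_sq_gaussianReal {l : ℝ} (hl : l < 1) :
    Integrable (fun g : ℝ => exp (l / 2 * g ^ 2)) (gaussianReal 0 1) ∧
      ∫ g, exp (l / 2 * g ^ 2) ∂gaussianReal 0 1 = (√(1 - l))⁻¹ := by
  have hb : 0 < (1 - l) / 2 := by linarith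
  have e : ∀ g : ℝ, gaussianPDFReal 0 1 g • exp (l / 2 * g ^ 2) =
      (√(2 * π))⁻¹ * exp (-((1 - l) / 2) * g ^ 2) := by
    intro g
    simp only [gaussianPDFReal, NNReal.coe_one, mul_one, sub_zero, smul_eq_mul]
    rw [mul_assoc, ← exp_add]
    congr 2
    ring
  constructor
  · rw [gaussianReal_of_var_ne_zero 0 one_ne_zero, gaussianPDF_def,
      integrable_withDensity_iff_integrable_smul₀' (by fun_prop) (by simp)]
    refine ((integrable_exp_neg_mul_sq hb).const_mul (√(2 * π))⁻¹).congr (ae_of_all _ fun g => ?_)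
    simp only [← e, ENNReal.toReal_ofReal (gaussianPDFReal_nonneg _ _ _)]
  · rw [integral_gaussianReal_eq_integral_smul one_ne_zero]
    simp only [e]
    rw [integral_const_mul, integral_gaussian, ← sqrt_inv, ← sqrt_inv, ← sqrt_mul (by positivity)]
    congr 1
    have := pi_pos
    field_simp

lemma integral_exp_mul_gaussianReal (a : ℝ) :
    Integrable (fun g : ℝ => exp (a * g)) (gaussianReal 0 1) ∧
      ∫ g, exp (a * g) ∂gaussianReal 0 1 = exp (a ^ 2 / 2) := by
  refine ⟨integrable_exp_mul_gaussianReal a, ?_⟩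
  have h4 := congrFun (mgf_fun_id_gaussianReal (μ := 0) (v := 1)) a
  simpa [mgf] using h4

lemma integral_exp_sum_gaussVec {κ : Type*} [Fintype κ] (c : κ → ℝ) :
    Integrable (fun ω : κ → ℝ => exp (∑ k, c k * ω k)) (gaussVec κ) ∧
      ∫ ω, exp (∑ k, c k * ω k) ∂gaussVec κ = exp ((∑ k, c k ^ 2) / 2) := by
  simp only [exp_sum]
  refine ⟨Integrable.fintype_prod (f := fun k x => exp (c k * x))
    fun k => (integral_exp_mul_gaussianReal (c k)).1, ?_⟩
  rw [gaussVec, integral_fintype_prod_eq_prod (fun k x => exp (c k * x))]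
  rw [Finset.prod_congr rfl fun k _ => (integral_exp_mul_gaussianReal (c k)).2, ← exp_sum,
    Finset.sum_div]

variable {N : ℕ}

lemma sum_exp_scOv_le (hN : 1 ≤ N) (a : ℝ) :
    ∑ x : Config N, ∑ y : Config N, exp (a * scOv N x y) ≤ 4 ^ N * exp (a ^ 2 / 2) := by
  have hN0 : (0 : ℝ) < N := by exact_mod_cast hN
  have hs : 0 < √(N : ℝ) := sqrt_pos.2 hN0
  have hsq : √(N : ℝ) ^ 2 = N := Real.sq_sqrt hN0.le
  have h1 : ∀ x : Config N, ∑ y : Config N, exp (a * scOv N x y) ≤ 2 ^ N * exp (a ^ 2 / 2) := by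
    intro x
    have e1 : ∀ y : Config N, exp (a * scOv N x y) =
        ∏ i, exp (a / √N * (spin (x i) * spin (y i))) := by
      intro y
      rw [← exp_sum, ← Finset.mul_sum, scOv, ovlp]
      congr 1
      field_simp
      rw [hsq]
      ring
    simp only [e1]
    have e2 : ∑ y : Config N, ∏ i, exp (a / √N * (spin (x i) * spin (y i))) =
        ∏ i : Fin N, ∑ c : Bool, exp (a / √N * (spin (x i) * spin c)) := by
      rw [Finset.prod_univ_sum, Fintype.piFinset_univ]
    rw [e2]
    have e3 : ∀ i : Fin N, ∑ c : Bool, exp (a / √N * (spin (x i) * spin c)) ≤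
        2 * exp ((a / √N) ^ 2 / 2) := by
      intro i
      have := cosh_le_exp_half_sq (a / √N)
      rw [cosh_eq] at this
      cases x i <;> simp [spin] <;> linarith
    calc ∏ i : Fin N, ∑ c : Bool, exp (a / √N * (spin (x i) * spin c))
        ≤ ∏ _i : Fin N, 2 * exp ((a / √N) ^ 2 / 2) :=
          Finset.prod_le_prod (fun i _ => Finset.sum_nonneg fun c _ => (exp_pos _).le)
            fun i _ => e3 i
      _ = _ := by
          rw [Finset.prod_const, mul_pow, ← exp_nat_mul, Finset.card_univ, Fintype.card_fin,
            div_pow, hsq]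
          congr 2
          field_simp
  calc _ ≤ ∑ _x : Config N, (2 : ℝ) ^ N * exp (a ^ 2 / 2) := Finset.sum_le_sum fun x _ => h1 x
    _ = _ := by
        rw [Finset.sum_const, nsmul_eq_mul, ← mul_assoc]
        simp only [Finset.card_univ, Fintype.card_fun, Fintype.card_bool, Fintype.card_fin]
        push_cast
        rw [← mul_pow]
        norm_num

/-- The exponential moment of the squared overlap under the uniform measure. -/
lemma sum_exp_sq_scOv_le (hN : 1 ≤ N) {l : ℝ} (hl0 : 0 ≤ l) (hl : l < 1) :
    ∑ x : Config N, ∑ y : Config N, exp (l / 2 * scOv N x y ^ 2) ≤ 4 ^ N * (√(1 - l))⁻¹ := by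
  have h1 : ∀ x y : Config N, exp (l / 2 * scOv N x y ^ 2) =
      ∫ g, exp (√l * scOv N x y * g) ∂gaussianReal 0 1 := by
    intro x y
    rw [(integral_exp_mul_gaussianReal _).2, mul_pow, Real.sq_sqrt hl0]
    congr 1; ring
  have hi : ∀ x y : Config N, Integrable (fun g => exp (√l * scOv N x y * g)) (gaussianReal 0 1) :=
    fun x y => (integral_exp_mul_gaussianReal _).1
  simp only [h1]
  have h2 : ∑ x : Config N, ∑ y : Config N, ∫ g, exp (√l * scOv N x y * g) ∂gaussianReal 0 1 =
      ∫ g, ∑ x : Config N, ∑ y : Config N, exp (√l * scOv N x y * g) ∂gaussianReal 0 1 := by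
    rw [integral_finsetSum _ fun x _ => integrable_finsetSum _ fun y _ => hi x y]
    exact Finset.sum_congr rfl fun x _ => (integral_finsetSum _ fun y _ => hi x y).symm
  rw [h2, ← (integral_exp_sq_gaussianReal hl).2, ← integral_const_mul]
  refine integral_mono (integrable_finsetSum _ fun x _ => integrable_finsetSum _ fun y _ => hi x y)
    ((integral_exp_sq_gaussianReal hl).1.const_mul _) fun g => ?_
  have h3 := sum_exp_scOv_le hN (√l * g)
  rw [mul_pow, Real.sq_sqrt hl0] at h3
  refine le_trans (le_of_eq ?_) (h3.trans (le_of_eq ?_))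
  · refine Finset.sum_congr rfl fun x _ => Finset.sum_congr rfl fun y _ => ?_
    congr 1; ring
  · congr 2; ring

end PartitionFunction

section Tail

variable {κ : Type*} [Fintype κ] [DecidableEq κ] {N : ℕ} {β : ℝ} {b : κ → Config N → ℝ}
  {T : Fin N → Finset κ}

/-- The partition function of a Gaussian field. -/
def partZ (b : κ → Config N → ℝ) (ω : κ → ℝ) : ℝ := ∑ x, exp (linH b ω x)

/-- The mean of the partition function. -/
def meanZ (N : ℕ) (β : ℝ) : ℝ := 2 ^ N * exp (β ^ 2 * (N - 1) / 4)

lemma meanZ_pos (N : ℕ) (β : ℝ) : 0 < meanZ N β := by unfold meanZ; positivity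

lemma partZ_pos (b : κ → Config N → ℝ) (ω : κ → ℝ) : 0 < partZ b ω := sum_exp_pos _

lemma continuous_partZ (b : κ → Config N → ℝ) : Continuous (partZ b) := by
  unfold partZ linH; fun_prop

lemma SKSystem.sum_sq (h : SKSystem N β b T) (hN : 1 ≤ N) (x : Config N) :
    ∑ k, b k x ^ 2 = β ^ 2 * (N - 1) / 2 := by
  have := h.cov x x
  rw [ovlp_self hN] at this
  simp only [sq (b _ x)]
  rw [this]; ring

lemma sq_scOv (x y : Config N) : scOv N x y ^ 2 = N * ovlp N x y ^ 2 := by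
  rw [scOv, mul_pow, Real.sq_sqrt (Nat.cast_nonneg N)]

lemma SKSystem.integral_partZ (h : SKSystem N β b T) (hN : 1 ≤ N) :
    Integrable (partZ b) (gaussVec κ) ∧ ∫ ω, partZ b ω ∂gaussVec κ = meanZ N β := by
  have hx : ∀ x, Integrable (fun ω => exp (linH b ω x)) (gaussVec κ) ∧
      ∫ ω, exp (linH b ω x) ∂gaussVec κ = exp (β ^ 2 * (N - 1) / 4) := by
    intro x
    have := integral_exp_sum_gaussVec (fun k => b k x)
    rw [h.sum_sq hN] at this
    refine ⟨this.1, this.2.trans ?_⟩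
    congr 1; ring
  refine ⟨integrable_finsetSum _ fun x _ => (hx x).1, ?_⟩
  unfold partZ
  rw [integral_finsetSum _ fun x _ => (hx x).1, Finset.sum_congr rfl fun x _ => (hx x).2]
  simp [meanZ]

lemma SKSystem.integral_partZ_sq_mul_gav (h : SKSystem N β b T) (hN : 1 ≤ N)
    (f : (Fin 2 → Config N) → ℝ) :
    Integrable (fun ω => partZ b ω ^ 2 * gav (linH b ω) f) (gaussVec κ) ∧
      ∫ ω, partZ b ω ^ 2 * gav (linH b ω) f ∂gaussVec κ =
        ∑ x, ∑ y, f ![x, y] * exp (β ^ 2 * (N - 1) / 2 + β ^ 2 / 2 * (scOv N x y ^ 2 - 1)) := by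
  have e : ∀ ω, partZ b ω ^ 2 * gav (linH b ω) f =
      ∑ x, ∑ y, f ![x, y] * exp (∑ k, (b k x + b k y) * ω k) := by
    intro ω
    rw [gav_two, Finset.mul_sum]
    refine Finset.sum_congr rfl fun x _ => ?_
    rw [Finset.mul_sum]
    refine Finset.sum_congr rfl fun y _ => ?_
    simp only [add_mul, Finset.sum_add_distrib, exp_add]
    have hz := (partZ_pos b ω).ne'
    simp only [gibbsProb]
    rw [show ∑ y, exp (linH b ω y) = partZ b ω from rfl]
    field_simp
    rfl
  have hxy : ∀ x y, Integrable (fun ω : κ → ℝ => exp (∑ k, (b k x + b k y) * ω k)) (gaussVec κ) ∧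
      ∫ ω, exp (∑ k, (b k x + b k y) * ω k) ∂gaussVec κ =
        exp (β ^ 2 * (N - 1) / 2 + β ^ 2 / 2 * (scOv N x y ^ 2 - 1)) := by
    intro x y
    have := integral_exp_sum_gaussVec (fun k => b k x + b k y)
    refine ⟨this.1, this.2.trans ?_⟩
    congr 1
    have e1 : ∑ k, (b k x + b k y) ^ 2 = ∑ k, b k x ^ 2 + ∑ k, b k y ^ 2 +
        2 * ∑ k, b k x * b k y := by
      rw [Finset.mul_sum, ← Finset.sum_add_distrib, ← Finset.sum_add_distrib]
      exact Finset.sum_congr rfl fun k _ => by ring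
    rw [e1, h.sum_sq hN, h.sum_sq hN, h.cov, sq_scOv]
    ring
  simp only [e]
  have hi : ∀ x y, Integrable (fun ω : κ → ℝ => f ![x, y] * exp (∑ k, (b k x + b k y) * ω k))
      (gaussVec κ) := fun x y => (hxy x y).1.const_mul _
  refine ⟨integrable_finsetSum _ fun x _ => integrable_finsetSum _ fun y _ => hi x y, ?_⟩
  rw [integral_finsetSum _ fun x _ => integrable_finsetSum _ fun y _ => hi x y]
  refine Finset.sum_congr rfl fun x _ => ?_
  rw [integral_finsetSum _ fun y _ => hi x y]
  refine Finset.sum_congr rfl fun y _ => ?_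
  rw [integral_const_mul, (hxy x y).2]

lemma SKSystem.integral_partZ_sq_mul_gav_le (h : SKSystem N β b T) (hN : 1 ≤ N)
    (f : (Fin 2 → Config N) → ℝ) (hf : ∀ ρ, 0 ≤ f ρ) {l c : ℝ} (hl0 : 0 ≤ l) (hl : l < 1)
    (hc : 0 ≤ c)
    (hfc : ∀ x y, f ![x, y] * exp (β ^ 2 / 2 * scOv N x y ^ 2) ≤ c * exp (l / 2 * scOv N x y ^ 2)) :
    ∫ ω, partZ b ω ^ 2 * gav (linH b ω) f ∂gaussVec κ ≤ meanZ N β ^ 2 * (c * (√(1 - l))⁻¹) := by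
  rw [(h.integral_partZ_sq_mul_gav hN f).2]
  have h1 : ∀ x y : Config N,
      f ![x, y] * exp (β ^ 2 * (N - 1) / 2 + β ^ 2 / 2 * (scOv N x y ^ 2 - 1)) ≤
      exp (β ^ 2 * (N - 1) / 2) * (c * exp (l / 2 * scOv N x y ^ 2)) := by
    intro x y
    refine le_trans ?_ (mul_le_mul_of_nonneg_left (hfc x y) (exp_pos _).le)
    rw [mul_left_comm, ← exp_add]
    refine mul_le_mul_of_nonneg_left (exp_le_exp.2 ?_) (hf _)
    nlinarith [sq_nonneg β]
  have h2 : meanZ N β ^ 2 = 4 ^ N * exp (β ^ 2 * (N - 1) / 2) := by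
    rw [meanZ, mul_pow, ← pow_mul, mul_comm N 2, pow_mul, ← exp_nat_mul]
    norm_num
    ring
  calc _ ≤ ∑ x : Config N, ∑ y : Config N,
        exp (β ^ 2 * (N - 1) / 2) * (c * exp (l / 2 * scOv N x y ^ 2)) :=
        Finset.sum_le_sum fun x _ => Finset.sum_le_sum fun y _ => h1 x y
    _ = exp (β ^ 2 * (N - 1) / 2) * (c * ∑ x : Config N, ∑ y : Config N,
        exp (l / 2 * scOv N x y ^ 2)) := by simp only [Finset.mul_sum]
    _ ≤ exp (β ^ 2 * (N - 1) / 2) * (c * (4 ^ N * (√(1 - l))⁻¹)) := by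
        gcongr
        exact sum_exp_sq_scOv_le hN hl0 hl
    _ = _ := by rw [h2]; ring

/-- A lower bound for the partition function by convexity of the free energy. -/
lemma SKSystem.partZ_mul_exp_le (h : SKSystem N β b T) (hβ : β ^ 2 ≤ 1) (ω a : κ → ℝ) {K : ℝ}
    (hK : 0 ≤ K)
    (ha : gav (linH b a) (fun ρ : Fin 2 → Config N => scOv N (ρ 0) (ρ 1) ^ 2) ≤ K ^ 2) :
    partZ b a * exp (-(K * √(∑ k, (ω k - a k) ^ 2))) ≤ partZ b ω := by
  set p := gibbsProb (linH b a) with hp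
  have hp1 : ∑ x, p x = 1 := sum_gibbsProb _
  have hp0 : ∀ x, 0 ≤ p x := fun x => (gibbsProb_pos _ x).le
  have hz := partZ_pos b a
  have e1 : partZ b ω = partZ b a * ∑ x, p x * exp (linH b ω x - linH b a x) := by
    rw [Finset.mul_sum, partZ]
    refine Finset.sum_congr rfl fun x _ => ?_
    rw [exp_sub, hp, gibbsProb, show ∑ y, exp (linH b a y) = partZ b a from rfl]
    have := (exp_pos (linH b a x)).ne'
    field_simp
  rw [e1]
  refine mul_le_mul_of_nonneg_left ?_ hz.le
  have e2 : exp (∑ x, p x * (linH b ω x - linH b a x)) ≤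
      ∑ x, p x * exp (linH b ω x - linH b a x) := by
    have := convexOn_exp.map_sum_le (t := univ) (w := p)
      (p := fun x => linH b ω x - linH b a x) (fun x _ => hp0 x) hp1 (fun x _ => Set.mem_univ _)
    simpa [smul_eq_mul] using this
  refine le_trans (exp_le_exp.2 ?_) e2
  set m : κ → ℝ := fun k => ∑ x, p x * b k x with hm
  have e3 : ∑ x, p x * (linH b ω x - linH b a x) = ∑ k, m k * (ω k - a k) := by
    simp only [hm, linH, ← Finset.sum_sub_distrib, ← mul_sub, Finset.mul_sum, Finset.sum_mul]
    rw [Finset.sum_comm]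
    exact Finset.sum_congr rfl fun k _ => Finset.sum_congr rfl fun x _ => by ring
  have e4 : ∑ k, m k ^ 2 ≤ K ^ 2 := by
    have e5 : ∑ k, m k ^ 2 = ∑ x, ∑ y, (∑ k, b k x * b k y) * (p x * p y) := by
      simp only [hm, sq]
      simp only [Finset.sum_mul_sum]
      rw [Finset.sum_comm]
      refine Finset.sum_congr rfl fun x _ => ?_
      rw [Finset.sum_comm]
      refine Finset.sum_congr rfl fun y _ => ?_
      rw [Finset.sum_mul]
      exact Finset.sum_congr rfl fun k _ => by ring
    rw [e5]
    refine le_trans ?_ ha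
    rw [gav_two]
    refine Finset.sum_le_sum fun x _ => Finset.sum_le_sum fun y _ => ?_
    refine mul_le_mul_of_nonneg_right ?_ (mul_nonneg (hp0 x) (hp0 y))
    simp only [Matrix.cons_val_zero, Matrix.cons_val_one]
    rw [h.cov, ← sq_scOv]
    nlinarith [sq_nonneg β, sq_nonneg (scOv N x y)]
  rw [e3]
  have e6 := Finset.sum_mul_sq_le_sq_mul_sq univ m (fun k => ω k - a k)
  have e7 : |∑ k, m k * (ω k - a k)| ≤ K * √(∑ k, (ω k - a k) ^ 2) := by
    refine abs_le_of_sq_le_sq ?_ (by positivity)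
    rw [mul_pow, Real.sq_sqrt (Finset.sum_nonneg fun k _ => sq_nonneg _)]
    exact e6.trans (mul_le_mul_of_nonneg_right e4 (Finset.sum_nonneg fun k _ => sq_nonneg _))
  exact (abs_le.1 e7).1

/-- Separated sets cannot both have large Gaussian measure. -/
lemma gaussVec_separated_le {A C : Set (κ → ℝ)} (hA : MeasurableSet A) {r : ℝ}
    (hAC : ∀ a ∈ A, ∀ ω ∈ C, r ≤ √(∑ k, (ω k - a k) ^ 2)) (hne : A.Nonempty) :
    (gaussVec κ).real A * (gaussVec κ).real C ≤ exp (π ^ 2 / 8 + 2) * exp (-r) := by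
  set A' : Set (EuclideanSpace ℝ κ) := WithLp.ofLp ⁻¹' A with hA'
  have hmeas : Measurable (WithLp.toLp 2 : (κ → ℝ) → EuclideanSpace ℝ κ) := by fun_prop
  have hA'm : MeasurableSet A' := hA.preimage (by fun_prop)
  have h1 := stdGaussian_infDist_le A' hA'm r
  have hBm : MeasurableSet {x : EuclideanSpace ℝ κ | r ≤ Metric.infDist x A'} :=
    measurableSet_le measurable_const (Metric.continuous_infDist_pt A').measurable
  rw [← map_pi_eq_stdGaussian, map_measureReal_apply hmeas hA'm,
    map_measureReal_apply hmeas hBm] at h1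
  refine le_trans ?_ h1
  refine mul_le_mul le_rfl (measureReal_mono ?_) measureReal_nonneg measureReal_nonneg
  intro ω hω
  obtain ⟨a, ha⟩ := hne
  refine (Metric.le_infDist ⟨WithLp.toLp 2 a, ha⟩).2 fun y hy => ?_
  rw [EuclideanSpace.dist_eq]
  refine (hAC _ hy ω hω).trans (le_of_eq ?_)
  simp [Real.dist_eq, sq_abs]

end Tail

section TailBound

variable {κ : Type*} [Fintype κ] [DecidableEq κ] {N : ℕ} {β : ℝ} {b : κ → Config N → ℝ}
  {T : Fin N → Finset κ}

/-- The squared rescaled overlap of two replicas. -/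
def sqOv (N : ℕ) (ρ : Fin 2 → Config N) : ℝ := scOv N (ρ 0) (ρ 1) ^ 2

/-- The indicator that the squared rescaled overlap is at least `u`. -/
def bigOv (N : ℕ) (u : ℝ) (ρ : Fin 2 → Config N) : ℝ := if u ≤ sqOv N ρ then 1 else 0

lemma sqOv_nonneg (ρ : Fin 2 → Config N) : 0 ≤ sqOv N ρ := sq_nonneg _

lemma bigOv_nonneg (u : ℝ) (ρ : Fin 2 → Config N) : 0 ≤ bigOv N u ρ := by
  unfold bigOv; split_ifs <;> norm_num

lemma bigOv_le_one (u : ℝ) (ρ : Fin 2 → Config N) : bigOv N u ρ ≤ 1 := by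
  unfold bigOv; split_ifs <;> norm_num

lemma inv_sqrt_half_le {s : ℝ} (hs : 0 < s) : (√(1 - (1 - s ^ 4 / 2)))⁻¹ ≤ 3 / 2 / s ^ 2 := by
  have h1 : 2 / 3 * s ^ 2 ≤ √(1 - (1 - s ^ 4 / 2)) := by
    apply Real.le_sqrt_of_sq_le
    nlinarith [pow_pos hs 4]
  calc (√(1 - (1 - s ^ 4 / 2)))⁻¹ ≤ (2 / 3 * s ^ 2)⁻¹ := inv_anti₀ (by positivity) h1
    _ = _ := by field_simp

lemma SKSystem.integral_partZ_sq_mul_sqOv_le (h : SKSystem N β b T) (hN : 1 ≤ N) {s : ℝ}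
    (hs : 0 < s) (hs1 : s ≤ 1) (hβ : β ^ 2 = 1 - s ^ 4) :
    ∫ ω, partZ b ω ^ 2 * gav (linH b ω) (sqOv N) ∂gaussVec κ ≤ meanZ N β ^ 2 * (6 / s ^ 6) := by
  have h4 : s ^ 4 ≤ 1 := pow_le_one₀ hs.le hs1
  have := h.integral_partZ_sq_mul_gav_le hN (sqOv N) sqOv_nonneg (l := 1 - s ^ 4 / 2)
    (c := 4 / s ^ 4) (by linarith) (by have := pow_pos hs 4; linarith) (by positivity) ?_
  · refine this.trans ?_
    gcongr
    calc 4 / s ^ 4 * (√(1 - (1 - s ^ 4 / 2)))⁻¹ ≤ 4 / s ^ 4 * (3 / 2 / s ^ 2) := by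
          gcongr; exact inv_sqrt_half_le hs
      _ = _ := by field_simp; norm_num
  · intro x y
    simp only [sqOv, Matrix.cons_val_zero, Matrix.cons_val_one]
    set u := scOv N x y ^ 2
    have e : (1 - s ^ 4 / 2) / 2 * u = s ^ 4 / 4 * u + β ^ 2 / 2 * u := by rw [hβ]; ring
    rw [e, exp_add, ← mul_assoc]
    refine mul_le_mul_of_nonneg_right ?_ (exp_pos _).le
    have := add_one_le_exp (s ^ 4 / 4 * u)
    calc u = 4 / s ^ 4 * (s ^ 4 / 4 * u) := by field_simp
      _ ≤ _ := by gcongr; linarith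

lemma SKSystem.integral_partZ_sq_le (h : SKSystem N β b T) (hN : 1 ≤ N) {s : ℝ}
    (hs : 0 < s) (hs1 : s ≤ 1) (hβ : β ^ 2 = 1 - s ^ 4) :
    Integrable (fun ω => partZ b ω ^ 2) (gaussVec κ) ∧
    ∫ ω, partZ b ω ^ 2 ∂gaussVec κ ≤ meanZ N β ^ 2 * (1 / s ^ 2) := by
  have h4 : s ^ 4 ≤ 1 := pow_le_one₀ hs.le hs1
  have e : ∀ ω, partZ b ω ^ 2 * gav (linH b ω) (fun _ : Fin 2 → Config N => 1) =
      partZ b ω ^ 2 := fun ω => by rw [gav_const, mul_one]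
  have h1 := (h.integral_partZ_sq_mul_gav hN (fun _ => 1)).1
  have h2 := h.integral_partZ_sq_mul_gav_le hN (fun _ => 1) (fun _ => zero_le_one) (l := β ^ 2)
    (c := 1) (sq_nonneg _) (by have := pow_pos hs 4; linarith) zero_le_one (fun x y => by simp)
  simp only [e] at h1 h2
  refine ⟨h1, h2.trans (le_of_eq ?_)⟩
  rw [hβ, show 1 - (1 - s ^ 4) = (s ^ 2) ^ 2 by ring, Real.sqrt_sq (by positivity)]
  ring

lemma SKSystem.integral_partZ_sq_mul_bigOv_le (h : SKSystem N β b T) (hN : 1 ≤ N) {s : ℝ}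
    (hs : 0 < s) (hs1 : s ≤ 1) (hβ : β ^ 2 = 1 - s ^ 4) (u : ℝ) :
    ∫ ω, partZ b ω ^ 2 * gav (linH b ω) (bigOv N u) ∂gaussVec κ ≤
      meanZ N β ^ 2 * (exp (-(s ^ 4 / 4 * u)) * (3 / 2 / s ^ 2)) := by
  have h4 : s ^ 4 ≤ 1 := pow_le_one₀ hs.le hs1
  have := h.integral_partZ_sq_mul_gav_le hN (bigOv N u) (bigOv_nonneg u) (l := 1 - s ^ 4 / 2)
    (c := exp (-(s ^ 4 / 4 * u))) (by linarith) (by have := pow_pos hs 4; linarith)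
    (exp_pos _).le ?_
  · refine this.trans ?_
    gcongr
    exact inv_sqrt_half_le hs
  · intro x y
    have e : sqOv N ![x, y] = scOv N x y ^ 2 := rfl
    rw [bigOv]
    split_ifs with huv
    · rw [one_mul, ← exp_add]
      refine exp_le_exp.2 ?_
      rw [e] at huv
      set v := scOv N x y ^ 2
      have : s ^ 4 / 4 * u ≤ s ^ 4 / 4 * v := by gcongr
      rw [hβ]
      linarith
    · rw [zero_mul]; positivity

/-- The event that the partition function is not small and the overlap is moderate. -/
def goodSet (N : ℕ) (β : ℝ) (b : κ → Config N → ℝ) (K : ℝ) : Set (κ → ℝ) :=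
  {ω | meanZ N β / 2 ≤ partZ b ω ∧ gav (linH b ω) (sqOv N) ≤ K ^ 2}

lemma measurableSet_goodSet (K : ℝ) : MeasurableSet (goodSet N β b K) := by
  have h1 : Measurable (fun ω => gav (linH b ω) (sqOv N)) :=
    (continuous_gav_linH b (sqOv N)).measurable
  exact (measurableSet_le measurable_const (continuous_partZ b).measurable).inter
    (measurableSet_le h1 measurable_const)

lemma SKSystem.le_measureReal_goodSet (h : SKSystem N β b T) (hN : 1 ≤ N) {s : ℝ}
    (hs : 0 < s) (hs1 : s ≤ 1) (hβ : β ^ 2 = 1 - s ^ 4) :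
    s ^ 2 / 16 ≤ (gaussVec κ).real (goodSet N β b (7 / s ^ 3)) := by
  set M := meanZ N β with hM
  have hM0 : 0 < M := meanZ_pos N β
  set A := goodSet N β b (7 / s ^ 3) with hA
  have hAm : MeasurableSet A := measurableSet_goodSet _
  set η := s ^ 2 / (4 * M) with hη
  have hη0 : 0 < η := by positivity
  have hpt : ∀ ω, partZ b ω ≤ M / 2 + 2 / (M * (7 / s ^ 3) ^ 2) *
      (partZ b ω ^ 2 * gav (linH b ω) (sqOv N)) + η / 2 * partZ b ω ^ 2 +
      1 / (2 * η) * A.indicator (fun _ => (1 : ℝ)) ω := by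
    intro ω
    have hz := partZ_pos b ω
    have hX : 0 ≤ gav (linH b ω) (sqOv N) := by
      have := gav_mono (linH b ω) (f := fun _ => (0:ℝ)) (g := sqOv N) (fun ρ => sqOv_nonneg ρ)
      rwa [gav_const] at this
    by_cases hω : ω ∈ A
    · rw [Set.indicator_of_mem hω]
      have : partZ b ω ≤ η / 2 * partZ b ω ^ 2 + 1 / (2 * η) * 1 := by
        have : 0 ≤ 1 / (2 * η) * (η * partZ b ω - 1) ^ 2 := by positivity
        have e : 1 / (2 * η) * (η * partZ b ω - 1) ^ 2 =
          η / 2 * partZ b ω ^ 2 + 1 / (2 * η) * 1 - partZ b ω := by field_simp; ring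
        linarith
      have : 0 ≤ 2 / (M * (7 / s ^ 3) ^ 2) * (partZ b ω ^ 2 * gav (linH b ω) (sqOv N)) := by
        positivity
      linarith
    · rw [Set.indicator_of_notMem hω]
      have p1 : 0 ≤ η / 2 * partZ b ω ^ 2 := by positivity
      by_cases hz2 : M / 2 ≤ partZ b ω
      · have hX2 : (7 / s ^ 3) ^ 2 < gav (linH b ω) (sqOv N) := by
          by_contra hcon
          exact hω ⟨hz2, not_lt.1 hcon⟩
        have : partZ b ω ≤ 2 / (M * (7 / s ^ 3) ^ 2) *
            (partZ b ω ^ 2 * (7 / s ^ 3) ^ 2) := by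
          have e : 2 / (M * (7 / s ^ 3) ^ 2) * (partZ b ω ^ 2 * (7 / s ^ 3) ^ 2) =
            2 / M * partZ b ω ^ 2 := by field_simp
          rw [e, div_mul_eq_mul_div, le_div_iff₀ hM0]
          nlinarith
        have : partZ b ω ≤ 2 / (M * (7 / s ^ 3) ^ 2) *
            (partZ b ω ^ 2 * gav (linH b ω) (sqOv N)) := this.trans (by gcongr)
        linarith
      · have : 0 ≤ 2 / (M * (7 / s ^ 3) ^ 2) * (partZ b ω ^ 2 * gav (linH b ω) (sqOv N)) := by
          positivity
        linarith
  have hi1 := (h.integral_partZ_sq_mul_gav hN (sqOv N)).1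
  have hi2 := (h.integral_partZ_sq_le hN hs hs1 hβ).1
  have hi3 : Integrable (A.indicator (fun _ => (1 : ℝ))) (gaussVec κ) :=
    (integrable_const _).indicator hAm
  have hj1 := (integrable_const (μ := gaussVec κ) (M / 2)).fun_add
    (hi1.const_mul (2 / (M * (7 / s ^ 3) ^ 2)))
  have hj2 := hj1.fun_add (hi2.const_mul (η / 2))
  have h_int := integral_mono (h.integral_partZ hN).1
    (hj2.fun_add (hi3.const_mul (1 / (2 * η)))) hpt
  rw [(h.integral_partZ hN).2] at h_int
  rw [integral_add hj2 (hi3.const_mul (1 / (2 * η))),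
    integral_add hj1 (hi2.const_mul (η / 2)), integral_add (integrable_const (M / 2))
    (hi1.const_mul _), integral_const_mul, integral_const_mul, integral_const_mul,
    integral_indicator hAm] at h_int
  simp only [integral_const, smul_eq_mul, mul_one, measureReal_restrict_apply_univ,
    probReal_univ, one_mul] at h_int
  have b1 := h.integral_partZ_sq_mul_sqOv_le hN hs hs1 hβ
  have b2 := (h.integral_partZ_sq_le hN hs hs1 hβ).2
  have c1 : 2 / (M * (7 / s ^ 3) ^ 2) * ∫ ω, partZ b ω ^ 2 * gav (linH b ω) (sqOv N) ∂gaussVec κ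
      ≤ 12 / 49 * M := by
    calc _ ≤ 2 / (M * (7 / s ^ 3) ^ 2) * (M ^ 2 * (6 / s ^ 6)) := by gcongr
      _ = _ := by field_simp; norm_num
  have c2 : η / 2 * ∫ ω, partZ b ω ^ 2 ∂gaussVec κ ≤ M / 8 := by
    calc _ ≤ η / 2 * (M ^ 2 * (1 / s ^ 2)) := by gcongr
      _ = _ := by rw [hη]; field_simp; norm_num
  have c3 : 1 / (2 * η) * (gaussVec κ).real A = M * (2 / s ^ 2 * (gaussVec κ).real A) := by
    rw [hη]; field_simp; norm_num
  rw [c3] at h_int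
  have : M * (1 / 8) ≤ M * (2 / s ^ 2 * (gaussVec κ).real A) := by linarith
  have := le_of_mul_le_mul_left this hM0
  rw [div_mul_eq_mul_div, le_div_iff₀ (by positivity)] at this
  linarith

lemma SKSystem.nu_bigOv_le (h : SKSystem N β b T) (hN : 1 ≤ N) {s : ℝ}
    (hs : 0 < s) (hs1 : s ≤ 1) (hβ : β ^ 2 = 1 - s ^ 4) {κ₀ : ℝ} (hκ₀ : 0 ≤ κ₀) :
    nu b (bigOv N (κ₀ * s ^ 4 * N)) ≤
      (16 * exp (π ^ 2 / 8 + 2) + 6) / s ^ 2 * exp (-(κ₀ * s ^ 11 * N / 112)) := by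
  set M := meanZ N β with hM
  have hM0 : 0 < M := meanZ_pos N β
  set r := κ₀ * s ^ 11 * N / 112 with hr
  set K := 7 / s ^ 3 with hK
  set A := goodSet N β b K with hA
  have hAm : MeasurableSet A := measurableSet_goodSet _
  have hPA := h.le_measureReal_goodSet hN hs hs1 hβ
  have hβ1 : β ^ 2 ≤ 1 := by have := pow_pos hs 4; linarith
  have hK0 : 0 ≤ K := by positivity
  set C : Set (κ → ℝ) := {ω | partZ b ω < M / 2 * exp (-(K * r))} with hC
  have hCm : MeasurableSet C := measurableSet_lt (continuous_partZ b).measurable measurable_const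
  have hne : A.Nonempty := by
    by_contra hcon
    rw [Set.not_nonempty_iff_eq_empty] at hcon
    rw [← hA, hcon, measureReal_empty] at hPA
    have := pow_pos hs 2
    linarith
  have hsep := gaussVec_separated_le (κ := κ) (A := A) (C := C) (r := r) hAm (by
    intro a ha ω hω
    by_contra hcon
    rw [not_le] at hcon
    have h1 := h.partZ_mul_exp_le hβ1 ω a hK0 ha.2
    have h2 : M / 2 * exp (-(K * r)) ≤ partZ b a * exp (-(K * √(∑ k, (ω k - a k) ^ 2))) := by
      have := ha.1
      have h3 : K * √(∑ k, (ω k - a k) ^ 2) ≤ K * r := by gcongr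
      have h4 : exp (-(K * r)) ≤ exp (-(K * √(∑ k, (ω k - a k) ^ 2))) :=
        exp_le_exp.2 (by linarith)
      exact mul_le_mul this h4 (exp_pos _).le (partZ_pos b a).le
    exact absurd hω (not_lt.2 (h2.trans h1))) hne
  have hPC : (gaussVec κ).real C ≤ 16 / s ^ 2 * (exp (π ^ 2 / 8 + 2) * exp (-r)) := by
    have : s ^ 2 / 16 * (gaussVec κ).real C ≤ exp (π ^ 2 / 8 + 2) * exp (-r) :=
      (mul_le_mul_of_nonneg_right hPA measureReal_nonneg).trans hsep
    calc (gaussVec κ).real C = 16 / s ^ 2 * (s ^ 2 / 16 * (gaussVec κ).real C) := by field_simp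
      _ ≤ _ := by gcongr
  set u := κ₀ * s ^ 4 * N with hu
  set a := 1 / 2 * exp (-(K * r)) with ha
  have ha0 : 0 < a := by positivity
  have hpt : ∀ ω, gav (linH b ω) (bigOv N u) ≤ C.indicator (fun _ => (1 : ℝ)) ω +
      1 / (a * M) ^ 2 * (partZ b ω ^ 2 * gav (linH b ω) (bigOv N u)) := by
    intro ω
    have g0 : 0 ≤ gav (linH b ω) (bigOv N u) := by
      have := gav_mono (linH b ω) (f := fun _ => (0:ℝ)) (g := bigOv N u) (bigOv_nonneg u)
      rwa [gav_const] at this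
    have g1 : gav (linH b ω) (bigOv N u) ≤ 1 := by
      have := gav_mono (linH b ω) (g := fun _ => (1:ℝ)) (f := bigOv N u) (bigOv_le_one u)
      rwa [gav_const] at this
    by_cases hω : ω ∈ C
    · rw [Set.indicator_of_mem hω]
      have : 0 ≤ 1 / (a * M) ^ 2 * (partZ b ω ^ 2 * gav (linH b ω) (bigOv N u)) := by positivity
      linarith
    · rw [Set.indicator_of_notMem hω, zero_add]
      have hz : a * M ≤ partZ b ω := by
        have : M / 2 * exp (-(K * r)) ≤ partZ b ω := not_lt.1 hω
        calc a * M = M / 2 * exp (-(K * r)) := by rw [ha]; ring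
          _ ≤ _ := this
      have hz2 : (a * M) ^ 2 ≤ partZ b ω ^ 2 := by gcongr
      calc gav (linH b ω) (bigOv N u) = 1 / (a * M) ^ 2 * ((a * M) ^ 2 *
            gav (linH b ω) (bigOv N u)) := by field_simp
        _ ≤ _ := by gcongr
  have hi1 := (h.integral_partZ_sq_mul_gav hN (bigOv N u)).1
  have hi3 : Integrable (C.indicator (fun _ => (1 : ℝ))) (gaussVec κ) :=
    (integrable_const _).indicator hCm
  have h_int := integral_mono (integrable_gav_linH b (bigOv N u))
    (hi3.add (hi1.const_mul (1 / (a * M) ^ 2))) hpt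
  simp only [Pi.add_apply] at h_int
  rw [integral_add hi3 (hi1.const_mul (1 / (a * M) ^ 2)), integral_const_mul,
    integral_indicator hCm] at h_int
  simp only [integral_const, smul_eq_mul, mul_one, measureReal_restrict_apply_univ] at h_int
  have b1 := h.integral_partZ_sq_mul_bigOv_le hN hs hs1 hβ u
  have c1 : 1 / (a * M) ^ 2 * ∫ ω, partZ b ω ^ 2 * gav (linH b ω) (bigOv N u) ∂gaussVec κ ≤
      6 / s ^ 2 * exp (-r) := by
    have e1 : (a ^ 2)⁻¹ = 4 * exp (2 * (K * r)) := by
      rw [ha, mul_pow, ← exp_nat_mul, mul_inv, ← exp_neg]; norm_num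
    have e2 : 2 * (K * r) + -(s ^ 4 / 4 * u) ≤ -r := by
      have : K * r = κ₀ * s ^ 8 * N / 16 := by rw [hK, hr]; field_simp; ring
      rw [this, hu, hr]
      have h3 : s ^ 11 ≤ s ^ 8 := pow_le_pow_of_le_one hs.le hs1 (by norm_num)
      have h4 : κ₀ * s ^ 11 * N ≤ κ₀ * s ^ 8 * N := by gcongr
      have h5 : 0 ≤ κ₀ * s ^ 8 * N := by positivity
      have e : s ^ 4 / 4 * (κ₀ * s ^ 4 * N) = κ₀ * s ^ 8 * N / 4 := by ring
      rw [e]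
      linarith
    calc _ ≤ 1 / (a * M) ^ 2 * (M ^ 2 * (exp (-(s ^ 4 / 4 * u)) * (3 / 2 / s ^ 2))) := by
          gcongr
      _ = (a ^ 2)⁻¹ * (exp (-(s ^ 4 / 4 * u)) * (3 / 2 / s ^ 2)) := by field_simp
      _ = 6 / s ^ 2 * exp (2 * (K * r) + -(s ^ 4 / 4 * u)) := by rw [e1, exp_add]; ring
      _ ≤ _ := by gcongr
  calc nu b (bigOv N u) ≤ _ := h_int
    _ ≤ 16 / s ^ 2 * (exp (π ^ 2 / 8 + 2) * exp (-r)) + 6 / s ^ 2 * exp (-r) := add_le_add hPC c1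
    _ = _ := by ring

/-- At distance at least of order `N ^ (-1/3)` from criticality the overlap is small up to
polynomially small probability. -/
lemma exists_nu_bigOv_le {c₀ κ₀ : ℝ} (hc₀ : 0 < c₀) (hκ₀ : 0 < κ₀) :
    ∃ C : ℝ, 0 ≤ C ∧ ∀ (κ : Type) [Fintype κ] [DecidableEq κ] (N : ℕ) (β : ℝ)
      (b : κ → Config N → ℝ) (T : Fin N → Finset κ), SKSystem N β b T → 1 ≤ N → 0 < 1 - β ^ 2 →
      c₀ ≤ N * (1 - β ^ 2) ^ 3 →
      nu b (bigOv N (κ₀ * (1 - β ^ 2) * N)) * (N : ℝ) ^ 5 ≤ C := by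
  set D := 16 * exp (π ^ 2 / 8 + 2) + 6 with hD
  have hD0 : 0 < D := by positivity
  refine ⟨D * (Nat.factorial 64) * (112 / κ₀) ^ 64 / c₀ ^ 59, by positivity, ?_⟩
  intro κ _ _ N β b T h hN hδ hc
  set s := √√(1 - β ^ 2) with hs_def
  have hs : 0 < s := Real.sqrt_pos.2 (Real.sqrt_pos.2 hδ)
  have hs4 : s ^ 4 = 1 - β ^ 2 := by
    rw [show s ^ 4 = (s ^ 2) ^ 2 by ring, hs_def, Real.sq_sqrt (Real.sqrt_nonneg _),
      Real.sq_sqrt hδ.le]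
  have hs1 : s ≤ 1 := by
    by_contra hcon
    have := one_lt_pow₀ (not_le.1 hcon) (n := 4) (by norm_num)
    have := sq_nonneg β
    linarith
  have hN0 : (0 : ℝ) < N := by exact_mod_cast hN
  have h1 := h.nu_bigOv_le hN hs hs1 (by linarith) hκ₀.le
  rw [← hs4]
  rw [← hs4] at hc
  set r := κ₀ * s ^ 11 * N / 112 with hr
  have hr0 : 0 < r := by positivity
  have h2 : exp (-r) ≤ (Nat.factorial 64) / r ^ 64 := by
    have := Real.pow_div_factorial_le_exp (x := r) hr0.le 64
    rw [exp_neg, inv_le_comm₀ (exp_pos _) (by positivity), inv_div]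
    exact this
  have hs12 : c₀ ^ 59 ≤ (N * (s ^ 4) ^ 3) ^ 59 := by gcongr
  have hs2 : s ^ 4 ≤ s ^ 2 := pow_le_pow_of_le_one hs.le hs1 (by norm_num)
  calc nu b (bigOv N (κ₀ * s ^ 4 * N)) * (N : ℝ) ^ 5
      ≤ D / s ^ 2 * exp (-r) * (N : ℝ) ^ 5 := by gcongr
    _ ≤ D / s ^ 4 * ((Nat.factorial 64) / r ^ 64) * (N : ℝ) ^ 5 := by gcongr
    _ = D * (Nat.factorial 64) * (112 / κ₀) ^ 64 / (N * (s ^ 4) ^ 3) ^ 59 := by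
        rw [hr]
        generalize (Nat.factorial 64 : ℝ) = F
        simp only [div_pow, mul_pow, ← pow_mul]
        field_simp
        ring
    _ ≤ _ := by gcongr

end TailBound

section Moments

/-- Uniform bounds for the moments of the overlap near criticality. -/
lemma exists_ovMom_le {c₀ : ℝ} (hc₀ : 0 < c₀) (k : ℕ) (hk : k ≤ 5) :
    ∃ C : ℝ, 0 ≤ C ∧ ∀ (κ : Type) [Fintype κ] [DecidableEq κ] (N : ℕ) (β : ℝ)
      (b : κ → Config N → ℝ) (T : Fin N → Finset κ), SKSystem N β b T → 1 ≤ N → 0 < 1 - β ^ 2 →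
      c₀ ≤ N * (1 - β ^ 2) ^ 3 →
      ovMom N b (2 * k) * (1 - β ^ 2) ^ k ≤ C := by
  induction k with
  | zero =>
    refine ⟨1, zero_le_one, fun κ _ _ N β b T h hN hδ hc => ?_⟩
    simp [ovMom, nu_const]
  | succ k ih =>
    obtain ⟨C, hC0, hC⟩ := ih (by omega)
    set D := recCst (k + 1) * 2 ^ (2 * k + 4) + 1 with hD
    have hD0 : 0 < D := by have := recCst_nonneg (k + 1); positivity
    obtain ⟨P, hP0, hP⟩ := exists_nu_bigOv_le hc₀ (κ₀ := 1 / (2 * D)) (by positivity)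
    refine ⟨2 * D * (C + 2 + P), by positivity, fun κ _ _ N β b T h hN hδ hc => ?_⟩
    have hN1 : (1 : ℝ) ≤ N := by exact_mod_cast hN
    have hN0 : (0 : ℝ) < N := by linarith
    have hδ1 : 1 - β ^ 2 ≤ 1 := by have := sq_nonneg β; linarith
    have h1 := h.moment_recursion hN (by linarith) k
    have h2 := hC κ N β b T h hN hδ hc
    have h3 := hP κ N β b T h hN hδ hc
    set δ := 1 - β ^ 2 with hδdef
    set u := 1 / (2 * D) * δ * N with hu
    have hu0 : 0 ≤ u := by positivity
    have h4 : ovMom N b (2 * (k + 2)) ≤ u * ovMom N b (2 * (k + 1)) +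
        (N : ℝ) ^ (k + 2) * nu b (bigOv N u) := by
      rw [ovMom, ovMom, ← nu_const_mul, ← nu_const_mul, ← nu_add]
      refine nu_mono b fun ρ => ?_
      have e1 : scOv N (ρ 0) (ρ 1) ^ (2 * (k + 2)) = sqOv N ρ * sqOv N ρ ^ (k + 1) := by
        rw [pow_mul, ← pow_succ']; rfl
      have e2 : scOv N (ρ 0) (ρ 1) ^ (2 * (k + 1)) = sqOv N ρ ^ (k + 1) := by
        rw [pow_mul]; rfl
      have hq := sqOv_nonneg ρ
      have hqN : sqOv N ρ ≤ N := by
        have := pow_le_one₀ (abs_nonneg _) (abs_ovlp_le (ρ 0) (ρ 1)) (n := 2)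
        rw [sq_abs] at this
        rw [sqOv, sq_scOv]
        nlinarith
      rw [e1, e2, bigOv]
      split_ifs with hc
      · have : sqOv N ρ * sqOv N ρ ^ (k + 1) ≤ N * (N : ℝ) ^ (k + 1) := by gcongr
        have hp : (N : ℝ) ^ (k + 2) = N * (N : ℝ) ^ (k + 1) := pow_succ' _ _
        have h0 : 0 ≤ u * sqOv N ρ ^ (k + 1) := by positivity
        linarith
      · have : sqOv N ρ * sqOv N ρ ^ (k + 1) ≤ u * sqOv N ρ ^ (k + 1) := by
          have := (not_le.1 hc).le
          gcongr
        linarith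
    have hP0 : 0 ≤ nu b (bigOv N u) := nu_nonneg b (bigOv_nonneg u)
    have h5 : 1 / (N : ℝ) * ovMom N b (2 * (k + 2)) ≤
        1 / (2 * D) * δ * ovMom N b (2 * (k + 1)) + P := by
      calc 1 / (N : ℝ) * ovMom N b (2 * (k + 2)) ≤ 1 / (N : ℝ) *
            (u * ovMom N b (2 * (k + 1)) + (N : ℝ) ^ (k + 2) * nu b (bigOv N u)) := by gcongr
        _ = 1 / (2 * D) * δ * ovMom N b (2 * (k + 1)) + nu b (bigOv N u) * (N : ℝ) ^ (k + 1) := by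
            rw [hu]; field_simp; ring
        _ ≤ 1 / (2 * D) * δ * ovMom N b (2 * (k + 1)) + nu b (bigOv N u) * (N : ℝ) ^ 5 := by
            gcongr
        _ ≤ _ := by gcongr
    have hm := ovMom_nonneg (N := N) b k
    have hm1 := ovMom_nonneg (N := N) b (k + 1)
    have hm2 := ovMom_nonneg (N := N) b (k + 2)
    have hinv : 1 / (N : ℝ) ≤ 1 := by rw [div_le_one hN0]; exact hN1
    have h6 : δ * ovMom N b (2 * (k + 1)) ≤ D * (ovMom N b (2 * k) + 1 +
        (1 / (2 * D) * δ * ovMom N b (2 * (k + 1)) + P + 1)) := by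
      refine h1.trans ?_
      refine mul_le_mul (by rw [hD]; linarith) ?_ (by positivity) hD0.le
      rw [mul_add]
      linarith
    have h7 : D * (1 / (2 * D) * δ * ovMom N b (2 * (k + 1))) =
        δ * ovMom N b (2 * (k + 1)) / 2 := by field_simp
    have h8 : δ * ovMom N b (2 * (k + 1)) ≤ 2 * D * (ovMom N b (2 * k) + 2 + P) := by
      linarith
    have hδk : δ ^ k ≤ 1 := pow_le_one₀ hδ.le hδ1
    have hδk0 : 0 ≤ δ ^ k := by positivity
    calc ovMom N b (2 * (k + 1)) * δ ^ (k + 1) = δ * ovMom N b (2 * (k + 1)) * δ ^ k := by ring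
      _ ≤ 2 * D * (ovMom N b (2 * k) + 2 + P) * δ ^ k := by gcongr
      _ = 2 * D * (ovMom N b (2 * k) * δ ^ k + (2 + P) * δ ^ k) := by ring
      _ ≤ 2 * D * (C + (2 + P) * 1) := by gcongr
      _ = _ := by ring

end Moments

section PairMarginals

variable {S : Type*} [Fintype S] [Nonempty S] {κ : Type*} [Fintype κ] [DecidableEq κ]

/-- The coefficients of the sum of two Gaussian fields on pairs. -/
def pairCoef (b₁ b₂ : κ → S → ℝ) (k : κ) (x : S × S) : ℝ := b₁ k x.1 + b₂ k x.2

lemma linH_pairCoef (b₁ b₂ : κ → S → ℝ) (ω : κ → ℝ) (x : S × S) :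
    linH (pairCoef b₁ b₂) ω x = linH b₁ ω x.1 + linH b₂ ω x.2 := by
  simp only [linH, pairCoef, add_mul, Finset.sum_add_distrib]

lemma gibbsProb_pairCoef (b₁ b₂ : κ → S → ℝ) (ω : κ → ℝ) (x : S × S) :
    gibbsProb (linH (pairCoef b₁ b₂) ω) x =
      gibbsProb (linH b₁ ω) x.1 * gibbsProb (linH b₂ ω) x.2 := by
  have h : ∑ y : S × S, exp (linH (pairCoef b₁ b₂) ω y) =
      (∑ y, exp (linH b₁ ω y)) * ∑ y, exp (linH b₂ ω y) := by
    rw [Finset.sum_mul_sum, Fintype.sum_prod_type]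
    simp only [linH_pairCoef, exp_add]
  rw [gibbsProb, gibbsProb, gibbsProb, h, linH_pairCoef, exp_add, mul_div_mul_comm]

lemma sum_pair_mul (p₁ p₂ : S → ℝ) (h₂ : ∑ y, p₂ y = 1) (f : S → ℝ) :
    ∑ x : S × S, f x.1 * (p₁ x.1 * p₂ x.2) = ∑ x, f x * p₁ x := by
  rw [Fintype.sum_prod_type]
  refine Finset.sum_congr rfl fun x _ => ?_
  simp only
  rw [← mul_one (f x * p₁ x), ← h₂, Finset.mul_sum]
  exact Finset.sum_congr rfl fun y _ => by ring

lemma sum_pair_mul_snd (p₁ p₂ : S → ℝ) (h₁ : ∑ y, p₁ y = 1) (f : S → ℝ) :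
    ∑ x : S × S, f x.2 * (p₁ x.1 * p₂ x.2) = ∑ x, f x * p₂ x := by
  rw [Fintype.sum_prod_type_right]
  refine Finset.sum_congr rfl fun x _ => ?_
  simp only
  rw [← mul_one (f x * p₂ x), ← h₁, Finset.mul_sum]
  exact Finset.sum_congr rfl fun y _ => by ring

lemma nu_pair_fst (b₁ b₂ : κ → S → ℝ) (f : S → S → ℝ) :
    nu (pairCoef b₁ b₂) (fun ρ : Fin 2 → S × S => f (ρ 0).1 (ρ 1).1) =
      nu b₁ (fun ρ : Fin 2 → S => f (ρ 0) (ρ 1)) := by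
  unfold nu
  congr 1
  ext ω
  rw [gav_two, gav_two]
  simp only [gibbsProb_pairCoef, Matrix.cons_val_zero, Matrix.cons_val_one]
  set p₁ := gibbsProb (linH b₁ ω)
  set p₂ := gibbsProb (linH b₂ ω)
  have h₂ : ∑ y, p₂ y = 1 := sum_gibbsProb _
  have := sum_pair_mul p₁ p₂ h₂ (fun x => ∑ y, f x y * p₁ y)
  have e : ∀ x : S × S, ∑ y : S × S, f x.1 y.1 * (p₁ x.1 * p₂ x.2 * (p₁ y.1 * p₂ y.2)) =
      (∑ y, f x.1 y * p₁ y) * (p₁ x.1 * p₂ x.2) := by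
    intro x
    rw [← sum_pair_mul p₁ p₂ h₂ (fun y => f x.1 y), Finset.sum_mul]
    exact Finset.sum_congr rfl fun y _ => by ring
  rw [Finset.sum_congr rfl fun x _ => e x, this]
  refine Finset.sum_congr rfl fun x _ => ?_
  rw [Finset.sum_mul]
  exact Finset.sum_congr rfl fun y _ => by ring

lemma nu_pair_snd (b₁ b₂ : κ → S → ℝ) (f : S → S → ℝ) :
    nu (pairCoef b₁ b₂) (fun ρ : Fin 2 → S × S => f (ρ 0).2 (ρ 1).2) =
      nu b₂ (fun ρ : Fin 2 → S => f (ρ 0) (ρ 1)) := by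
  unfold nu
  congr 1
  ext ω
  rw [gav_two, gav_two]
  simp only [gibbsProb_pairCoef, Matrix.cons_val_zero, Matrix.cons_val_one]
  set p₁ := gibbsProb (linH b₁ ω)
  set p₂ := gibbsProb (linH b₂ ω)
  have h₁ : ∑ y, p₁ y = 1 := sum_gibbsProb _
  have := sum_pair_mul_snd p₁ p₂ h₁ (fun x => ∑ y, f x y * p₂ y)
  have e : ∀ x : S × S, ∑ y : S × S, f x.2 y.2 * (p₁ x.1 * p₂ x.2 * (p₁ y.1 * p₂ y.2)) =
      (∑ y, f x.2 y * p₂ y) * (p₁ x.1 * p₂ x.2) := by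
    intro x
    rw [← sum_pair_mul_snd p₁ p₂ h₁ (fun y => f x.2 y), Finset.sum_mul]
    exact Finset.sum_congr rfl fun y _ => by ring
  rw [Finset.sum_congr rfl fun x _ => e x, this]
  refine Finset.sum_congr rfl fun x _ => ?_
  rw [Finset.sum_mul]
  exact Finset.sum_congr rfl fun y _ => by ring

lemma nu_pair_cross (b₁ b₂ : κ → S → ℝ) (f : S → S → ℝ) :
    nu (pairCoef b₁ b₂) (fun ρ : Fin 2 → S × S => f (ρ 0).1 (ρ 1).2) =
      nu (pairCoef b₁ b₂) (fun ρ : Fin 1 → S × S => f (ρ 0).1 (ρ 0).2) := by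
  unfold nu
  congr 1
  ext ω
  rw [gav_two, gav_one]
  simp only [gibbsProb_pairCoef, Matrix.cons_val_zero, Matrix.cons_val_one]
  set p₁ := gibbsProb (linH b₁ ω)
  set p₂ := gibbsProb (linH b₂ ω)
  have h₁ : ∑ y, p₁ y = 1 := sum_gibbsProb _
  have h₂ : ∑ y, p₂ y = 1 := sum_gibbsProb _
  have := sum_pair_mul p₁ p₂ h₂ (fun x => ∑ y, f x y * p₂ y)
  have e : ∀ x : S × S, ∑ y : S × S, f x.1 y.2 * (p₁ x.1 * p₂ x.2 * (p₁ y.1 * p₂ y.2)) =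
      (∑ y, f x.1 y * p₂ y) * (p₁ x.1 * p₂ x.2) := by
    intro x
    rw [← sum_pair_mul_snd p₁ p₂ h₁ (fun y => f x.1 y), Finset.sum_mul]
    exact Finset.sum_congr rfl fun y _ => by ring
  rw [Finset.sum_congr rfl fun x _ => e x, this, Fintype.sum_prod_type]
  refine Finset.sum_congr rfl fun x _ => ?_
  rw [Finset.sum_mul]
  exact Finset.sum_congr rfl fun y _ => by ring

/-- Cross moments of a power of a positive semidefinite kernel are dominated by the moments of the
two marginals. -/
lemma nu_pair_pow_le {ι : Type*} [DecidableEq ι] (J : Finset ι) (φ : ι → S → ℝ) (m : ℕ)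
    (b₁ b₂ : κ → S → ℝ) :
    nu (pairCoef b₁ b₂) (fun ρ : Fin 1 → S × S => (∑ j ∈ J, φ j (ρ 0).1 * φ j (ρ 0).2) ^ m) ≤
      1 / 2 * (nu b₁ (fun ρ : Fin 2 → S => (∑ j ∈ J, φ j (ρ 0) * φ j (ρ 1)) ^ m) +
        nu b₂ (fun ρ : Fin 2 → S => (∑ j ∈ J, φ j (ρ 0) * φ j (ρ 1)) ^ m)) := by
  unfold nu
  rw [← integral_add (integrable_gav_linH _ _) (integrable_gav_linH _ _), ← integral_const_mul]
  refine integral_mono (integrable_gav_linH _ _)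
    (((integrable_gav_linH _ _).add (integrable_gav_linH _ _)).const_mul _) fun ω => ?_
  simp only [Pi.add_apply]
  rw [gav_one, gav_two, gav_two, Fintype.sum_prod_type]
  simp only [gibbsProb_pairCoef, Matrix.cons_val_zero, Matrix.cons_val_one, sum_mul_pow_eq]
  set p₁ := gibbsProb (linH b₁ ω)
  set p₂ := gibbsProb (linH b₂ ω)
  set Q := Fintype.piFinset (fun _ : Fin m => J)
  have key : ∀ p q : S → ℝ, ∑ x, ∑ y, (∑ a ∈ Q, (∏ c, φ (a c) x) * ∏ c, φ (a c) y) * (p x * q y) =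
      ∑ a ∈ Q, (∑ x, (∏ c, φ (a c) x) * p x) * ∑ y, (∏ c, φ (a c) y) * q y := by
    intro p q
    symm
    simp only [Finset.sum_mul_sum]
    rw [Finset.sum_comm]
    refine Finset.sum_congr rfl fun x _ => ?_
    rw [Finset.sum_comm]
    refine Finset.sum_congr rfl fun y _ => ?_
    rw [Finset.sum_mul]
    exact Finset.sum_congr rfl fun a _ => by ring
  rw [key, key, key, ← Finset.sum_add_distrib, Finset.mul_sum]
  refine Finset.sum_le_sum fun a _ => ?_
  nlinarith [sq_nonneg ((∑ x, (∏ c, φ (a c) x) * p₁ x) - ∑ y, (∏ c, φ (a c) y) * p₂ y)]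

end PairMarginals

section PairSystems

variable {κ : Type*} [Fintype κ] [DecidableEq κ] {N : ℕ} {β t : ℝ} {b₁ b₂ : κ → Config N → ℝ}
  {T : Fin N → Finset κ}

/-- Two correlated SK systems on the same disorder. -/
structure PairSystem (N : ℕ) (β t : ℝ) (b₁ b₂ : κ → Config N → ℝ) (T : Fin N → Finset κ) :
    Prop where
  fst : SKSystem N β b₁ T
  snd : SKSystem N β b₂ T
  cross : ∀ i σ τ, ∑ k ∈ T i, b₁ k σ * b₂ k τ = β ^ 2 * t * (spinProd i σ τ * ovCav N i σ τ)

/-- The contribution of site `i` to the cavity kernel. -/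
def cavProd (N : ℕ) (i : Fin N) (σ τ : Config N) : ℝ := spinProd i σ τ * ovCav N i σ τ

lemma cavProd_flip_left (i : Fin N) (σ τ : Config N) :
    cavProd N i (flipAt i σ) τ = -cavProd N i σ τ := by
  rw [cavProd, spinProd_flip_left, ovCav_flip_left, cavProd, neg_mul]

lemma cavProd_comm (i : Fin N) (σ τ : Config N) : cavProd N i σ τ = cavProd N i τ σ := by
  rw [cavProd, spinProd_comm, ovCav_comm, cavProd]

lemma cavProd_self (i : Fin N) (σ : Config N) : cavProd N i σ σ = 1 - 1 / N := by
  have h1 := ovlp_eq i σ σ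
  rw [ovlp_self i.pos, spin_mul_self] at h1
  rw [cavProd, spinProd, spin_mul_self, one_mul]
  linarith

/-- The cavity kernel on pairs of configurations. -/
def pairKer (N : ℕ) (β t : ℝ) (i : Fin N) (x y : Config N × Config N) : ℝ :=
  β ^ 2 * (cavProd N i x.1 y.1 + cavProd N i x.2 y.2) +
    β ^ 2 * t * (cavProd N i x.1 y.2 + cavProd N i x.2 y.1)

/-- The non-constant part of the diagonal of the cavity kernel on pairs. -/
def pairDiag (N : ℕ) (β t : ℝ) (i : Fin N) (x : Config N × Config N) : ℝ :=
  2 * (β ^ 2 * t * cavProd N i x.1 x.2)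

/-- The function dominating the cavity kernel on pairs. -/
def pairDom (N : ℕ) (x y : Config N × Config N) : ℝ :=
  domOv N x.1 y.1 + domOv N x.2 y.2 + (domOv N x.1 y.2 + domOv N x.2 y.1)

/-- The function dominating the diagonal of the cavity kernel on pairs. -/
def pairDomDiag (N : ℕ) (x : Config N × Config N) : ℝ := 2 * domOv N x.1 x.2

/-- Flipping the spins of both configurations at site `i`. -/
def flipBoth (i : Fin N) (x : Config N × Config N) : Config N × Config N :=
  (flipAt i x.1, flipAt i x.2)

/-- Flipping the spin of the first configuration at site `i`. -/
def flipFst (i : Fin N) (x : Config N × Config N) : Config N × Config N := (flipAt i x.1, x.2)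

lemma pairDom_nonneg (x y : Config N × Config N) : 0 ≤ pairDom N x y := by
  have h1 := domOv_pos (N := N) x.1 y.1
  have h2 := domOv_pos (N := N) x.2 y.2
  have h3 := domOv_pos (N := N) x.1 y.2
  have h4 := domOv_pos (N := N) x.2 y.1
  unfold pairDom; linarith

lemma pairDomDiag_nonneg (x : Config N × Config N) : 0 ≤ pairDomDiag N x := by
  have h1 := domOv_pos (N := N) x.1 x.2
  unfold pairDomDiag; linarith

lemma PairSystem.cavityData (h : PairSystem N β t b₁ b₂ T) (hβ : β ^ 2 ≤ 1)
    (ht : t ∈ Set.Icc (0 : ℝ) 1) (i : Fin N) :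
    CavityData (pairCoef b₁ b₂) (T i) (pairKer N β t i) (pairDiag N β t i) (flipBoth i) (flipFst i)
      (pairDom N) (pairDomDiag N) (1 / √N) 8 where
  ker x y := by
    have e : ∀ k, pairCoef b₁ b₂ k x * pairCoef b₁ b₂ k y =
        b₁ k x.1 * b₁ k y.1 + b₂ k x.2 * b₂ k y.2 +
        (b₁ k x.1 * b₂ k y.2 + b₁ k y.1 * b₂ k x.2) := fun k => by unfold pairCoef; ring
    simp only [e, Finset.sum_add_distrib]
    rw [h.fst.site, h.snd.site, h.cross, h.cross, pairKer, cavProd_comm i x.2 y.1]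
    unfold cavProd
    ring
  diag := ⟨2 * (β ^ 2 * (1 - 1 / N)), fun x => by
    rw [pairKer, pairDiag, cavProd_self, cavProd_self, cavProd_comm i x.2 x.1]; ring⟩
  inv x := by simp [flipBoth, flipAt_involutive i _]
  inv' x := by simp [flipFst, flipAt_involutive i _]
  off k hk x := by simp [pairCoef, flipBoth, h.fst.off i k hk, h.snd.off i k hk]
  off' k hk x := by simp [pairCoef, flipFst, h.fst.off i k hk]
  odd x y := by simp only [pairKer, flipBoth, cavProd_flip_left]; ring
  odd' x := by simp only [pairDiag, flipFst, cavProd_flip_left]; ring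
  bound x y := by
    have h1 := abs_spinProd_mul_ovCav_le i x.1 y.1
    have h2 := abs_spinProd_mul_ovCav_le i x.2 y.2
    have h3 := abs_spinProd_mul_ovCav_le i x.1 y.2
    have h4 := abs_spinProd_mul_ovCav_le i x.2 y.1
    have hb : |β ^ 2| ≤ 1 := by rwa [abs_of_nonneg (sq_nonneg β)]
    have hbt : |β ^ 2 * t| ≤ 1 := by
      rw [abs_of_nonneg (mul_nonneg (sq_nonneg β) ht.1)]
      exact mul_le_one₀ hβ ht.1 ht.2
    have g : ∀ a u v : ℝ, |a| ≤ 1 → |a * (u + v)| ≤ |u| + |v| := fun a u v ha => by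
      rw [abs_mul]
      have := abs_add_le u v
      nlinarith [abs_nonneg (u + v), abs_nonneg a]
    calc |pairKer N β t i x y| ≤ _ := abs_add_le _ _
      _ ≤ _ := add_le_add (g _ _ _ hb) (g _ _ _ hbt)
      _ ≤ _ := add_le_add (add_le_add h1 h2) (add_le_add h3 h4)
      _ = _ := by unfold pairDom; ring
  bound' x := by
    have h1 := abs_spinProd_mul_ovCav_le i x.1 x.2
    have hbt : |β ^ 2 * t| ≤ 1 := by
      rw [abs_of_nonneg (mul_nonneg (sq_nonneg β) ht.1)]
      exact mul_le_one₀ hβ ht.1 ht.2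
    rw [pairDiag, abs_mul, abs_mul, abs_two, pairDomDiag]
    have : |β ^ 2 * t| * |cavProd N i x.1 x.2| ≤ 1 * (1 / √N * domOv N x.1 x.2) :=
      mul_le_mul hbt h1 (abs_nonneg _) zero_le_one
    linarith
  nonneg x y := pairDom_nonneg x y
  nonneg' x := pairDomDiag_nonneg x
  le x y := by
    have h1 := domOv_le i.pos x.1 y.1
    have h2 := domOv_le i.pos x.2 y.2
    have h3 := domOv_le i.pos x.1 y.2
    have h4 := domOv_le i.pos x.2 y.1
    rw [pairDom]; simp only [mul_add]; linarith
  le' x := by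
    have h1 := domOv_le i.pos x.1 x.2
    rw [pairDomDiag]; linarith
  theta := by positivity

lemma scOv_eq_sum (σ τ : Config N) :
    scOv N σ τ = ∑ j, (√(√N / N) * spin (σ j)) * (√(√N / N) * spin (τ j)) := by
  have h : √(√(N : ℝ) / N) * √(√(N : ℝ) / N) = √N / N := Real.mul_self_sqrt (by positivity)
  have h' : ∀ j, (√(√N / N) * spin (σ j)) * (√(√N / N) * spin (τ j)) =
      √N / N * (spin (σ j) * spin (τ j)) := fun j => by rw [mul_mul_mul_comm, h]
  simp only [h', ← Finset.mul_sum]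
  rw [scOv, ovlp]
  ring

/-- Moments of the overlap between the two members of a pair. -/
def pairMom (N : ℕ) (b₁ b₂ : κ → Config N → ℝ) (p : ℕ) : ℝ :=
  nu (pairCoef b₁ b₂) (fun ρ : Fin 1 → Config N × Config N => scOv N (ρ 0).1 (ρ 0).2 ^ p)

lemma pairMom_le (b₁ b₂ : κ → Config N → ℝ) (p : ℕ) :
    pairMom N b₁ b₂ p ≤ 1 / 2 * (ovMom N b₁ p + ovMom N b₂ p) := by
  have := nu_pair_pow_le univ (fun j (σ : Config N) => √(√N / N) * spin (σ j)) p b₁ b₂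
  simp only [← scOv_eq_sum] at this
  exact this

lemma domOv_pow_le (k : ℕ) (σ τ : Config N) :
    domOv N σ τ ^ (2 * k) ≤ 2 ^ (2 * k) * (scOv N σ τ ^ (2 * k) + 1) := by
  have h1 := add_pow_le (abs_nonneg (scOv N σ τ)) zero_le_one (2 * k)
  rw [one_pow, (even_two_mul k).pow_abs] at h1
  refine h1.trans ?_
  have h2 : 0 ≤ scOv N σ τ ^ (2 * k) := (even_two_mul k).pow_nonneg _
  refine mul_le_mul_of_nonneg_right ?_ (by positivity)
  exact pow_le_pow_right₀ (by norm_num) (Nat.sub_le _ _)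

lemma nu_pairDom_le (b₁ b₂ : κ → Config N → ℝ) (k : ℕ) (hk : k ≠ 0) {m : ℝ}
    (h₁ : ovMom N b₁ (2 * k) ≤ m) (h₂ : ovMom N b₂ (2 * k) ≤ m) :
    nu (pairCoef b₁ b₂) (fun ρ : Fin 2 → Config N × Config N =>
      pairDom N (ρ 0) (ρ 1) ^ (2 * k)) ≤ 4 ^ (2 * k + 1) * (2 ^ (2 * k) * (m + 1)) ∧
    nu (pairCoef b₁ b₂) (fun ρ : Fin 1 → Config N × Config N =>
      pairDomDiag N (ρ 0) ^ (2 * k)) ≤ 4 ^ (2 * k + 1) * (2 ^ (2 * k) * (m + 1)) := by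
  have hm0 : 0 ≤ m := (ovMom_nonneg b₁ k).trans h₁
  have h₃ : pairMom N b₁ b₂ (2 * k) ≤ m := (pairMom_le b₁ b₂ _).trans (by linarith)
  set F : Config N → Config N → ℝ := fun σ τ => domOv N σ τ ^ (2 * k) with hF
  have e1 : nu (pairCoef b₁ b₂) (fun ρ : Fin 2 → Config N × Config N => F (ρ 0).1 (ρ 1).1) ≤
      2 ^ (2 * k) * (m + 1) := by
    rw [nu_pair_fst]
    exact (domMom_le b₁ k).trans (by gcongr)
  have e2 : nu (pairCoef b₁ b₂) (fun ρ : Fin 2 → Config N × Config N => F (ρ 0).2 (ρ 1).2) ≤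
      2 ^ (2 * k) * (m + 1) := by
    rw [nu_pair_snd]
    exact (domMom_le b₂ k).trans (by gcongr)
  have e3 : nu (pairCoef b₁ b₂) (fun ρ : Fin 1 → Config N × Config N => F (ρ 0).1 (ρ 0).2) ≤
      2 ^ (2 * k) * (m + 1) := by
    refine (nu_mono _ fun ρ => domOv_pow_le k _ _).trans ?_
    rw [nu_const_mul, nu_add, nu_const]
    gcongr
    exact h₃
  have e4 : nu (pairCoef b₁ b₂) (fun ρ : Fin 2 → Config N × Config N => F (ρ 0).1 (ρ 1).2) ≤
      2 ^ (2 * k) * (m + 1) := by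
    rw [nu_pair_cross]; exact e3
  have e5 : nu (pairCoef b₁ b₂) (fun ρ : Fin 2 → Config N × Config N => F (ρ 0).2 (ρ 1).1) ≤
      2 ^ (2 * k) * (m + 1) := by
    have := nu_comp_injective (pairCoef b₁ b₂) (e := ![(1 : Fin 2), 0])
      (by intro x y; fin_cases x <;> fin_cases y <;> simp)
      (fun ρ : Fin 2 → Config N × Config N => F (ρ 0).1 (ρ 1).2)
    simp only [Function.comp_apply, Matrix.cons_val_zero, Matrix.cons_val_one] at this
    rw [← this] at e4
    refine le_trans (le_of_eq ?_) e4
    congr 1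
    ext ρ
    simp only [hF, domOv_comm (ρ 0).2 (ρ 1).1]
  constructor
  · have hpt : ∀ ρ : Fin 2 → Config N × Config N, pairDom N (ρ 0) (ρ 1) ^ (2 * k) ≤
        4 ^ (2 * k) * (F (ρ 0).1 (ρ 1).1 + F (ρ 0).2 (ρ 1).2 +
          (F (ρ 0).1 (ρ 1).2 + F (ρ 0).2 (ρ 1).1)) := by
      intro ρ
      have := pow_sum_le_mul_sum_pow (univ : Finset (Fin 4)) ![domOv N (ρ 0).1 (ρ 1).1,
        domOv N (ρ 0).2 (ρ 1).2, domOv N (ρ 0).1 (ρ 1).2, domOv N (ρ 0).2 (ρ 1).1]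
        (by intro j _; fin_cases j <;> exact (domOv_pos _ _).le) (2 * k) (by omega)
      simp only [Fin.sum_univ_four, Finset.card_univ, Fintype.card_fin] at this
      simp only [hF, pairDom]
      convert this using 1
      · simp; ring
      · simp; ring
    refine (nu_mono _ hpt).trans ?_
    rw [nu_const_mul, nu_add, nu_add, nu_add, pow_succ, mul_assoc]
    gcongr
    linarith
  · simp only [pairDomDiag, mul_pow]
    rw [nu_const_mul]
    calc _ ≤ 2 ^ (2 * k) * (2 ^ (2 * k) * (m + 1)) := by gcongr
      _ ≤ _ := by
        gcongr
        calc (2 : ℝ) ^ (2 * k) ≤ 4 ^ (2 * k) := by gcongr; norm_num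
          _ ≤ _ := pow_le_pow_right₀ (by norm_num) (by omega)

/-- Moments of the total kernel of a pair system. -/
lemma nu_totKer_pair_le (b₁ b₂ : κ → Config N → ℝ) (k n : ℕ) (hk : k ≠ 0) {m : ℝ}
    (h₁ : ovMom N b₁ (2 * k) ≤ m) (h₂ : ovMom N b₂ (2 * k) ≤ m) :
    nu (pairCoef b₁ b₂) (fun ρ : Fin n → Config N × Config N =>
      totKer (pairDom N) (pairDomDiag N) ρ ^ (2 * k)) ≤
      ((n : ℝ) * n) ^ (2 * k) * (n * n) * (4 ^ (2 * k + 1) * (2 ^ (2 * k) * (m + 1))) :=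
  nu_totKer_pow_le _ pairDom_nonneg pairDomDiag_nonneg n (2 * k) (by omega)
    (nu_pairDom_le b₁ b₂ k hk h₁ h₂).1 (nu_pairDom_le b₁ b₂ k hk h₁ h₂).2

lemma domOv_le_totKer_pair {n : ℕ} (ρ : Fin n → Config N × Config N) (l : Fin n) :
    domOv N (ρ l).1 (ρ l).2 ≤ totKer (pairDom N) (pairDomDiag N) ρ := by
  have hr : ∀ l l', 0 ≤ replKer (pairDom N) (pairDomDiag N) ρ l l' := by
    intro l l'; unfold replKer; split_ifs
    · exact pairDomDiag_nonneg _
    · exact pairDom_nonneg _ _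
  have h1 : domOv N (ρ l).1 (ρ l).2 ≤ replKer (pairDom N) (pairDomDiag N) ρ l l := by
    have := domOv_pos (N := N) (ρ l).1 (ρ l).2
    simp only [replKer, if_true, pairDomDiag]
    linarith
  refine h1.trans ?_
  refine (Finset.single_le_sum (f := fun l' => replKer (pairDom N) (pairDomDiag N) ρ l l')
    (fun l' _ => hr l l') (mem_univ l)).trans ?_
  exact Finset.single_le_sum (f := fun l => ∑ l', replKer (pairDom N) (pairDomDiag N) ρ l l')
    (fun l _ => Finset.sum_nonneg fun l' _ => hr l l') (mem_univ l)

end PairSystems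

section PairCavity

variable {κ : Type*} [Fintype κ] [DecidableEq κ] {N : ℕ} {β t : ℝ} {b₁ b₂ : κ → Config N → ℝ}
  {T : Fin N → Finset κ}

/-- The scaled overlap inside a pair. -/
def pOv (x : Config N × Config N) : ℝ := scOv N x.1 x.2

/-- The scaled cavity overlap inside a pair. -/
def pCav (i : Fin N) (x : Config N × Config N) : ℝ := scCav N i x.1 x.2

/-- The function dominating the overlap inside a pair. -/
def pDom (x : Config N × Config N) : ℝ := domOv N x.1 x.2

/-- The product of the spins at site `i` of a pair. -/
def pSpin (i : Fin N) (x : Config N × Config N) : ℝ := spinProd i x.1 x.2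

lemma one_le_pDom (x : Config N × Config N) : 1 ≤ pDom x := one_le_domOv _ _

lemma abs_pOv_le (x : Config N × Config N) : |pOv x| ≤ pDom x := abs_scOv_le _ _

lemma abs_pCav_le (i : Fin N) (x : Config N × Config N) : |pCav i x| ≤ pDom x :=
  abs_scCav_le i _ _

lemma abs_pSpin (i : Fin N) (x : Config N × Config N) : |pSpin i x| = 1 := abs_spinProd _ _ _

lemma pSpin_mul_self (i : Fin N) (x : Config N × Config N) : pSpin i x * pSpin i x = 1 :=
  spinProd_mul_self _ _ _

lemma pOv_eq (i : Fin N) (x : Config N × Config N) : pOv x = pCav i x + pSpin i x / √N :=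
  scOv_sub_scCav i _ _

lemma pCav_flipFst (i : Fin N) (x : Config N × Config N) : pCav i (flipFst i x) = pCav i x :=
  scCav_flip_left _ _ _

lemma pCav_flipBoth (i : Fin N) (x : Config N × Config N) : pCav i (flipBoth i x) = pCav i x := by
  rw [pCav, flipBoth, scCav_flip_left, scCav_flip_right, pCav]

lemma pSpin_flipFst (i : Fin N) (x : Config N × Config N) : pSpin i (flipFst i x) = -pSpin i x :=
  spinProd_flip_left _ _ _

lemma abs_pOv_sq_sub_le (i : Fin N) (x : Config N × Config N) :
    |pOv x ^ 2 - pCav i x ^ 2| ≤ 2 / √N * pDom x := by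
  have := abs_pow_scOv_sub_le i 2 x.1 x.2
  simpa [pOv, pCav, pDom] using this

lemma pairKer_comm (i : Fin N) (x y : Config N × Config N) :
    pairKer N β t i x y = pairKer N β t i y x := by
  rw [pairKer, pairKer, cavProd_comm i x.1 y.1, cavProd_comm i x.2 y.2, cavProd_comm i x.1 y.2,
    cavProd_comm i x.2 y.1]
  ring

/-- The total kernel of pairs of configurations. -/
def pairTot {n : ℕ} (ρ : Fin n → Config N × Config N) : ℝ := totKer (pairDom N) (pairDomDiag N) ρ

lemma pDom_le_pairTot {n : ℕ} (ρ : Fin n → Config N × Config N) (l : Fin n) :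
    pDom (ρ l) ≤ pairTot ρ := domOv_le_totKer_pair ρ l

lemma one_le_pairTot {n : ℕ} (ρ : Fin (n + 1) → Config N × Config N) : 1 ≤ pairTot ρ :=
  (one_le_pDom _).trans (pDom_le_pairTot ρ 0)

/-- The error functional of the second order cavity expansion with two replicas. -/
def pairErr (b₁ b₂ : κ → Config N → ℝ) (G : (Fin 2 → Config N × Config N) → ℝ) : ℝ :=
  nu (pairCoef b₁ b₂) (fun ρ : Fin (2 + 2 + 2) → Config N × Config N =>
    pairTot ρ ^ 2 * G (dropTwo (dropTwo ρ)))

lemma pairErr_mono (b₁ b₂ : κ → Config N → ℝ) {G G' : (Fin 2 → Config N × Config N) → ℝ}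
    (h : ∀ ρ, G ρ ≤ G' ρ) : pairErr b₁ b₂ G ≤ pairErr b₁ b₂ G' :=
  nu_mono _ fun ρ => mul_le_mul_of_nonneg_left (h _) (sq_nonneg _)

lemma nu_dropTwo {S : Type*} [Fintype S] [Nonempty S] (c : κ → S → ℝ) {n : ℕ}
    (f : (Fin n → S) → ℝ) : nu c (fun ρ : Fin (n + 2) → S => f (dropTwo ρ)) = nu c f :=
  nu_comp_injective c (e := fun l : Fin n => l.castSucc.castSucc)
    (fun x y h => by simpa using h) f

lemma nu_le_pairErr (b₁ b₂ : κ → Config N → ℝ) {G : (Fin 2 → Config N × Config N) → ℝ}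
    (h : ∀ ρ, 0 ≤ G ρ) : nu (pairCoef b₁ b₂) G ≤ pairErr b₁ b₂ G := by
  rw [← nu_dropTwo _ G, ← nu_dropTwo _ fun ρ => G (dropTwo ρ)]
  refine nu_mono _ fun ρ => ?_
  have := one_le_pow₀ (n := 2) (one_le_pairTot (n := 5) ρ)
  exact le_mul_of_one_le_left (h _) this

lemma pairErr_nonneg (b₁ b₂ : κ → Config N → ℝ) {G : (Fin 2 → Config N × Config N) → ℝ}
    (h : ∀ ρ, 0 ≤ G ρ) : 0 ≤ pairErr b₁ b₂ G :=
  (nu_nonneg _ h).trans (nu_le_pairErr b₁ b₂ h)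

/-- The constant in the cavity expansions with two pairs. -/
def pairCst : ℝ :=
  cavCst 2 * Real.exp (cavCst 4 * 8) + cavCst 4 * cavCst 2 * Real.exp (cavCst 6 * 8)

lemma pairCst_nonneg : 0 ≤ pairCst := by
  have h2 := cavCst_nonneg 2
  have h4 := cavCst_nonneg 4
  unfold pairCst; positivity

lemma PairSystem.first_order (h : PairSystem N β t b₁ b₂ T) (hβ : β ^ 2 ≤ 1)
    (ht : t ∈ Set.Icc (0 : ℝ) 1) (i : Fin N) {f G : (Fin 2 → Config N × Config N) → ℝ} {a : ℝ}
    (ha : 0 ≤ a) (l : Fin 2) (hG : ∀ ρ, 0 ≤ G ρ) (hf : ∀ ρ, |f ρ| ≤ a * (pDom (ρ l) * G ρ)) :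
    |nu (pairCoef b₁ b₂) f - nu (coefS (pairCoef b₁ b₂) (T i) 0) f| ≤
      pairCst * (1 / √N * (a * pairErr b₁ b₂ G)) := by
  have hd := h.cavityData hβ ht i
  have h1 : nu (pairCoef b₁ b₂) (fun ρ : Fin (2 + 2) → Config N × Config N =>
      totKer (pairDom N) (pairDomDiag N) ρ * |f (dropTwo ρ)|) ≤ a * pairErr b₁ b₂ G := by
    rw [pairErr, ← nu_const_mul, ← nu_dropTwo]
    refine nu_mono _ fun ρ => ?_
    have e1 : totKer (pairDom N) (pairDomDiag N) (dropTwo ρ) ≤ pairTot ρ := hd.totKer_dropTwo_le ρ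
    have e0 : 0 ≤ totKer (pairDom N) (pairDomDiag N) (dropTwo ρ) := hd.totKer_nonneg _
    have e2 : pDom (dropTwo (dropTwo ρ) l) ≤ pairTot ρ := pDom_le_pairTot ρ _
    have e3 := hG (dropTwo (dropTwo ρ))
    have e4 : 0 ≤ pairTot ρ := e0.trans e1
    calc _ ≤ pairTot ρ * (a * (pairTot ρ * G (dropTwo (dropTwo ρ)))) := by
          refine mul_le_mul e1 ((hf _).trans ?_) (abs_nonneg _) e4
          gcongr
      _ = _ := by ring
  have h2 := cavCst_nonneg 2
  have h4 := cavCst_nonneg 4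
  refine (hd.abs_nu_sub_le f).trans ?_
  have h0 : 0 ≤ a * pairErr b₁ b₂ G := mul_nonneg ha (pairErr_nonneg _ _ hG)
  calc _ ≤ cavCst 2 * Real.exp (cavCst 4 * 8) * (1 / √N * (a * pairErr b₁ b₂ G)) := by gcongr
    _ ≤ _ := by
      refine mul_le_mul_of_nonneg_right ?_ (by positivity)
      unfold pairCst
      have : 0 ≤ cavCst 4 * cavCst 2 * Real.exp (cavCst 6 * 8) := by positivity
      linarith

lemma PairSystem.second_order (h : PairSystem N β t b₁ b₂ T) (hβ : β ^ 2 ≤ 1)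
    (ht : t ∈ Set.Icc (0 : ℝ) 1) (i : Fin N) {g : (Fin 2 → Config N × Config N) → ℝ}
    (hg : ∀ ρ l, g (Function.update ρ l (flipBoth i (ρ l))) = g ρ)
    (hg' : ∀ ρ l, g (Function.update ρ l (flipFst i (ρ l))) = g ρ) :
    |nu (pairCoef b₁ b₂) (fun ρ => √N * pSpin i (ρ 0) * g ρ) -
      β ^ 2 * t * nu (coefS (pairCoef b₁ b₂) (T i) 0) (fun ρ => pCav i (ρ 0) * g ρ)| ≤
      pairCst * (1 / √N * pairErr b₁ b₂ fun ρ => |g ρ|) := by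
  have hd := h.cavityData hβ ht i
  have hN : 0 < √(N : ℝ) := Real.sqrt_pos.2 (by exact_mod_cast i.pos)
  set f : (Fin 2 → Config N × Config N) → ℝ := fun ρ => √N * pSpin i (ρ 0) * g ρ with hf
  have z0 : nu (coefS (pairCoef b₁ b₂) (T i) 0) f = 0 :=
    nu_eq_zero_of_odd hd.inv' hd.coef_zero_inv' 0 fun ρ => by
      simp only [hf, hg', Function.update_self, pSpin_flipFst]; ring
  have z1 : nu (coefS (pairCoef b₁ b₂) (T i) 0)
      (cavOp (pairKer N β t i) (pairDiag N β t i) f) =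
      β ^ 2 * t * nu (coefS (pairCoef b₁ b₂) (T i) 0) (fun ρ => pCav i (ρ 0) * g ρ) := by
    rw [hd.nu_zero_cavOp]
    simp only [Fin.sum_univ_two, replKer, if_true, zero_ne_one, one_ne_zero, if_false]
    have a1 : nu (coefS (pairCoef b₁ b₂) (T i) 0)
        (fun ρ => f ρ * pairKer N β t i (ρ 0) (ρ 1)) = 0 :=
      hd.nu_zero_eq_zero 1 fun ρ => by
        simp only [hf, hg, Function.update_self]
        rw [Function.update_of_ne (by decide), pairKer_comm, hd.odd, pairKer_comm]; ring
    have a2 : nu (coefS (pairCoef b₁ b₂) (T i) 0)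
        (fun ρ => f ρ * pairKer N β t i (ρ 1) (ρ 0)) = 0 :=
      hd.nu_zero_eq_zero 1 fun ρ => by
        simp only [hf, hg, Function.update_self]
        rw [Function.update_of_ne (by decide), hd.odd]; ring
    have a3 : nu (coefS (pairCoef b₁ b₂) (T i) 0)
        (fun ρ => f ρ * pairDiag N β t i (ρ 1)) = 0 :=
      nu_eq_zero_of_odd hd.inv' hd.coef_zero_inv' 1 fun ρ => by
        simp only [hf, hg', Function.update_self]
        rw [Function.update_of_ne (by decide), hd.odd']; ring
    have a4 : nu (coefS (pairCoef b₁ b₂) (T i) 0)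
        (fun ρ => f ρ * pairDiag N β t i (ρ 0)) =
        2 * (β ^ 2 * t) * nu (coefS (pairCoef b₁ b₂) (T i) 0) (fun ρ => pCav i (ρ 0) * g ρ) := by
      rw [← nu_const_mul]
      congr 1
      ext ρ
      have := pSpin_mul_self i (ρ 0)
      simp only [hf, pairDiag, cavProd, pCav, scCav]
      simp only [pSpin] at this ⊢
      linear_combination (2 * β ^ 2 * t * √N * g ρ * ovCav N i (ρ 0).1 (ρ 0).2) * this
    rw [a1, a2, a3, a4]
    ring
  have h2 := cavCst_nonneg 2
  have h4 := cavCst_nonneg 4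
  have key := hd.abs_nu_sub_sub_le f
  rw [z0, z1, sub_zero] at key
  refine key.trans ?_
  have h0 : 0 ≤ pairErr b₁ b₂ fun ρ => |g ρ| := pairErr_nonneg _ _ fun _ => abs_nonneg _
  have e : (1 / √N) ^ 2 * nu (pairCoef b₁ b₂) (fun ρ : Fin (2 + 2 + 2) → Config N × Config N =>
      totKer (pairDom N) (pairDomDiag N) ρ ^ 2 * |f (dropTwo (dropTwo ρ))|) =
      1 / √N * pairErr b₁ b₂ fun ρ => |g ρ| := by
    have : ∀ ρ, |f ρ| = √N * |g ρ| := fun ρ => by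
      simp only [hf, abs_mul, abs_pSpin, abs_of_pos hN, mul_one]
    simp only [this, mul_left_comm _ √(N : ℝ)]
    rw [nu_const_mul, pairErr]
    field_simp
    rfl
  rw [e]
  refine mul_le_mul_of_nonneg_right ?_ (by positivity)
  unfold pairCst
  have : 0 ≤ cavCst 2 * Real.exp (cavCst 4 * 8) := by positivity
  simp only [Nat.reduceAdd]
  linarith

lemma PairSystem.expansion (h : PairSystem N β t b₁ b₂ T) (hβ : β ^ 2 ≤ 1)
    (ht : t ∈ Set.Icc (0 : ℝ) 1) (i : Fin N) {g : (Fin 2 → Config N × Config N) → ℝ}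
    (hg : ∀ ρ l, g (Function.update ρ l (flipBoth i (ρ l))) = g ρ)
    (hg' : ∀ ρ l, g (Function.update ρ l (flipFst i (ρ l))) = g ρ) :
    |nu (pairCoef b₁ b₂) (fun ρ => √N * pSpin i (ρ 0) * g ρ) -
      β ^ 2 * t * nu (pairCoef b₁ b₂) (fun ρ => pCav i (ρ 0) * g ρ)| ≤
      2 * pairCst * (1 / √N * pairErr b₁ b₂ fun ρ => |g ρ|) := by
  have h1 := h.second_order hβ ht i hg hg'
  have h2 := h.first_order hβ ht i (f := fun ρ => pCav i (ρ 0) * g ρ) (G := fun ρ => |g ρ|)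
    zero_le_one 0 (fun _ => abs_nonneg _) (fun ρ => by
      rw [abs_mul, one_mul]
      exact mul_le_mul_of_nonneg_right (abs_pCav_le i _) (abs_nonneg _))
  rw [one_mul] at h2
  have hbt : |β ^ 2 * t| ≤ 1 := by
    rw [abs_of_nonneg (mul_nonneg (sq_nonneg β) ht.1)]
    exact mul_le_one₀ hβ ht.1 ht.2
  have h3 : |β ^ 2 * t * (nu (pairCoef b₁ b₂) (fun ρ => pCav i (ρ 0) * g ρ) -
      nu (coefS (pairCoef b₁ b₂) (T i) 0) (fun ρ => pCav i (ρ 0) * g ρ))| ≤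
      pairCst * (1 / √N * pairErr b₁ b₂ fun ρ => |g ρ|) := by
    rw [abs_mul]
    exact (mul_le_of_le_one_left (abs_nonneg _) hbt).trans h2
  rw [abs_le] at *
  constructor <;> linarith

end PairCavity

section PairMoments

variable {κ : Type*} [Fintype κ] [DecidableEq κ] {N : ℕ} {β t : ℝ} {b₁ b₂ : κ → Config N → ℝ}
  {T : Fin N → Finset κ}

/-- The second moment of the overlap inside a pair. -/
def pairTwo (b₁ b₂ : κ → Config N → ℝ) : ℝ :=
  nu (pairCoef b₁ b₂) (fun ρ : Fin 2 → Config N × Config N => pOv (ρ 0) ^ 2)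

/-- The mixed fourth moment of the overlaps inside two pairs. -/
def pairFour (b₁ b₂ : κ → Config N → ℝ) : ℝ :=
  nu (pairCoef b₁ b₂) (fun ρ : Fin 2 → Config N × Config N => pOv (ρ 0) ^ 2 * pOv (ρ 1) ^ 2)

lemma nu_swap {S : Type*} [Fintype S] [Nonempty S] (c : κ → S → ℝ) (f : S → S → ℝ) :
    nu c (fun ρ : Fin 2 → S => f (ρ 1) (ρ 0)) = nu c (fun ρ : Fin 2 → S => f (ρ 0) (ρ 1)) := by
  have := nu_comp_injective c (e := ![(1 : Fin 2), 0])
    (by intro x y; fin_cases x <;> fin_cases y <;> simp) (fun ρ : Fin 2 → S => f (ρ 0) (ρ 1))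
  simpa using this

/-- The average over sites of the local terms reproduces the overlap. -/
lemma abs_nu_sub_le_of_sites (hN : 1 ≤ N) (c : κ → Config N × Config N → ℝ)
    (g : (Fin 2 → Config N × Config N) → ℝ) {z e : ℝ}
    (h : ∀ i, |nu c (fun ρ => √N * pSpin i (ρ 0) * g ρ) - z| ≤ e) :
    |nu c (fun ρ => pOv (ρ 0) * g ρ) - z| ≤ e := by
  have hN' : (0 : ℝ) < N := by exact_mod_cast hN
  have h1 : ∑ i : Fin N, (nu c (fun ρ => √N * pSpin i (ρ 0) * g ρ) - z) =
      N * (nu c (fun ρ => pOv (ρ 0) * g ρ) - z) := by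
    rw [Finset.sum_sub_distrib, ← nu_finset_sum, mul_sub, ← nu_const_mul]
    congr 1
    · congr 1
      ext ρ
      rw [← Finset.sum_mul]
      simp only [pSpin]
      rw [sum_spinProd hN, pOv, mul_assoc]
    · simp
  have h2 : |(N : ℝ) * (nu c (fun ρ => pOv (ρ 0) * g ρ) - z)| ≤ N * e := by
    rw [← h1]
    refine (Finset.abs_sum_le_sum_abs _ _).trans ?_
    refine (Finset.sum_le_sum fun i _ => h i).trans ?_
    simp
  rw [abs_mul, abs_of_pos hN'] at h2
  exact le_of_mul_le_mul_left h2 hN'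

lemma PairSystem.pairTwo_le (h : PairSystem N β t b₁ b₂ T) (hN : 1 ≤ N) (hβ : β ^ 2 ≤ 1)
    (ht : t ∈ Set.Icc (0 : ℝ) 1) :
    |(1 - β ^ 2 * t) * pairTwo b₁ b₂ - 1| ≤
      (4 * pairCst + 5) * (1 / √N * pairErr b₁ b₂ fun ρ => pDom (ρ 0)) := by
  have hs : 0 < √(N : ℝ) := Real.sqrt_pos.2 (by exact_mod_cast hN)
  have hK := pairCst_nonneg
  have hbt : |β ^ 2 * t| ≤ 1 := by
    rw [abs_of_nonneg (mul_nonneg (sq_nonneg β) ht.1)]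
    exact mul_le_one₀ hβ ht.1 ht.2
  set E := pairErr b₁ b₂ fun ρ => pDom (ρ 0) with hE
  have hd0 : ∀ ρ : Fin 2 → Config N × Config N, 0 ≤ pDom (ρ 0) := fun ρ =>
    zero_le_one.trans (one_le_pDom _)
  have hE0 : 0 ≤ E := pairErr_nonneg _ _ hd0
  have main := abs_nu_sub_le_of_sites hN (pairCoef b₁ b₂) (fun ρ => pOv (ρ 0))
    (z := 1 + β ^ 2 * t * pairTwo b₁ b₂) (e := (2 * pairCst + 2) * (1 / √N * E)) (fun i => by
      have h1 := h.expansion hβ ht i (g := fun ρ => pCav i (ρ 0))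
        (fun ρ l => by
          by_cases hl : l = 0
          · subst hl; simp only [Function.update_self, pCav_flipBoth]
          · rw [Function.update_of_ne (Ne.symm hl)])
        (fun ρ l => by
          by_cases hl : l = 0
          · subst hl; simp only [Function.update_self, pCav_flipFst]
          · rw [Function.update_of_ne (Ne.symm hl)])
      have h2 : (pairErr b₁ b₂ fun ρ => |pCav i (ρ 0)|) ≤ E :=
        pairErr_mono _ _ fun ρ => abs_pCav_le i _
      have h3 : nu (pairCoef b₁ b₂) (fun ρ : Fin 2 → Config N × Config N =>
          √N * pSpin i (ρ 0) * pOv (ρ 0)) = nu (pairCoef b₁ b₂)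
          (fun ρ : Fin 2 → Config N × Config N => √N * pSpin i (ρ 0) * pCav i (ρ 0)) + 1 := by
        conv_rhs => rw [← nu_const (pairCoef b₁ b₂) 2 1, ← nu_add]
        congr 1
        ext ρ
        rw [pOv_eq i, mul_add]
        congr 1
        rw [← pSpin_mul_self i (ρ 0)]
        field_simp
      have h4 : |pairTwo b₁ b₂ - nu (pairCoef b₁ b₂)
          (fun ρ : Fin 2 → Config N × Config N => pCav i (ρ 0) * pCav i (ρ 0))| ≤
          2 * (1 / √N * E) := by
        rw [pairTwo, ← nu_sub]
        refine (abs_nu_le _ _).trans ?_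
        have : nu (pairCoef b₁ b₂) (fun ρ : Fin 2 → Config N × Config N => 2 / √N * pDom (ρ 0)) ≤
            2 * (1 / √N * E) := by
          rw [nu_const_mul]
          have := nu_le_pairErr b₁ b₂ hd0
          rw [← hE] at this
          calc _ ≤ 2 / √N * E := by gcongr
            _ = _ := by ring
        refine (nu_mono _ fun ρ => ?_).trans this
        rw [← pow_two]
        exact abs_pOv_sq_sub_le i _
      have h5 : |β ^ 2 * t * (pairTwo b₁ b₂ - nu (pairCoef b₁ b₂)
          (fun ρ : Fin 2 → Config N × Config N => pCav i (ρ 0) * pCav i (ρ 0)))| ≤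
          2 * (1 / √N * E) := by
        rw [abs_mul]
        exact (mul_le_of_le_one_left (abs_nonneg _) hbt).trans h4
      have h6 : 2 * pairCst * (1 / √N * pairErr b₁ b₂ fun ρ => |pCav i (ρ 0)|) ≤
          2 * pairCst * (1 / √N * E) := by gcongr
      rw [h3]
      rw [abs_le] at *
      constructor <;> linarith)
  have e1 : nu (pairCoef b₁ b₂) (fun ρ : Fin 2 → Config N × Config N => pOv (ρ 0) * pOv (ρ 0)) =
      pairTwo b₁ b₂ := by
    rw [pairTwo]; congr 1; ext ρ; ring
  rw [e1] at main
  have e2 : 0 ≤ 1 / √N * E := by positivity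
  have e3 : 0 ≤ pairCst * (1 / √N * E) := by positivity
  rw [abs_le] at *
  constructor <;> linarith

lemma PairSystem.pairFour_le (h : PairSystem N β t b₁ b₂ T) (hN : 1 ≤ N) (hβ : β ^ 2 ≤ 1)
    (ht : t ∈ Set.Icc (0 : ℝ) 1) :
    |(1 - β ^ 2 * t) * pairFour b₁ b₂ - pairTwo b₁ b₂| ≤
      (4 * pairCst + 5) * (1 / √N * pairErr b₁ b₂ fun ρ => pDom (ρ 0) * pDom (ρ 1) ^ 2) := by
  have hs : 0 < √(N : ℝ) := Real.sqrt_pos.2 (by exact_mod_cast hN)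
  have hK := pairCst_nonneg
  have hbt : |β ^ 2 * t| ≤ 1 := by
    rw [abs_of_nonneg (mul_nonneg (sq_nonneg β) ht.1)]
    exact mul_le_one₀ hβ ht.1 ht.2
  set E := pairErr b₁ b₂ fun ρ => pDom (ρ 0) * pDom (ρ 1) ^ 2 with hE
  have hd : ∀ x : Config N × Config N, 0 ≤ pDom x := fun x =>
    zero_le_one.trans (one_le_pDom _)
  have hd0 : ∀ ρ : Fin 2 → Config N × Config N, 0 ≤ pDom (ρ 0) * pDom (ρ 1) ^ 2 := fun ρ =>
    mul_nonneg (hd _) (sq_nonneg _)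
  have hE0 : 0 ≤ E := pairErr_nonneg _ _ hd0
  have hEnu : nu (pairCoef b₁ b₂) (fun ρ : Fin 2 → Config N × Config N =>
      pDom (ρ 0) * pDom (ρ 1) ^ 2) ≤ E := nu_le_pairErr b₁ b₂ hd0
  have hEnu' : nu (pairCoef b₁ b₂) (fun ρ : Fin 2 → Config N × Config N =>
      pDom (ρ 1) * pDom (ρ 0) ^ 2) ≤ E := by
    rw [nu_swap _ fun x y => pDom x * pDom y ^ 2]; exact hEnu
  have hx : nu (pairCoef b₁ b₂) (fun ρ : Fin 2 → Config N × Config N => pOv (ρ 1) ^ 2) =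
      pairTwo b₁ b₂ := nu_swap _ fun x _ => pOv x ^ 2
  have main := abs_nu_sub_le_of_sites hN (pairCoef b₁ b₂) (fun ρ => pOv (ρ 0) * pOv (ρ 1) ^ 2)
    (z := pairTwo b₁ b₂ + β ^ 2 * t * pairFour b₁ b₂)
    (e := (4 * pairCst + 5) * (1 / √N * E)) (fun i => by
      have hd' := h.cavityData hβ ht i
      have h1 := h.expansion hβ ht i (g := fun ρ => pCav i (ρ 0) * pCav i (ρ 1) ^ 2)
        (fun ρ l => by
          fin_cases l <;> simp [Function.update_of_ne, pCav_flipBoth])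
        (fun ρ l => by
          fin_cases l <;> simp [Function.update_of_ne, pCav_flipFst])
      have h2 : (pairErr b₁ b₂ fun ρ => |pCav i (ρ 0) * pCav i (ρ 1) ^ 2|) ≤ E :=
        pairErr_mono _ _ fun ρ => by
          rw [abs_mul, abs_pow]
          exact mul_le_mul (abs_pCav_le i _) (pow_le_pow_left₀ (abs_nonneg _) (abs_pCav_le i _) 2)
            (by positivity) (hd _)
      have h3 : nu (pairCoef b₁ b₂) (fun ρ : Fin 2 → Config N × Config N =>
          √N * pSpin i (ρ 0) * (pOv (ρ 0) * pOv (ρ 1) ^ 2)) =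
          nu (pairCoef b₁ b₂) (fun ρ : Fin 2 → Config N × Config N =>
            √N * pSpin i (ρ 0) * (pCav i (ρ 0) * pCav i (ρ 1) ^ 2)) +
          (nu (pairCoef b₁ b₂) (fun ρ : Fin 2 → Config N × Config N =>
            2 * (pSpin i (ρ 0) * pSpin i (ρ 1) * pCav i (ρ 0) * pCav i (ρ 1))) +
          (nu (pairCoef b₁ b₂) (fun ρ : Fin 2 → Config N × Config N =>
            1 / √N * (pSpin i (ρ 0) * pCav i (ρ 0))) + pairTwo b₁ b₂)) := by
        rw [← hx, ← nu_add, ← nu_add, ← nu_add]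
        congr 1
        ext ρ
        have s0 := pSpin_mul_self i (ρ 0)
        have s1 := pSpin_mul_self i (ρ 1)
        have e0 : √N * pSpin i (ρ 0) * (pOv (ρ 0) * pOv (ρ 1) ^ 2) =
            √N * pSpin i (ρ 0) * pCav i (ρ 0) * pOv (ρ 1) ^ 2 + pOv (ρ 1) ^ 2 := by
          have : √N * pSpin i (ρ 0) * pOv (ρ 0) = √N * pSpin i (ρ 0) * pCav i (ρ 0) + 1 := by
            rw [pOv_eq i (ρ 0), ← s0]; field_simp
          linear_combination pOv (ρ 1) ^ 2 * this
        have e1 : √N * pOv (ρ 1) ^ 2 =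
            √N * pCav i (ρ 1) ^ 2 + 2 * pSpin i (ρ 1) * pCav i (ρ 1) + 1 / √N := by
          rw [pOv_eq i (ρ 1), ← s1]; field_simp; ring
        rw [e0]
        linear_combination pSpin i (ρ 0) * pCav i (ρ 0) * e1
      have h4 : |pairFour b₁ b₂ - nu (pairCoef b₁ b₂)
          (fun ρ : Fin 2 → Config N × Config N =>
            pCav i (ρ 0) * (pCav i (ρ 0) * pCav i (ρ 1) ^ 2))| ≤ 4 * (1 / √N * E) := by
        rw [pairFour, ← nu_sub]
        refine (abs_nu_le _ _).trans ?_
        have : nu (pairCoef b₁ b₂) (fun ρ : Fin 2 → Config N × Config N =>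
            2 / √N * (pDom (ρ 0) * pDom (ρ 1) ^ 2) + 2 / √N * (pDom (ρ 1) * pDom (ρ 0) ^ 2)) ≤
            4 * (1 / √N * E) := by
          rw [nu_add, nu_const_mul, nu_const_mul]
          calc _ ≤ 2 / √N * E + 2 / √N * E := by gcongr
            _ = _ := by ring
        refine (nu_mono _ fun ρ => ?_).trans this
        have a1 := abs_pOv_sq_sub_le i (ρ 0)
        have a2 := abs_pOv_sq_sub_le i (ρ 1)
        have b1 : pOv (ρ 1) ^ 2 ≤ pDom (ρ 1) ^ 2 := by
          rw [← sq_abs (pOv _)]; exact pow_le_pow_left₀ (abs_nonneg _) (abs_pOv_le _) 2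
        have b2 : pCav i (ρ 0) ^ 2 ≤ pDom (ρ 0) ^ 2 := by
          rw [← sq_abs (pCav _ _)]; exact pow_le_pow_left₀ (abs_nonneg _) (abs_pCav_le i _) 2
        have e0 : pOv (ρ 0) ^ 2 * pOv (ρ 1) ^ 2 -
            pCav i (ρ 0) * (pCav i (ρ 0) * pCav i (ρ 1) ^ 2) =
            (pOv (ρ 0) ^ 2 - pCav i (ρ 0) ^ 2) * pOv (ρ 1) ^ 2 +
              (pOv (ρ 1) ^ 2 - pCav i (ρ 1) ^ 2) * pCav i (ρ 0) ^ 2 := by ring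
        rw [e0]
        refine (abs_add_le _ _).trans ?_
        rw [abs_mul, abs_mul, abs_of_nonneg (sq_nonneg (pOv (ρ 1))),
          abs_of_nonneg (sq_nonneg (pCav i (ρ 0))), ← mul_assoc, ← mul_assoc]
        have c0 := hd (ρ 0)
        have c1 := hd (ρ 1)
        exact add_le_add (mul_le_mul a1 b1 (sq_nonneg _) (by positivity))
          (mul_le_mul a2 b2 (sq_nonneg _) (by positivity))
      have h5 : |β ^ 2 * t * (pairFour b₁ b₂ - nu (pairCoef b₁ b₂)
          (fun ρ : Fin 2 → Config N × Config N =>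
            pCav i (ρ 0) * (pCav i (ρ 0) * pCav i (ρ 1) ^ 2)))| ≤ 4 * (1 / √N * E) := by
        rw [abs_mul]
        exact (mul_le_of_le_one_left (abs_nonneg _) hbt).trans h4
      have h6 : 2 * pairCst * (1 / √N * pairErr b₁ b₂ fun ρ => |pCav i (ρ 0) * pCav i (ρ 1) ^ 2|) ≤
          2 * pairCst * (1 / √N * E) := by gcongr
      have h7 : |nu (pairCoef b₁ b₂) (fun ρ : Fin 2 → Config N × Config N =>
            1 / √N * (pSpin i (ρ 0) * pCav i (ρ 0)))| ≤ 1 / √N * E := by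
        rw [nu_const_mul, abs_mul, abs_of_pos (by positivity)]
        refine mul_le_mul_of_nonneg_left ?_ (by positivity)
        refine (abs_nu_le _ _).trans (le_trans (nu_mono _ fun ρ => ?_) hEnu)
        rw [abs_mul, abs_pSpin, one_mul]
        exact (abs_pCav_le i _).trans
          (le_mul_of_one_le_right (hd _) (one_le_pow₀ (one_le_pDom _)))
      have h8 : |nu (pairCoef b₁ b₂) (fun ρ : Fin 2 → Config N × Config N =>
            2 * (pSpin i (ρ 0) * pSpin i (ρ 1) * pCav i (ρ 0) * pCav i (ρ 1)))| ≤
          2 * pairCst * (1 / √N * E) := by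
        have z : nu (coefS (pairCoef b₁ b₂) (T i) 0) (fun ρ : Fin 2 → Config N × Config N =>
            2 * (pSpin i (ρ 0) * pSpin i (ρ 1) * pCav i (ρ 0) * pCav i (ρ 1))) = 0 :=
          nu_eq_zero_of_odd hd'.inv' hd'.coef_zero_inv' 0 fun ρ => by
            simp only [Function.update_self, pSpin_flipFst, pCav_flipFst]
            rw [Function.update_of_ne (by decide)]; ring
        have k := h.first_order hβ ht i (f := fun ρ =>
            2 * (pSpin i (ρ 0) * pSpin i (ρ 1) * pCav i (ρ 0) * pCav i (ρ 1)))
          (G := fun ρ => pDom (ρ 0) * pDom (ρ 1) ^ 2) zero_le_two 0 hd0 (fun ρ => by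
            rw [abs_mul, abs_mul, abs_mul, abs_mul, abs_pSpin, abs_pSpin, abs_two, one_mul, one_mul]
            refine mul_le_mul_of_nonneg_left ?_ zero_le_two
            refine mul_le_mul (abs_pCav_le i _) ((abs_pCav_le i _).trans ?_) (abs_nonneg _) (hd _)
            have c0 := one_le_pDom (ρ 0)
            have c1 := one_le_pDom (ρ 1)
            nlinarith)
        rw [z, sub_zero] at k
        refine k.trans (le_of_eq ?_)
        rw [← hE]; ring
      rw [h3]
      rw [abs_le] at *
      constructor <;> linarith)
  have e1 : nu (pairCoef b₁ b₂) (fun ρ : Fin 2 → Config N × Config N =>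
      pOv (ρ 0) * (pOv (ρ 0) * pOv (ρ 1) ^ 2)) = pairFour b₁ b₂ := by
    rw [pairFour]; congr 1; ext ρ; ring
  rw [e1] at main
  rw [abs_le] at *
  constructor <;> linarith

lemma pDom_sq_le (x : Config N × Config N) : pDom x ^ 2 ≤ 4 * (pOv x ^ 2 + 1) := by
  have := domOv_pow_le 1 x.1 x.2
  norm_num at this
  exact this

lemma nu_pDom_sq_le (b₁ b₂ : κ → Config N → ℝ) (l : Fin 2) :
    nu (pairCoef b₁ b₂) (fun ρ : Fin 2 → Config N × Config N => pDom (ρ l) ^ 2) ≤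
      4 * (pairTwo b₁ b₂ + 1) := by
  have h0 : nu (pairCoef b₁ b₂) (fun ρ : Fin 2 → Config N × Config N => pDom (ρ 0) ^ 2) ≤
      4 * (pairTwo b₁ b₂ + 1) := by
    refine (nu_mono _ fun ρ => pDom_sq_le _).trans ?_
    rw [nu_const_mul, nu_add, nu_const, pairTwo]
  fin_cases l
  · exact h0
  · exact (nu_swap _ fun x _ => pDom x ^ 2).le.trans h0

lemma nu_pDom_sq_mul_le (b₁ b₂ : κ → Config N → ℝ) :
    nu (pairCoef b₁ b₂) (fun ρ : Fin 2 → Config N × Config N =>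
      (pDom (ρ 0) * pDom (ρ 1)) ^ 2) ≤ 16 * (pairFour b₁ b₂ + 2 * pairTwo b₁ b₂ + 1) := by
  have hx : nu (pairCoef b₁ b₂) (fun ρ : Fin 2 → Config N × Config N => pOv (ρ 1) ^ 2) =
      pairTwo b₁ b₂ := nu_swap _ fun x _ => pOv x ^ 2
  have hpt : ∀ ρ : Fin 2 → Config N × Config N, (pDom (ρ 0) * pDom (ρ 1)) ^ 2 ≤
      16 * (pOv (ρ 0) ^ 2 * pOv (ρ 1) ^ 2 + (pOv (ρ 0) ^ 2 + (pOv (ρ 1) ^ 2 + 1))) := fun ρ => by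
    rw [mul_pow]
    refine (mul_le_mul (pDom_sq_le _) (pDom_sq_le _) (sq_nonneg _) (by positivity)).trans
      (le_of_eq ?_)
    ring
  refine (nu_mono _ hpt).trans (le_of_eq ?_)
  rw [nu_const_mul, nu_add, nu_add, nu_add, nu_const, hx, pairFour, pairTwo]
  ring

lemma sq_pairErr_le (b₁ b₂ : κ → Config N → ℝ) :
    (pairErr b₁ b₂ fun ρ => pDom (ρ 0)) ^ 2 ≤ 4 * (pairTwo b₁ b₂ + 1) *
      nu (pairCoef b₁ b₂) (fun ρ : Fin 6 → Config N × Config N => pairTot ρ ^ 4) := by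
  have h := nu_mul_sq_le (pairCoef b₁ b₂)
    (fun ρ : Fin (2 + 2 + 2) → Config N × Config N => pDom (dropTwo (dropTwo ρ) 0))
    (fun ρ => pairTot ρ ^ 2)
  have e : nu (pairCoef b₁ b₂) (fun ρ : Fin (2 + 2 + 2) → Config N × Config N =>
      pDom (dropTwo (dropTwo ρ) 0) ^ 2) ≤ 4 * (pairTwo b₁ b₂ + 1) := by
    rw [nu_dropTwo _ (fun ρ : Fin (2 + 2) → Config N × Config N => pDom (dropTwo ρ 0) ^ 2),
      nu_dropTwo _ (fun ρ : Fin 2 → Config N × Config N => pDom (ρ 0) ^ 2)]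
    exact nu_pDom_sq_le b₁ b₂ 0
  simp only [← pow_mul] at h
  simp only [pairErr, mul_comm (pairTot _ ^ 2)]
  refine h.trans (mul_le_mul_of_nonneg_right e (nu_nonneg _ fun ρ =>
    (by decide : Even (2 * 2)).pow_nonneg _))

lemma pow_pairErr_le (b₁ b₂ : κ → Config N → ℝ) :
    (pairErr b₁ b₂ fun ρ => pDom (ρ 0) * pDom (ρ 1) ^ 2) ^ 4 ≤
      (16 * (pairFour b₁ b₂ + 2 * pairTwo b₁ b₂ + 1)) ^ 2 * (4 * (pairTwo b₁ b₂ + 1) *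
      nu (pairCoef b₁ b₂) (fun ρ : Fin 6 → Config N × Config N => pairTot ρ ^ 10)) := by
  set r : (Fin (2 + 2 + 2) → Config N × Config N) → Fin 2 → Config N × Config N :=
    fun ρ => dropTwo (dropTwo ρ) with hr
  have hW : ∀ ρ l, pDom (r ρ l) ≤ pairTot ρ := fun ρ l => pDom_le_pairTot ρ _
  have hd : ∀ x : Config N × Config N, 0 ≤ pDom x := fun x =>
    zero_le_one.trans (one_le_pDom _)
  have hdrop : ∀ G : (Fin 2 → Config N × Config N) → ℝ,
      nu (pairCoef b₁ b₂) (fun ρ => G (r ρ)) = nu (pairCoef b₁ b₂) G := fun G => by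
    rw [← nu_dropTwo _ G, ← nu_dropTwo _ (fun ρ => G (dropTwo ρ))]
  have h1 := nu_mul_sq_le (pairCoef b₁ b₂) (fun ρ => pDom (r ρ 0) * pDom (r ρ 1))
    (fun ρ => pDom (r ρ 1) * pairTot ρ ^ 2)
  have h2 := nu_mul_sq_le (pairCoef b₁ b₂) (fun ρ => pDom (r ρ 1))
    (fun ρ => pDom (r ρ 1) * pairTot ρ ^ 4)
  have e1 : (pairErr b₁ b₂ fun ρ => pDom (ρ 0) * pDom (ρ 1) ^ 2) = nu (pairCoef b₁ b₂)
      (fun ρ => pDom (r ρ 0) * pDom (r ρ 1) * (pDom (r ρ 1) * pairTot ρ ^ 2)) := by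
    rw [pairErr]; congr 1; ext ρ; simp only [hr]; ring
  have e2 : nu (pairCoef b₁ b₂) (fun ρ => (pDom (r ρ 1) * pairTot ρ ^ 2) ^ 2) =
      nu (pairCoef b₁ b₂) (fun ρ => pDom (r ρ 1) * (pDom (r ρ 1) * pairTot ρ ^ 4)) := by
    congr 1; ext ρ; ring
  have e3 : nu (pairCoef b₁ b₂) (fun ρ => (pDom (r ρ 1) * pairTot ρ ^ 4) ^ 2) ≤
      nu (pairCoef b₁ b₂) (fun ρ : Fin 6 → Config N × Config N => pairTot ρ ^ 10) :=
    nu_mono _ fun ρ => by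
      have h0 := hd (r ρ 1)
      have h3 := pow_le_pow_left₀ h0 (hW ρ 1) 2
      calc _ = pDom (r ρ 1) ^ 2 * pairTot ρ ^ 8 := by ring
        _ ≤ pairTot ρ ^ 2 * pairTot ρ ^ 8 :=
          mul_le_mul_of_nonneg_right h3 ((by decide : Even 8).pow_nonneg _)
        _ = _ := by ring
  have e4 : nu (pairCoef b₁ b₂) (fun ρ => (pDom (r ρ 0) * pDom (r ρ 1)) ^ 2) ≤
      16 * (pairFour b₁ b₂ + 2 * pairTwo b₁ b₂ + 1) := by
    rw [hdrop fun ρ => (pDom (ρ 0) * pDom (ρ 1)) ^ 2]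
    exact nu_pDom_sq_mul_le b₁ b₂
  have e5 : nu (pairCoef b₁ b₂) (fun ρ => pDom (r ρ 1) ^ 2) ≤ 4 * (pairTwo b₁ b₂ + 1) := by
    rw [hdrop fun ρ => pDom (ρ 1) ^ 2]
    exact nu_pDom_sq_le b₁ b₂ 1
  rw [← e1, e2] at h1
  have p1 : 0 ≤ nu (pairCoef b₁ b₂) (fun ρ => (pDom (r ρ 0) * pDom (r ρ 1)) ^ 2) :=
    nu_nonneg _ fun ρ => sq_nonneg _
  have p2 : 0 ≤ nu (pairCoef b₁ b₂) (fun ρ => pDom (r ρ 1) ^ 2) :=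
    nu_nonneg _ fun ρ => sq_nonneg _
  have p3 : 0 ≤ nu (pairCoef b₁ b₂) (fun ρ => (pDom (r ρ 1) * pairTot ρ ^ 4) ^ 2) :=
    nu_nonneg _ fun ρ => sq_nonneg _
  calc _ = ((pairErr b₁ b₂ fun ρ => pDom (ρ 0) * pDom (ρ 1) ^ 2) ^ 2) ^ 2 := by ring
    _ ≤ _ := pow_le_pow_left₀ (sq_nonneg _) h1 2
    _ ≤ _ := by
      rw [mul_pow]
      exact mul_le_mul (pow_le_pow_left₀ p1 e4 2)
        (h2.trans (mul_le_mul e5 e3 p3 (p2.trans e5))) (sq_nonneg _) (sq_nonneg _)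

end PairMoments

/-- Absorption of a square root: `P ≤ E + K q` and `q² ≤ B P` bound `P`. -/
lemma le_of_le_add_of_sq_le {P E K q B : ℝ} (hB : 0 ≤ B) (hP : 0 ≤ P)
    (h : P ≤ E + K * q) (hq : q ^ 2 ≤ B * P) : P ≤ 2 * E + K ^ 2 * B := by
  have h1 : (K * q) ^ 2 ≤ ((P + K ^ 2 * B) / 2) ^ 2 := by
    nlinarith [sq_nonneg (P - K ^ 2 * B), mul_le_mul_of_nonneg_left hq (sq_nonneg K)]
  have h2 : K * q ≤ (P + K ^ 2 * B) / 2 := abs_le_of_sq_le_sq' h1 (by positivity) |>.2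
  linarith

lemma le_add_one_of_sq_le {q B : ℝ} (hB : 0 ≤ B) (hq : q ^ 2 ≤ B) : q ≤ B + 1 := by
  nlinarith [sq_nonneg (q - 1)]

set_option maxHeartbeats 1000000 in
/-- The numerical core: bounds on the second and the mixed fourth moment control the variance. -/
lemma exists_variance_bound {c₁ M K : ℝ} (hc₁ : 0 ≤ c₁) (hM : 0 ≤ M) (hK : 0 ≤ K) :
    ∃ L : ℝ, 0 ≤ L ∧ ∀ s u x y e₁ e₂ a m₄ m₁₀ : ℝ, 0 < s → s ≤ u → u ≤ 1 → 0 ≤ x → 0 ≤ y →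
      0 ≤ e₁ → 0 ≤ e₂ → 0 ≤ a → a ≤ c₁ * s ^ 6 → m₄ * s ^ 8 ≤ M → m₁₀ * s ^ 20 ≤ M →
      |u ^ 4 * x - 1| ≤ K * (a * e₁) → |u ^ 4 * y - x| ≤ K * (a * e₂) →
      e₁ ^ 2 ≤ 4 * (x + 1) * m₄ → e₂ ^ 4 ≤ (16 * (y + 2 * x + 1)) ^ 2 * (4 * (x + 1) * m₁₀) →
      y - 2 * x / u ^ 4 + 1 / u ^ 8 ≤ L * (a / (s ^ 5 * u ^ 9)) := by
  set B₁ := 4 * M with hB₁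
  set C₁ := 2 * 2 + (K * c₁) ^ 2 * B₁ with hC₁
  set D₁ := B₁ * C₁ + 1 with hD₁
  set B₂ := 1024 * M * C₁ with hB₂
  set C₂ := 2 * (3 * C₁ + 1) + (K * c₁) ^ 2 * (B₂ + 1) with hC₂
  set D₂ := (B₂ + 1) * C₂ + 1 with hD₂
  have hC₁0 : 0 ≤ C₁ := by positivity
  have hC₂0 : 0 ≤ C₂ := by positivity
  refine ⟨K * (D₁ + D₂), by positivity, ?_⟩
  intro s u x y e₁ e₂ a m₄ m₁₀ hs hsu hu1 hx hy he₁ he₂ ha has hm₄ hm₁₀ h1 h2 h3 h4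
  have hu : 0 < u := hs.trans_le hsu
  have hs1 : s ≤ 1 := hsu.trans hu1
  have hu4 : u ^ 4 ≤ 1 := pow_le_one₀ hu.le hu1
  have hs4 : s ^ 4 ≤ u ^ 4 := pow_le_pow_left₀ hs.le hsu 4
  -- second moment
  have k1 : (s ^ 4 * e₁) ^ 2 ≤ B₁ * (x + 1) := by
    calc (s ^ 4 * e₁) ^ 2 = s ^ 8 * e₁ ^ 2 := by ring
      _ ≤ s ^ 8 * (4 * (x + 1) * m₄) := by gcongr
      _ = 4 * (x + 1) * (m₄ * s ^ 8) := by ring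
      _ ≤ 4 * (x + 1) * M := by gcongr
      _ = _ := by rw [hB₁]; ring
  have P1 : u ^ 4 * (x + 1) ≤ C₁ := by
    refine le_of_le_add_of_sq_le (q := s ^ 6 * e₁) (by positivity) (by positivity) ?_ ?_
    · have : K * (a * e₁) ≤ K * c₁ * (s ^ 6 * e₁) := by
        calc K * (a * e₁) ≤ K * (c₁ * s ^ 6 * e₁) := by gcongr
          _ = _ := by ring
      have := (abs_le.1 h1).2
      linarith
    · calc (s ^ 6 * e₁) ^ 2 = s ^ 4 * (s ^ 4 * e₁) ^ 2 := by ring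
        _ ≤ u ^ 4 * (B₁ * (x + 1)) := by gcongr
        _ = _ := by ring
  have q1 : s ^ 4 * u ^ 2 * e₁ ≤ D₁ := by
    refine le_add_one_of_sq_le (by positivity) ?_
    calc (s ^ 4 * u ^ 2 * e₁) ^ 2 = u ^ 4 * (s ^ 4 * e₁) ^ 2 := by ring
      _ ≤ u ^ 4 * (B₁ * (x + 1)) := by gcongr
      _ = B₁ * (u ^ 4 * (x + 1)) := by ring
      _ ≤ _ := by gcongr
  -- fourth moment
  have k2 : (s ^ 5 * u ^ 5 * e₂) ^ 4 ≤ B₂ * (u ^ 8 * (y + 2 * x + 1)) ^ 2 := by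
    calc (s ^ 5 * u ^ 5 * e₂) ^ 4 = u ^ 20 * s ^ 20 * e₂ ^ 4 := by ring
      _ ≤ u ^ 20 * s ^ 20 * ((16 * (y + 2 * x + 1)) ^ 2 * (4 * (x + 1) * m₁₀)) := by gcongr
      _ = 1024 * (m₁₀ * s ^ 20) * (u ^ 4 * (x + 1)) * (u ^ 8 * (y + 2 * x + 1)) ^ 2 := by ring
      _ ≤ 1024 * M * C₁ * (u ^ 8 * (y + 2 * x + 1)) ^ 2 := by gcongr
      _ = _ := by rw [hB₂]
  have k3 : (s ^ 5 * u ^ 5 * e₂) ^ 2 ≤ (B₂ + 1) * (u ^ 8 * (y + 2 * x + 1)) := by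
    refine abs_le_of_sq_le_sq' ?_ (by positivity) |>.2
    have h0 : 0 ≤ B₂ := by positivity
    calc ((s ^ 5 * u ^ 5 * e₂) ^ 2) ^ 2 = (s ^ 5 * u ^ 5 * e₂) ^ 4 := by ring
      _ ≤ _ := k2
      _ ≤ (B₂ + 1) ^ 2 * (u ^ 8 * (y + 2 * x + 1)) ^ 2 := by
        refine mul_le_mul_of_nonneg_right ?_ (sq_nonneg _)
        nlinarith
      _ = _ := by ring
  have P2 : u ^ 8 * (y + 2 * x + 1) ≤ C₂ := by
    refine le_of_le_add_of_sq_le (q := s ^ 5 * u ^ 5 * e₂) (by positivity) (by positivity) ?_ k3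
    have e : K * (a * e₂) * u ^ 4 ≤ K * c₁ * (s ^ 5 * u ^ 5 * e₂) := by
      calc K * (a * e₂) * u ^ 4 ≤ K * (c₁ * s ^ 6 * e₂) * u ^ 4 := by gcongr
        _ = K * c₁ * (s ^ 5 * u ^ 4 * e₂) * s := by ring
        _ ≤ K * c₁ * (s ^ 5 * u ^ 4 * e₂) * u := by gcongr
        _ = _ := by ring
    have e' : (u ^ 4 * y - x) * u ^ 4 ≤ K * (a * e₂) * u ^ 4 :=
      mul_le_mul_of_nonneg_right (abs_le.1 h2).2 (by positivity)
    have e3 : u ^ 4 * x ≤ C₁ :=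
      (mul_le_mul_of_nonneg_left (by linarith) (by positivity)).trans P1
    have e4 : u ^ 4 * (u ^ 4 * x) ≤ u ^ 4 * x := mul_le_of_le_one_left (by positivity) hu4
    have e5 : u ^ 8 ≤ 1 := pow_le_one₀ hu.le hu1
    calc u ^ 8 * (y + 2 * x + 1) = (u ^ 4 * y - x) * u ^ 4 + u ^ 4 * x +
          2 * (u ^ 4 * (u ^ 4 * x)) + u ^ 8 := by ring
      _ ≤ _ := by linarith
  have q2 : s ^ 5 * u ^ 5 * e₂ ≤ D₂ :=
    le_add_one_of_sq_le (by positivity) (k3.trans (by gcongr))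
  -- conclusion
  have r1 : -(u ^ 4 * x - 1) / u ^ 8 ≤ K * D₁ * (a / (s ^ 5 * u ^ 9)) := by
    have : -(u ^ 4 * x - 1) ≤ K * (a * e₁) := by linarith [(abs_le.1 h1).1]
    calc -(u ^ 4 * x - 1) / u ^ 8 ≤ K * (a * e₁) / u ^ 8 := by gcongr
      _ = K * (s ^ 4 * u ^ 2 * e₁) * (a / (s ^ 5 * u ^ 9)) * (s / u) := by field_simp
      _ ≤ K * (s ^ 4 * u ^ 2 * e₁) * (a / (s ^ 5 * u ^ 9)) * 1 := by
        gcongr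
        exact (div_le_one hu).2 hsu
      _ ≤ K * D₁ * (a / (s ^ 5 * u ^ 9)) * 1 := by gcongr
      _ = _ := mul_one _
  have r2 : (u ^ 4 * y - x) / u ^ 4 ≤ K * D₂ * (a / (s ^ 5 * u ^ 9)) := by
    have := (abs_le.1 h2).2
    calc (u ^ 4 * y - x) / u ^ 4 ≤ K * (a * e₂) / u ^ 4 := by gcongr
      _ = K * (s ^ 5 * u ^ 5 * e₂) * (a / (s ^ 5 * u ^ 9)) := by field_simp
      _ ≤ _ := by gcongr
  calc y - 2 * x / u ^ 4 + 1 / u ^ 8 = (u ^ 4 * y - x) / u ^ 4 + -(u ^ 4 * x - 1) / u ^ 8 := by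
        field_simp; ring
    _ ≤ _ := add_le_add r2 r1
    _ = _ := by ring

lemma nu_pairTot_pow_le {c₀ : ℝ} (hc₀ : 0 < c₀) (k : ℕ) (hk : k ≤ 5) (hk0 : k ≠ 0) :
    ∃ C : ℝ, 0 ≤ C ∧ ∀ (κ : Type) [Fintype κ] [DecidableEq κ] (N : ℕ) (β t : ℝ)
      (b₁ b₂ : κ → Config N → ℝ) (T : Fin N → Finset κ), PairSystem N β t b₁ b₂ T → 1 ≤ N →
      0 < 1 - β ^ 2 → c₀ ≤ N * (1 - β ^ 2) ^ 3 →
      nu (pairCoef b₁ b₂) (fun ρ : Fin 6 → Config N × Config N => pairTot ρ ^ (2 * k)) *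
        (1 - β ^ 2) ^ k ≤ C := by
  obtain ⟨C, hC, h⟩ := exists_ovMom_le hc₀ k hk
  set A : ℝ := (6 * 6) ^ (2 * k) * (6 * 6) * (4 ^ (2 * k + 1) * 2 ^ (2 * k)) with hA
  refine ⟨A * (C + 1), by positivity, ?_⟩
  intro κ _ _ N β t b₁ b₂ T hp hN hδ hNδ
  have hδk : 0 < (1 - β ^ 2) ^ k := pow_pos hδ k
  have h1 : ovMom N b₁ (2 * k) ≤ C / (1 - β ^ 2) ^ k := by
    rw [le_div_iff₀ hδk]; exact h κ N β b₁ T hp.fst hN hδ hNδ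
  have h2 : ovMom N b₂ (2 * k) ≤ C / (1 - β ^ 2) ^ k := by
    rw [le_div_iff₀ hδk]; exact h κ N β b₂ T hp.snd hN hδ hNδ
  have h3 := nu_totKer_pair_le b₁ b₂ k 6 hk0 h1 h2
  have h4 : (1 - β ^ 2) ^ k ≤ 1 := pow_le_one₀ hδ.le (by nlinarith [sq_nonneg β])
  calc _ ≤ _ := mul_le_mul_of_nonneg_right h3 hδk.le
    _ = A * (C + (1 - β ^ 2) ^ k) := by rw [hA]; push_cast; field_simp
    _ ≤ _ := by gcongr

theorem exists_pair_bound {c₀ : ℝ} (hc₀ : 0 < c₀) :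
    ∃ L : ℝ, 0 ≤ L ∧ ∀ (κ : Type) [Fintype κ] [DecidableEq κ] (N : ℕ) (β t : ℝ)
      (b₁ b₂ : κ → Config N → ℝ) (T : Fin N → Finset κ), PairSystem N β t b₁ b₂ T → 1 ≤ N →
      0 < 1 - β ^ 2 → t ∈ Set.Icc (0 : ℝ) 1 → c₀ ≤ N * (1 - β ^ 2) ^ 3 →
      pairFour b₁ b₂ - 2 * pairTwo b₁ b₂ / (1 - β ^ 2 * t) + 1 / (1 - β ^ 2 * t) ^ 2 ≤
        L * (N : ℝ) ^ (-(1 : ℝ) / 2) * (1 - β ^ 2) ^ (-(4 : ℝ) / 3) *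
          (1 - β ^ 2 * t) ^ (-(13 : ℝ) / 6) := by
  obtain ⟨C₄, hC₄, h₄⟩ := nu_pairTot_pow_le hc₀ 2 (by norm_num) (by norm_num)
  obtain ⟨C₁₀, hC₁₀, h₁₀⟩ := nu_pairTot_pow_le hc₀ 5 (by norm_num) (by norm_num)
  have hK := pairCst_nonneg
  obtain ⟨L, hL, hLb⟩ := exists_variance_bound (c₁ := 1 / √c₀) (M := C₄ + C₁₀)
    (K := 4 * pairCst + 5) (by positivity) (by positivity) (by positivity)
  refine ⟨L, hL, ?_⟩
  intro κ _ _ N β t b₁ b₂ T hp hN hδ ht hNδ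
  have hβ : β ^ 2 ≤ 1 := by linarith
  have hN0 : (0 : ℝ) < N := by exact_mod_cast hN
  have hδt : 1 - β ^ 2 ≤ 1 - β ^ 2 * t := by nlinarith [sq_nonneg β, ht.2]
  have hδt0 : 0 < 1 - β ^ 2 * t := hδ.trans_le hδt
  have hδt1 : 1 - β ^ 2 * t ≤ 1 := by nlinarith [sq_nonneg β, ht.1, mul_nonneg (sq_nonneg β) ht.1]
  set δ := 1 - β ^ 2 with hδd
  set δ' := 1 - β ^ 2 * t with hδ'd
  set s := δ ^ ((1 : ℝ) / 4) with hs
  set u := δ' ^ ((1 : ℝ) / 4) with hu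
  have hsp : ∀ n : ℕ, s ^ n = δ ^ ((n : ℝ) / 4) := fun n => by
    rw [hs, ← Real.rpow_natCast, ← Real.rpow_mul hδ.le]; congr 1; ring
  have hup : ∀ n : ℕ, u ^ n = δ' ^ ((n : ℝ) / 4) := fun n => by
    rw [hu, ← Real.rpow_natCast, ← Real.rpow_mul hδt0.le]; congr 1; ring
  have hs0 : 0 < s := Real.rpow_pos_of_pos hδ _
  have hu0 : 0 < u := Real.rpow_pos_of_pos hδt0 _
  have hsu : s ≤ u := Real.rpow_le_rpow hδ.le hδt (by norm_num)
  have hu1 : u ≤ 1 := Real.rpow_le_one hδt0.le hδt1 (by norm_num)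
  have hs4 : s ^ 4 = δ := by rw [hsp]; norm_num
  have hu4 : u ^ 4 = δ' := by rw [hup]; norm_num
  have ha : 1 / √(N : ℝ) ≤ 1 / √c₀ * s ^ 6 := by
    have h1 : √c₀ ≤ √(N : ℝ) * s ^ 6 := by
      rw [← Real.sqrt_sq (by positivity : 0 ≤ s ^ 6), ← Real.sqrt_mul hN0.le]
      refine Real.sqrt_le_sqrt (hNδ.trans (le_of_eq ?_))
      rw [← hs4]; ring
    have h2 : 0 < √c₀ := Real.sqrt_pos.2 hc₀
    have h3 : 0 < √(N : ℝ) := Real.sqrt_pos.2 hN0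
    rw [div_mul_eq_mul_div, one_mul, div_le_div_iff₀ h3 h2]
    linarith
  have hd : ∀ x : Config N × Config N, 0 ≤ pDom x := fun x =>
    zero_le_one.trans (one_le_pDom _)
  have b := hLb s u (pairTwo b₁ b₂) (pairFour b₁ b₂) (pairErr b₁ b₂ fun ρ => pDom (ρ 0))
    (pairErr b₁ b₂ fun ρ => pDom (ρ 0) * pDom (ρ 1) ^ 2) (1 / √N)
    (nu (pairCoef b₁ b₂) (fun ρ : Fin 6 → Config N × Config N => pairTot ρ ^ 4))
    (nu (pairCoef b₁ b₂) (fun ρ : Fin 6 → Config N × Config N => pairTot ρ ^ 10))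
    hs0 hsu hu1 (nu_nonneg _ fun ρ => sq_nonneg _)
    (nu_nonneg _ fun ρ => mul_nonneg (sq_nonneg _) (sq_nonneg _))
    (pairErr_nonneg _ _ fun ρ => hd _)
    (pairErr_nonneg _ _ fun ρ => mul_nonneg (hd _) (sq_nonneg _)) (by positivity) ha
    (by
      have := h₄ κ N β t b₁ b₂ T hp hN hδ hNδ
      rw [← hδd, ← hs4, ← pow_mul] at this
      norm_num at this
      linarith)
    (by
      have := h₁₀ κ N β t b₁ b₂ T hp hN hδ hNδ
      rw [← hδd, ← hs4, ← pow_mul] at this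
      norm_num at this
      linarith)
    (by rw [hu4]; exact hp.pairTwo_le hN hβ ht) (by rw [hu4]; exact hp.pairFour_le hN hβ ht)
    (sq_pairErr_le b₁ b₂) (pow_pairErr_le b₁ b₂)
  have hu8 : u ^ 8 = δ' ^ 2 := by rw [← hu4]; ring
  rw [hu4, hu8] at b
  refine b.trans ?_
  rw [mul_assoc, mul_assoc]
  refine mul_le_mul_of_nonneg_left ?_ hL
  have ea : 1 / √(N : ℝ) = (N : ℝ) ^ (-(1 : ℝ) / 2) := by
    rw [Real.sqrt_eq_rpow, neg_div, Real.rpow_neg hN0.le, one_div]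
  rw [div_eq_mul_inv, ea]
  refine mul_le_mul_of_nonneg_left ?_ (by positivity)
  have e5 : (s ^ 5)⁻¹ = δ ^ (-(4 : ℝ) / 3) * δ ^ ((1 : ℝ) / 12) := by
    rw [hsp, ← Real.rpow_neg hδ.le, ← Real.rpow_add hδ]; norm_num
  have e9 : δ' ^ (-(13 : ℝ) / 6) = (u ^ 9)⁻¹ * δ' ^ ((1 : ℝ) / 12) := by
    rw [hup, ← Real.rpow_neg hδt0.le, ← Real.rpow_add hδt0]; norm_num
  rw [mul_inv, e5, e9]
  have e12 : δ ^ ((1 : ℝ) / 12) ≤ δ' ^ ((1 : ℝ) / 12) := Real.rpow_le_rpow hδ.le hδt (by norm_num)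
  calc _ ≤ δ ^ (-(4 : ℝ) / 3) * δ' ^ ((1 : ℝ) / 12) * (u ^ 9)⁻¹ := by gcongr
    _ = _ := by ring

section Concrete

variable {N : ℕ} {β t : ℝ}

/-- The coefficient of the coupling `g_p` in the SK Hamiltonian. -/
def edgeCoef (N : ℕ) (β : ℝ) (p : Fin N × Fin N) (σ : Config N) : ℝ :=
  if p.1 < p.2 then β / √N * (spin (σ p.1) * spin (σ p.2)) else 0

lemma linH_edgeCoef (g : Fin N × Fin N → ℝ) (σ : Config N) :
    ∑ p, edgeCoef N β p σ * g p = ham N β g σ := by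
  rw [ham, Finset.sum_filter, Finset.mul_sum]
  refine Finset.sum_congr rfl fun p _ => ?_
  unfold edgeCoef
  split_ifs <;> ring

lemma edgeCoef_mul (p : Fin N × Fin N) (σ τ : Config N) :
    edgeCoef N β p σ * edgeCoef N β p τ =
      β ^ 2 / N * (if p.1 < p.2 then spinProd p.1 σ τ * spinProd p.2 σ τ else 0) := by
  unfold edgeCoef spinProd
  split_ifs
  · have h : β ^ 2 / (N : ℝ) = β / √N * (β / √N) := by
      rw [div_mul_div_comm, Real.mul_self_sqrt (by positivity), pow_two]
    rw [h]
    ring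
  · simp

lemma sum_edgeCoef_mul (hN : 1 ≤ N) (σ τ : Config N) :
    ∑ p, edgeCoef N β p σ * edgeCoef N β p τ = β ^ 2 / 2 * (N * ovlp N σ τ ^ 2 - 1) := by
  have hN0 : (N : ℝ) ≠ 0 := by positivity
  set z : Fin N → ℝ := fun j => spinProd j σ τ with hz
  have hsq : (∑ j, z j) ^ 2 = ∑ p : Fin N × Fin N, z p.1 * z p.2 := by
    rw [pow_two, Finset.sum_mul_sum, Fintype.sum_prod_type]
  have hsplit : ∀ p : Fin N × Fin N, z p.1 * z p.2 =
      (if p.1 < p.2 then z p.1 * z p.2 else 0) + (if p.2 < p.1 then z p.2 * z p.1 else 0) +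
        (if p.1 = p.2 then 1 else 0) := by
    rintro ⟨i, j⟩
    rcases lt_trichotomy i j with h | h | h
    · simp [h, h.not_gt, h.ne]
    · subst h; simp [hz, spinProd_mul_self]
    · simp [h, h.not_gt, h.ne', mul_comm]
  have hswap : ∑ p : Fin N × Fin N, (if p.2 < p.1 then z p.2 * z p.1 else 0) =
      ∑ p : Fin N × Fin N, (if p.1 < p.2 then z p.1 * z p.2 else 0) :=
    (Equiv.prodComm (Fin N) (Fin N)).sum_comp
      (fun p : Fin N × Fin N => if p.1 < p.2 then z p.1 * z p.2 else 0)
  have hdiag : ∑ p : Fin N × Fin N, (if p.1 = p.2 then (1 : ℝ) else 0) = N := by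
    rw [Fintype.sum_prod_type]; simp
  have htot : (∑ j, z j) ^ 2 =
      2 * ∑ p : Fin N × Fin N, (if p.1 < p.2 then z p.1 * z p.2 else 0) + N := by
    rw [hsq, Finset.sum_congr rfl fun p _ => hsplit p, Finset.sum_add_distrib,
      Finset.sum_add_distrib, hswap, hdiag]
    ring
  have hov : ∑ j, z j = N * ovlp N σ τ := by
    rw [ovlp]; field_simp; rfl
  simp only [edgeCoef_mul]
  rw [← Finset.mul_sum]
  rw [hov] at htot
  have : ∑ p : Fin N × Fin N, (if p.1 < p.2 then z p.1 * z p.2 else 0) =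
      ((N * ovlp N σ τ) ^ 2 - N) / 2 := by linarith
  simp only [hz] at this
  rw [this]
  field_simp

lemma sum_edgeCoef_site (i : Fin N) (σ τ : Config N) :
    ∑ p : Fin N × Fin N, (if p.1 = i ∨ p.2 = i then edgeCoef N β p σ * edgeCoef N β p τ else 0) =
      β ^ 2 * (spinProd i σ τ * ovCav N i σ τ) := by
  set z : Fin N → ℝ := fun j => spinProd j σ τ with hz
  have h1 : ∀ p : Fin N × Fin N,
      (if p.1 = i ∨ p.2 = i then edgeCoef N β p σ * edgeCoef N β p τ else 0) =
      β ^ 2 / N * ((if p.1 = i then (if i < p.2 then z i * z p.2 else 0) else 0) +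
        (if p.2 = i then (if p.1 < i then z i * z p.1 else 0) else 0)) := by
    rintro ⟨j, k⟩
    rw [edgeCoef_mul]
    by_cases hj : j = i
    · subst hj
      by_cases hk : k = j
      · subst hk; simp
      · simp [hk, hz]
    · by_cases hk : k = i
      · subst hk; simp [hj, hz, mul_comm]
      · simp [hj, hk]
  have h2 : ∑ p : Fin N × Fin N, (if p.1 = i then (if i < p.2 then z i * z p.2 else 0) else 0) =
      ∑ j, (if i < j then z i * z j else 0) := by
    rw [Fintype.sum_prod_type_right]; simp
  have h3 : ∑ p : Fin N × Fin N, (if p.2 = i then (if p.1 < i then z i * z p.1 else 0) else 0) =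
      ∑ j, (if j < i then z i * z j else 0) := by
    rw [Fintype.sum_prod_type]; simp
  rw [Finset.sum_congr rfl fun p _ => h1 p, ← Finset.mul_sum, Finset.sum_add_distrib, h2, h3,
    ← Finset.sum_add_distrib]
  have h4 : ∑ j, ((if i < j then z i * z j else 0) + (if j < i then z i * z j else 0)) =
      z i * ∑ j ∈ univ.erase i, z j := by
    rw [← Finset.sum_erase_add _ _ (mem_univ i), Finset.mul_sum]
    simp only [lt_irrefl, if_false, add_zero]
    refine Finset.sum_congr rfl fun j hj => ?_
    rcases lt_or_gt_of_ne (Finset.ne_of_mem_erase hj) with h | h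
    · simp [h, h.not_gt]
    · simp [h, h.not_gt]
  rw [h4, ovCav]
  simp only [hz]
  have : ∑ j ∈ univ.erase i, spinProd j σ τ = ∑ j ∈ univ.erase i, spin (σ j) * spin (τ j) := rfl
  rw [this]
  ring

lemma edgeCoef_flip {i : Fin N} {p : Fin N × Fin N} (hp : ¬(p.1 = i ∨ p.2 = i)) (σ : Config N) :
    edgeCoef N β p (flipAt i σ) = edgeCoef N β p σ := by
  rw [not_or] at hp
  simp [edgeCoef, flipAt, Function.update_of_ne hp.1, Function.update_of_ne hp.2]

/-- The index set of the three independent disorders. -/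
abbrev TriEdge (N : ℕ) := (Fin N × Fin N) ⊕ ((Fin N × Fin N) ⊕ (Fin N × Fin N))

/-- The edge underlying a coupling. -/
def TriEdge.edge : TriEdge N → Fin N × Fin N := Sum.elim id (Sum.elim id id)

/-- The coefficients of the first interpolated Hamiltonian. -/
def triFst (N : ℕ) (β t : ℝ) : TriEdge N → Config N → ℝ :=
  Sum.elim (fun p σ => √t * edgeCoef N β p σ)
    (Sum.elim (fun p σ => √(1 - t) * edgeCoef N β p σ) (fun _ _ => 0))

/-- The coefficients of the second interpolated Hamiltonian. -/
def triSnd (N : ℕ) (β t : ℝ) : TriEdge N → Config N → ℝ :=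
  Sum.elim (fun p σ => √t * edgeCoef N β p σ)
    (Sum.elim (fun _ _ => 0) (fun p σ => √(1 - t) * edgeCoef N β p σ))

/-- The couplings involving the site `i`. -/
def triSite (N : ℕ) (i : Fin N) : Finset (TriEdge N) :=
  univ.filter fun k => k.edge.1 = i ∨ k.edge.2 = i

lemma mem_triSite {i : Fin N} {k : TriEdge N} :
    k ∈ triSite N i ↔ k.edge.1 = i ∨ k.edge.2 = i := by
  rw [triSite, Finset.mem_filter]
  exact and_iff_right (Finset.mem_univ k)

lemma sum_triSite (i : Fin N) (F : TriEdge N → ℝ) :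
    ∑ k ∈ triSite N i, F k =
      ∑ p : Fin N × Fin N, (if p.1 = i ∨ p.2 = i then F (Sum.inl p) else 0) +
        (∑ p : Fin N × Fin N, (if p.1 = i ∨ p.2 = i then F (Sum.inr (Sum.inl p)) else 0) +
          ∑ p : Fin N × Fin N, (if p.1 = i ∨ p.2 = i then F (Sum.inr (Sum.inr p)) else 0)) := by
  rw [triSite, Finset.sum_filter, Fintype.sum_sum_type, Fintype.sum_sum_type]
  rfl

lemma triPairSystem (hN : 1 ≤ N) (ht : t ∈ Set.Icc (0 : ℝ) 1) :
    PairSystem N β t (triFst N β t) (triSnd N β t) (triSite N) := by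
  have h1 : √t * √t = t := Real.mul_self_sqrt ht.1
  have h2 : √(1 - t) * √(1 - t) = 1 - t := Real.mul_self_sqrt (by linarith [ht.2])
  have e1 : ∀ x y : ℝ, √t * x * (√t * y) = t * (x * y) := fun x y => by
    rw [mul_mul_mul_comm, h1]
  have e2 : ∀ x y : ℝ, √(1 - t) * x * (√(1 - t) * y) = (1 - t) * (x * y) := fun x y => by
    rw [mul_mul_mul_comm, h2]
  have e3 : ∀ (q : Prop) [Decidable q] (a x y : ℝ), (if q then a * (x * y) else 0) =
      a * (if q then x * y else 0) := fun q _ a x y => by split_ifs <;> simp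
  refine ⟨⟨fun σ τ => ?_, fun i σ τ => ?_, fun i k hk σ => ?_⟩,
    ⟨fun σ τ => ?_, fun i σ τ => ?_, fun i k hk σ => ?_⟩, fun i σ τ => ?_⟩
  · simp only [triFst, Fintype.sum_sum_type, Sum.elim_inl, Sum.elim_inr, e1, e2, ← Finset.mul_sum,
      sum_edgeCoef_mul hN, mul_zero, Finset.sum_const_zero]
    ring
  · rw [sum_triSite]
    simp only [triFst, Sum.elim_inl, Sum.elim_inr, e1, e2, e3, ← Finset.mul_sum, sum_edgeCoef_site, mul_zero, ite_self,
      Finset.sum_const_zero]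
    ring
  · rw [mem_triSite] at hk
    rcases k with p | p | p
    · exact congrArg (√t * ·) (edgeCoef_flip (p := p) hk σ)
    · exact congrArg (√(1 - t) * ·) (edgeCoef_flip (p := p) hk σ)
    · rfl
  · simp only [triSnd, Fintype.sum_sum_type, Sum.elim_inl, Sum.elim_inr, e1, e2, ← Finset.mul_sum,
      sum_edgeCoef_mul hN, mul_zero, Finset.sum_const_zero]
    ring
  · rw [sum_triSite]
    simp only [triSnd, Sum.elim_inl, Sum.elim_inr, e1, e2, e3, ← Finset.mul_sum, sum_edgeCoef_site, mul_zero, ite_self,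
      Finset.sum_const_zero]
    ring
  · rw [mem_triSite] at hk
    rcases k with p | p | p
    · exact congrArg (√t * ·) (edgeCoef_flip (p := p) hk σ)
    · rfl
    · exact congrArg (√(1 - t) * ·) (edgeCoef_flip (p := p) hk σ)
  · rw [sum_triSite]
    simp only [triFst, triSnd, Sum.elim_inl, Sum.elim_inr, e1, e3, ← Finset.mul_sum, sum_edgeCoef_site, mul_zero,
      zero_mul, ite_self, Finset.sum_const_zero]
    ring

/-- Splitting a disorder indexed by `TriEdge N` into its three components. -/
def triSplit (N : ℕ) : (TriEdge N → ℝ) ≃ᵐ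
    ((Fin N × Fin N → ℝ) × (Fin N × Fin N → ℝ) × (Fin N × Fin N → ℝ)) :=
  (MeasurableEquiv.sumPiEquivProdPi fun _ => ℝ).trans
    ((MeasurableEquiv.refl _).prodCongr (MeasurableEquiv.sumPiEquivProdPi fun _ => ℝ))

lemma measurePreserving_triSplit (N : ℕ) :
    MeasurePreserving (triSplit N) (gaussVec (TriEdge N)) (disM3 N) := by
  have h1 := measurePreserving_sumPiEquivProdPi
    (fun _ : (Fin N × Fin N) ⊕ ((Fin N × Fin N) ⊕ (Fin N × Fin N)) => gaussianReal 0 1)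
  have h2 := measurePreserving_sumPiEquivProdPi
    (fun _ : (Fin N × Fin N) ⊕ (Fin N × Fin N) => gaussianReal 0 1)
  exact ((MeasurePreserving.id (gaussPi N)).prod h2).comp h1

lemma linH_tri (ω : TriEdge N → ℝ) (x : Config N × Config N) :
    linH (pairCoef (triFst N β t) (triSnd N β t)) ω x =
      hamT N β t (triSplit N ω).1 (triSplit N ω).2.1 x.1 +
        hamT N β t (triSplit N ω).1 (triSplit N ω).2.2 x.2 := by
  have e1 : (triSplit N ω).1 = fun p => ω (Sum.inl p) := rfl
  have e2 : (triSplit N ω).2.1 = fun p => ω (Sum.inr (Sum.inl p)) := rfl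
  have e3 : (triSplit N ω).2.2 = fun p => ω (Sum.inr (Sum.inr p)) := rfl
  rw [linH_pairCoef, e1, e2, e3]
  unfold hamT
  simp only [← linH_edgeCoef, linH, triFst, triSnd, Fintype.sum_sum_type, Sum.elim_inl, Sum.elim_inr,
    mul_assoc, zero_mul, Finset.sum_const_zero, add_zero, zero_add, Finset.mul_sum]

lemma gibbsT_triSplit (ω : TriEdge N → ℝ) (f : Config N × Config N → ℝ) :
    gibbsT N β t (triSplit N ω).1 (triSplit N ω).2.1 (triSplit N ω).2.2 f =
      ∑ x, f x * gibbsProb (linH (pairCoef (triFst N β t) (triSnd N β t)) ω) x := by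
  simp only [gibbsT, gibbsProb, linH_tri, wT, Finset.sum_div, mul_div_assoc]

lemma integral_gibbsT_sub_sq (c : ℝ) :
    ∫ ω, |(N : ℝ) * gibbsT N β t ω.1 ω.2.1 ω.2.2 (fun ρ => ovlp N ρ.1 ρ.2 ^ 2) - c| ^ 2 ∂disM3 N =
      pairFour (triFst N β t) (triSnd N β t) - 2 * pairTwo (triFst N β t) (triSnd N β t) * c +
        c ^ 2 := by
  rw [← (measurePreserving_triSplit N).integral_comp']
  set B := pairCoef (triFst N β t) (triSnd N β t) with hB
  have hpt : ∀ ω, |(N : ℝ) * gibbsT N β t (triSplit N ω).1 (triSplit N ω).2.1 (triSplit N ω).2.2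
      (fun ρ => ovlp N ρ.1 ρ.2 ^ 2) - c| ^ 2 = gav (linH B ω)
      (fun ρ : Fin 2 → Config N × Config N => (pOv (ρ 0) ^ 2 - c) * (pOv (ρ 1) ^ 2 - c)) := by
    intro ω
    rw [gibbsT_triSplit, sq_abs, gav_two, ← hB]
    set p := gibbsProb (linH B ω) with hp
    have h1 : ∑ x, p x = 1 := sum_gibbsProb _
    have h2 : (N : ℝ) * ∑ x : Config N × Config N, ovlp N x.1 x.2 ^ 2 * p x - c =
        ∑ x, (pOv x ^ 2 - c) * p x := by
      simp only [sub_mul, Finset.sum_sub_distrib, ← Finset.mul_sum, h1, mul_one]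
      rw [Finset.mul_sum]
      congr 1
      refine Finset.sum_congr rfl fun x _ => ?_
      rw [pOv, sq_scOv, mul_assoc]
    rw [h2, pow_two, Finset.sum_mul_sum]
    refine Finset.sum_congr rfl fun x _ => Finset.sum_congr rfl fun y _ => ?_
    simp only [Matrix.cons_val_zero, Matrix.cons_val_one]
    ring
  simp only [hpt]
  change nu B _ = _
  have hx : nu B (fun ρ : Fin 2 → Config N × Config N => pOv (ρ 1) ^ 2) =
      pairTwo (triFst N β t) (triSnd N β t) := nu_swap _ fun x _ => pOv x ^ 2
  have e : (fun ρ : Fin 2 → Config N × Config N => (pOv (ρ 0) ^ 2 - c) * (pOv (ρ 1) ^ 2 - c)) =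
      fun ρ => pOv (ρ 0) ^ 2 * pOv (ρ 1) ^ 2 + ((-c) * pOv (ρ 0) ^ 2 +
        ((-c) * pOv (ρ 1) ^ 2 + c ^ 2)) := by
    ext ρ; ring
  rw [e, nu_add, nu_add, nu_add, nu_const_mul, nu_const_mul, nu_const, hx, pairFour, pairTwo]
  ring

end Concrete

lemma exists_pos_le_of_eventually {f : ℕ → ℝ} {q : ℝ} (hq : 0 < q) (hf : ∀ N, 1 ≤ N → 0 < f N)
    (h : ∀ᶠ N in atTop, q ≤ f N) : ∃ c, 0 < c ∧ ∀ N, 1 ≤ N → c ≤ f N := by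
  obtain ⟨M, hM⟩ := eventually_atTop.1 h
  have key : ∀ n, ∃ c, 0 < c ∧ ∀ N, 1 ≤ N → N < n → c ≤ f N := by
    intro n
    induction n with
    | zero => exact ⟨1, one_pos, fun N _ h => absurd h (Nat.not_lt_zero N)⟩
    | succ n ih =>
      obtain ⟨c, hc, h⟩ := ih
      rcases Nat.eq_zero_or_pos n with h0 | h0
      · exact ⟨1, one_pos, fun N h1 h2 => by omega⟩
      · refine ⟨min c (f n), lt_min hc (hf n h0), fun N h1 h2 => ?_⟩
        rcases Nat.lt_succ_iff_lt_or_eq.1 h2 with h3 | h3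
        · exact (min_le_left _ _).trans (h N h1 h3)
        · rw [h3]; exact min_le_right _ _
  obtain ⟨c, hc, h'⟩ := key M
  refine ⟨min c q, lt_min hc hq, fun N hN => ?_⟩
  rcases lt_or_ge N M with h1 | h1
  · exact (min_le_left _ _).trans (h' N hN h1)
  · exact (min_le_right _ _).trans (hM N h1)

lemma exists_pos_le_mul_cube {β : ℕ → ℝ} (hβmem : ∀ N, β N ∈ Set.Ioo (0 : ℝ) 1)
    (hc : (∃ c : ℝ, 0 < c ∧
        Tendsto (fun N : ℕ => (N : ℝ) ^ ((1 : ℝ) / 3) * (1 - β N ^ 2)) atTop (nhds c)) ∨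
      Tendsto (fun N : ℕ => (N : ℝ) ^ ((1 : ℝ) / 3) * (1 - β N ^ 2)) atTop atTop) :
    ∃ c₀ : ℝ, 0 < c₀ ∧ ∀ N : ℕ, 1 ≤ N → c₀ ≤ N * (1 - β N ^ 2) ^ 3 := by
  have hpos : ∀ N, 0 < 1 - β N ^ 2 := fun N => by
    have := hβmem N; nlinarith [this.1, this.2]
  have hq : ∃ q : ℝ, 0 < q ∧
      ∀ᶠ N : ℕ in atTop, q ≤ (N : ℝ) ^ ((1 : ℝ) / 3) * (1 - β N ^ 2) := by
    rcases hc with ⟨c, hc0, hc⟩ | hc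
    · exact ⟨c / 2, half_pos hc0, hc.eventually (eventually_ge_nhds (half_lt_self hc0))⟩
    · exact ⟨1, one_pos, hc.eventually_ge_atTop 1⟩
  obtain ⟨q, hq0, hq⟩ := hq
  obtain ⟨c, hc0, h⟩ := exists_pos_le_of_eventually hq0 (fun N hN =>
    mul_pos (Real.rpow_pos_of_pos (by exact_mod_cast hN) _) (hpos N)) hq
  refine ⟨c ^ 3, by positivity, fun N hN => ?_⟩
  refine (pow_le_pow_left₀ hc0.le (h N hN) 3).trans (le_of_eq ?_)
  rw [mul_pow, ← Real.rpow_natCast, ← Real.rpow_mul (by positivity)]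
  norm_num

/-- Proposition (overlap concentration), part II: second-moment bound on
`N⟨R(σ,τ)²⟩_t − 1/(1−β_N²t)`. -/
theorem sk_overlap_concentration_II
    (β : ℕ → ℝ) (hβmem : ∀ N, β N ∈ Set.Ioo (0 : ℝ) 1)
    (hβlim : Tendsto β atTop (nhds 1))
    (hc : (∃ c : ℝ, 0 < c ∧
        Tendsto (fun N : ℕ => (N : ℝ) ^ ((1 : ℝ) / 3) * (1 - β N ^ 2)) atTop (nhds c)) ∨
      Tendsto (fun N : ℕ => (N : ℝ) ^ ((1 : ℝ) / 3) * (1 - β N ^ 2)) atTop atTop) :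
    ∃ L : ℝ, ∀ N : ℕ, 1 ≤ N → ∀ t ∈ Set.Icc (0 : ℝ) 1,
      (∫ ω, |(N : ℝ) * gibbsT N (β N) t ω.1 ω.2.1 ω.2.2 (fun ρ => ovlp N ρ.1 ρ.2 ^ 2) -
          1 / (1 - β N ^ 2 * t)| ^ 2 ∂disM3 N) ≤
        L * (N : ℝ) ^ (-(3 : ℝ) / 4) * (1 - β N ^ 2) ^ (-(53 : ℝ) / 24) *
            (1 - β N ^ 2 * t) ^ (-(49 : ℝ) / 24) +
          L * (N : ℝ) ^ (-(1 : ℝ) / 2) * (1 - β N ^ 2) ^ (-(4 : ℝ) / 3) *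
            (1 - β N ^ 2 * t) ^ (-(13 : ℝ) / 6) := by
  obtain ⟨c₀, hc₀, hcube⟩ := exists_pos_le_mul_cube hβmem hc
  obtain ⟨L, hL, hbound⟩ := exists_pair_bound hc₀
  refine ⟨L, fun N hN t ht => ?_⟩
  have hδ : 0 < 1 - β N ^ 2 := by nlinarith [(hβmem N).1, (hβmem N).2]
  have hδt : 0 < 1 - β N ^ 2 * t := by nlinarith [sq_nonneg (β N), ht.2]
  have hpair := hbound (TriEdge N) N (β N) t _ _ _ (triPairSystem hN ht) hN hδ ht (hcube N hN)
  have hnonneg : 0 ≤ L * (N : ℝ) ^ (-(3 : ℝ) / 4) * (1 - β N ^ 2) ^ (-(53 : ℝ) / 24) *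
      (1 - β N ^ 2 * t) ^ (-(49 : ℝ) / 24) := by positivity
  rw [integral_gibbsT_sub_sq, mul_one_div, one_div_pow]
  linarith

end
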